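/- arXiv:2105.02536 — 4 statements merged into one kernel-verified Lean document; each statement's English description precedes it below -/
import Mathlib

section
/- Kajihara–Noumi type transformation with deformed variables: assume the balancing condition Σ_{i=1}^m x_i + Σ_{j=1}^{m+n} a_j + sδ = Σ_{i=1}^n X_i + rδ. Then for every k ≥ 0 and all points (x, y, X, Y, a) ∈ ℂ^m × ℂ^r × ℂ^n × ℂ^s × ℂ^{m+n} at which all bracket values occurring in denominators on either side are nonzero, one has: Σ_{μ ∈ ℤ_{≥0}^m, I ⊆ {1,…,r}, |μ|+|I| = k} (−1)^{|I|} ∏_{1≤i<j≤m} [x_i−x_j+(μ_i−μ_j)δ]/[x_i−x_j] · ∏_{i∈I, j∈I^c} [y_i−y_j−δ]/[y_i−y_j] · ∏_{1≤i≤m, j∈I^c} [x_i−y_j−δ]/[x_i−y_j+(μ_i−1)δ] · ∏_{i=1}^m ( (∏_{j=1}^{m+n} [x_i+a_j]_{μ_i}) / (∏_{j=1}^m [x_i−x_j+δ]_{μ_i} · ∏_{j=1}^n [x_i+X_j]_{μ_i}) · ∏_{j=1}^s [x_i+Y_j+μ_iδ]/[x_i+Y_j] ) · ∏_{i∈I}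 ( (∏_{j=1}^{m+n} [y_i+a_j]) / (∏_{j=1}^m [y_i−x_j−μ_jδ] · ∏_{j=1}^n [y_i+X_j]) · ∏_{j=1}^s [y_i+Y_j+δ]/[y_i+Y_j] ) equals the same expression with (m, x, r, y) replaced by (n, X, s, Y), with (n, X, s, Y) replaced by (m, x, r, y), and with each a_j replaced by −a_j; explicitly, Σ_{μ ∈ ℤ_{≥0}^n, I ⊆ {1,…,s}, |μ|+|I| = k} (−1)^{|I|} ∏_{1≤i<j≤n} [X_i−X_j+(μ_i−μ_j)δ]/[X_i−X_j] · ∏_{i∈I, j∈I^c} [Y_i−Y_j−δ]/[Y_i−Y_j] · ∏_{1≤i≤n, j∈I^c} [X_i−Y_j−δ]/[X_i−Y_j+(μ_i−1)δ] · ∏_{i=1}^n ( (∏_{j=1}^{m+n} [X_i−a_j]_{μ_i}) / (∏_{j=1}^n [X_i−X_j+δ]_{μ_i} · ∏_{j=1}^m [X_i+x_j]_{μ_i}) · ∏_{j=1}^r [X_i+y_j+μ_iδ]/[X_i+y_j] ) · ∏_{i∈I} ( (∏_{j=1}^{m+n} [Y_i−a_j]) / (∏_{j=1}^n [Y_i−X_j−μ_jδ]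 · ∏_{j=1}^m [Y_i+x_j]) · ∏_{j=1}^r [Y_i+y_j+δ]/[Y_i+y_j] ). -/
open Finset

/-- Shifted factorial `[x; a]_k` for `k ∈ ℤ`:
`[x; a]_k = [x][x+a]⋯[x+(k-1)a]` for `k ≥ 0` and `[x; a]_{-k} = 1/[x-ka; a]_k`. -/
noncomputable def sfac (br : ℂ → ℂ) (a x : ℂ) (k : ℤ) : ℂ :=
  if 0 ≤ k then ∏ i ∈ Finset.range k.toNat, br (x + (i : ℂ) * a)
  else (∏ i ∈ Finset.range (-k).toNat, br (x + ((k : ℂ) + (i : ℂ)) * a))⁻¹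

/-- Index set of the sums: pairs `(μ, I)` with `μ ∈ ℤ_{≥0}^m`, `I ⊆ {1,…,r}`, `|μ|+|I| = k`. -/
def idxSet (m r k : ℕ) : Finset ((Fin m → ℕ) × Finset (Fin r)) :=
  ((Fintype.piFinset fun _ : Fin m => Finset.range (k + 1)) ×ˢ
      (Finset.univ : Finset (Finset (Fin r)))).filter
    fun p => (∑ i, p.1 i) + p.2.card = k

/-- One side of the Kajihara–Noumi type transformation with deformed variables. -/
noncomputable def KNside (br : ℂ → ℂ) (δ : ℂ) {m r n s N : ℕ} (a : Fin N → ℂ)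
    (x : Fin m → ℂ) (y : Fin r → ℂ) (X : Fin n → ℂ) (Y : Fin s → ℂ) (k : ℕ) : ℂ :=
  ∑ p ∈ idxSet m r k,
    (-1 : ℂ) ^ p.2.card
      * (∏ i : Fin m, ∏ j : Fin m,
          if i < j then
            br (x i - x j + ((p.1 i : ℂ) - (p.1 j : ℂ)) * δ) / br (x i - x j)
          else 1)
      * (∏ i ∈ p.2, ∏ j ∈ p.2ᶜ, br (y i - y j - δ) / br (y i - y j))
      * (∏ i : Fin m, ∏ j ∈ p.2ᶜ,
          br (x i - y j - δ) / br (x i - y j + ((p.1 i : ℂ) - 1) * δ))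
      * (∏ i : Fin m,
          ((∏ j : Fin N, sfac br δ (x i + a j) (p.1 i : ℤ))
              / ((∏ j : Fin m, sfac br δ (x i - x j + δ) (p.1 i : ℤ))
                  * ∏ j : Fin n, sfac br δ (x i + X j) (p.1 i : ℤ)))
            * ∏ j : Fin s, br (x i + Y j + (p.1 i : ℂ) * δ) / br (x i + Y j))
      * ∏ i ∈ p.2,
          ((∏ j : Fin N, br (y i + a j))
              / ((∏ j : Fin m, br (y i - x j - (p.1 j : ℂ) * δ))
                  * ∏ j : Fin n, br (y i + X j)))
            * ∏ j : Fin s, br (y i + Y j + δ) / br (y i + Y j)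

/-- Nonvanishing of all bracket values occurring in denominators of a term of `KNside`. -/
def KNDenomNZ (br : ℂ → ℂ) (δ : ℂ) {m r n s : ℕ}
    (μ : Fin m → ℕ) (I : Finset (Fin r)) (x : Fin m → ℂ) (y : Fin r → ℂ)
    (X : Fin n → ℂ) (Y : Fin s → ℂ) : Prop :=
  (∀ i j : Fin m, i < j → br (x i - x j) ≠ 0)
    ∧ (∀ i ∈ I, ∀ j ∈ Iᶜ, br (y i - y j) ≠ 0)
    ∧ (∀ i : Fin m, ∀ j ∈ Iᶜ, br (x i - y j + ((μ i : ℂ) - 1) * δ) ≠ 0)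
    ∧ (∀ i j : Fin m, sfac br δ (x i - x j + δ) (μ i : ℤ) ≠ 0)
    ∧ (∀ (i : Fin m) (j : Fin n), sfac br δ (x i + X j) (μ i : ℤ) ≠ 0)
    ∧ (∀ (i : Fin m) (j : Fin s), br (x i + Y j) ≠ 0)
    ∧ (∀ i ∈ I, ∀ j : Fin m, br (y i - x j - (μ j : ℂ) * δ) ≠ 0)
    ∧ (∀ i ∈ I, ∀ j : Fin n, br (y i + X j) ≠ 0)
    ∧ (∀ i ∈ I, ∀ j : Fin s, br (y i + Y j) ≠ 0)

/-- The standing assumptions on the bracket: odd, entire, nonzero, with the three-term relation. -/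
structure IsBracket (br : ℂ → ℂ) : Prop where
  odd : ∀ z : ℂ, br (-z) = -br z
  differentiable : Differentiable ℂ br
  ne_zero : br ≠ 0
  three_term : ∀ a b c d : ℂ,
    br (a + b) * br (a - b) * br (c + d) * br (c - d)
      + br (a + d) * br (a - d) * br (b + c) * br (b - c)
      = br (a + c) * br (a - c) * br (b + d) * br (b - d)

namespace IsBracket

variable {br : ℂ → ℂ}

lemma map_zero (h : IsBracket br) : br 0 = 0 := by
  have := h.odd 0
  rw [neg_zero] at this
  exact self_eq_neg.mp this

lemma map_sub_comm (h : IsBracket br) (a b : ℂ) : br (a - b) = -br (b - a) := by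
  rw [← h.odd, neg_sub]

lemma continuous (h : IsBracket br) : Continuous br := h.differentiable.continuous

/-- The zeros of the bracket form a countable set. -/
lemma countable_zeros (h : IsBracket br) : {z | br z = 0}.Countable := by
  obtain ⟨z₀, hz₀⟩ := Function.ne_iff.mp h.ne_zero
  have han : AnalyticOnNhd ℂ br Set.univ := fun z _ => h.differentiable.analyticAt z
  have hcod := han.preimage_zero_mem_codiscrete (x := z₀) hz₀
  have hd := (mem_codiscrete'.mp hcod).2
  have hset : (br ⁻¹' {0}ᶜ)ᶜ = {z | br z = 0} := by ext; simp
  rw [hset] at hd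
  exact (HereditarilyLindelofSpace.isLindelof _).countable hd.to_subtype

/-- A countable family of nonconstant affine arguments is generically away from the zeros. -/
lemma dense_forall_ne_zero (h : IsBracket br) {β : Type*} [Countable β] (c d : β → ℂ)
    (hd : ∀ b, d b ≠ 0) : Dense {t : ℂ | ∀ b, br (c b + d b * t) ≠ 0} := by
  have hcount : (⋃ b, {t : ℂ | br (c b + d b * t) = 0}).Countable := by
    refine Set.countable_iUnion fun b => ?_
    refine h.countable_zeros.preimage_of_injOn (f := fun t => c b + d b * t) ?_
    intro t _ t' _ htt
    exact mul_left_cancel₀ (hd b) (add_left_cancel htt)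
  convert hcount.dense_compl ℝ using 1
  ext t
  simp

/-- Two functions that are continuous at the origin agree there if they agree at generic points. -/
lemma eq_at_zero_of_generic (h : IsBracket br) {β : Type*} [Countable β] (c d : β → ℂ)
    (hd : ∀ b, d b ≠ 0) {F G : ℂ → ℂ} (hF : ContinuousAt F 0) (hG : ContinuousAt G 0)
    (hFG : ∀ t, (∀ b, br (c b + d b * t) ≠ 0) → F t = G t) : F 0 = G 0 := by
  set S := {t : ℂ | ∀ b, br (c b + d b * t) ≠ 0}
  have hS : (nhdsWithin 0 S).NeBot :=
    mem_closure_iff_nhdsWithin_neBot.mp (h.dense_forall_ne_zero c d hd 0)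
  refine tendsto_nhds_unique (hF.mono_left nhdsWithin_le_nhds : Filter.Tendsto F (nhdsWithin 0 S) _)
    (((hG.mono_left nhdsWithin_le_nhds : Filter.Tendsto G (nhdsWithin 0 S) _)).congr' ?_)
  filter_upwards [self_mem_nhdsWithin] with t ht
  exact (hFG t ht).symm

/-- The zeros of the bracket are closed under subtraction. -/
lemma map_sub_eq_zero (h : IsBracket br) {p q : ℂ} (hp : br p = 0) (hq : br q = 0) :
    br (p - q) = 0 := by
  obtain ⟨v, hv⟩ := (h.dense_forall_ne_zero (fun _ : Bool => p)
    (fun b => if b then 1 else -1) (by intro b; cases b <;> simp)).nonempty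
  have h1 : br (p + v) ≠ 0 := by simpa using hv true
  have h2 : br (p - v) ≠ 0 := by simpa [sub_eq_add_neg] using hv false
  have h3 := h.three_term p 0 (p - q) v
  rw [add_zero, sub_zero, hp, show p - (p - q) = q by ring, hq, zero_add, zero_sub, h.odd] at h3
  have h4 : br (p + v) * br (p - v) * (br (p - q) * br (p - q)) = 0 := by linear_combination -h3
  simpa [h1, h2] using h4

/-- The left-hand side of the partial fraction identity. -/
noncomputable def partialFractionSum (br : ℂ → ℂ) (s : Finset ℂ) (P : Multiset ℂ) : ℂ :=
  ∑ w ∈ s, (P.map fun p => br (w - p)).prod / ∏ v ∈ s.erase w, br (w - v)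

lemma partialFractionSum_cons_mem (h : IsBracket br) {s : Finset ℂ} (P : Multiset ℂ)
    (hs : ∀ w ∈ s, ∀ v ∈ s, w ≠ v → br (w - v) ≠ 0) {p : ℂ} (hp : p ∈ s) :
    partialFractionSum br s (p ::ₘ P) = partialFractionSum br (s.erase p) P := by
  unfold partialFractionSum
  rw [← add_sum_erase s _ hp]
  simp only [Multiset.map_cons, Multiset.prod_cons, sub_self, h.map_zero, zero_mul, zero_div,
    zero_add]
  refine sum_congr rfl fun w hw => ?_
  obtain ⟨hwp, hws⟩ := mem_erase.mp hw
  rw [← mul_prod_erase (s.erase w) _ (mem_erase.mpr ⟨hwp.symm, hp⟩), erase_right_comm,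
    mul_div_mul_left _ _ (hs w hws p hp hwp)]

lemma partialFractionSum_exchange (h : IsBracket br) (s : Finset ℂ) (P : Multiset ℂ)
    (b b₁ p q : ℂ) :
    partialFractionSum br s (b ::ₘ b₁ ::ₘ P) * (br (q - p) * br (q + p - (b + b₁)))
      = br (q - b) * br (q - b₁) * partialFractionSum br s (p ::ₘ (b + b₁ - p) ::ₘ P)
        - br (p - b) * br (p - b₁) * partialFractionSum br s (q ::ₘ (b + b₁ - q) ::ₘ P) := by
  unfold partialFractionSum
  rw [sum_mul, mul_sum, mul_sum, ← sum_sub_distrib]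
  refine sum_congr rfl fun w _ => ?_
  simp only [Multiset.map_cons, Multiset.prod_cons]
  have h3 := h.three_term (w - (b + b₁) / 2) ((b₁ - b) / 2) (q - (b + b₁) / 2) (p - (b + b₁) / 2)
  rw [show w - (b + b₁) / 2 + (b₁ - b) / 2 = w - b by ring,
    show w - (b + b₁) / 2 - (b₁ - b) / 2 = w - b₁ by ring,
    show q - (b + b₁) / 2 + (p - (b + b₁) / 2) = q + p - (b + b₁) by ring,
    show q - (b + b₁) / 2 - (p - (b + b₁) / 2) = q - p by ring,
    show w - (b + b₁) / 2 + (p - (b + b₁) / 2) = w - (b + b₁ - p) by ring,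
    show w - (b + b₁) / 2 - (p - (b + b₁) / 2) = w - p by ring,
    show w - (b + b₁) / 2 + (q - (b + b₁) / 2) = w - (b + b₁ - q) by ring,
    show w - (b + b₁) / 2 - (q - (b + b₁) / 2) = w - q by ring,
    show (b₁ - b) / 2 + (q - (b + b₁) / 2) = q - b by ring,
    show (b₁ - b) / 2 - (q - (b + b₁) / 2) = -(q - b₁) by ring,
    show (b₁ - b) / 2 + (p - (b + b₁) / 2) = p - b by ring,
    show (b₁ - b) / 2 - (p - (b + b₁) / 2) = -(p - b₁) by ring, h.odd, h.odd] at h3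
  rw [div_eq_mul_inv, div_eq_mul_inv, div_eq_mul_inv]
  linear_combination (P.map fun p => br (w - p)).prod * (∏ v ∈ s.erase w, br (w - v))⁻¹ * h3

lemma continuous_partialFractionSum (h : IsBracket br) (s : Finset ℂ) (P : Multiset ℂ)
    (b b₁ b₂ : ℂ) : Continuous fun t : ℂ =>
      partialFractionSum br s ((b + t) ::ₘ b₁ ::ₘ (b₂ - t) ::ₘ P) := by
  have := h.continuous
  unfold partialFractionSum
  simp only [Multiset.map_cons, Multiset.prod_cons, div_eq_mul_inv]
  fun_prop

/-- Partial fractions for the bracket. -/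
theorem partialFractionSum_eq_zero (h : IsBracket br) (s : Finset ℂ) (hne : s.Nonempty)
    (hs : ∀ w ∈ s, ∀ v ∈ s, w ≠ v → br (w - v) ≠ 0) (P : Multiset ℂ)
    (hcard : P.card = s.card) (hsum : P.sum = ∑ w ∈ s, w) :
    partialFractionSum br s P = 0 := by
  obtain ⟨n, hn⟩ : ∃ n, s.card = n + 1 := ⟨s.card - 1, by have := hne.card_pos; omega⟩
  induction n generalizing s P with
  | zero =>
    obtain ⟨w, rfl⟩ := card_eq_one.mp hn
    obtain ⟨p, rfl⟩ := Multiset.card_eq_one.mp (hcard.trans hn)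
    simp only [Multiset.sum_singleton, sum_singleton] at hsum
    simp [partialFractionSum, hsum, h.map_zero]
  | succ n ih =>
    obtain ⟨p, hp, q, hq, hpq⟩ := one_lt_card.mp (show 1 < s.card by omega)
    have hgen : ∀ (b b₁ : ℂ) (Q : Multiset ℂ), (b ::ₘ b₁ ::ₘ Q).card = s.card →
        (b ::ₘ b₁ ::ₘ Q).sum = ∑ w ∈ s, w → br (q + p - (b + b₁)) ≠ 0 →
        partialFractionSum br s (b ::ₘ b₁ ::ₘ Q) = 0 := by
      intro b b₁ Q hQ hQs hb
      have hred : ∀ u ∈ s, partialFractionSum br s (u ::ₘ (b + b₁ - u) ::ₘ Q) = 0 := by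
        intro u hu
        rw [h.partialFractionSum_cons_mem _ hs hu]
        have hc := card_erase_of_mem hu
        refine ih (s.erase u) (card_pos.mp (by omega))
          (fun w hw v hv => hs w (mem_of_mem_erase hw) v (mem_of_mem_erase hv)) _ ?_ ?_ (by omega)
        · simp only [Multiset.card_cons] at hQ ⊢
          omega
        · have := add_sum_erase s (fun w => w) hu
          simp only [Multiset.sum_cons] at hQs ⊢
          linear_combination hQs - this
      have hex := h.partialFractionSum_exchange s Q b b₁ p q
      rw [hred p hp, hred q hq, mul_zero, mul_zero, sub_zero] at hex
      exact (mul_eq_zero.mp hex).resolve_right (mul_ne_zero (hs q hq p hp hpq.symm) hb)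
    cases n with
    | zero =>
      have hse : s = {p, q} := by
        refine (eq_of_subset_of_card_le ?_ ?_).symm
        · intro u; simp only [mem_insert, mem_singleton]; rintro (rfl | rfl) <;> assumption
        · rw [card_pair hpq, hn]
      obtain ⟨b, b₁, rfl⟩ := Multiset.card_eq_two.mp (hcard.trans hn)
      subst hse
      have hsum' : b + b₁ = p + q := by
        simpa [sum_pair hpq, Multiset.insert_eq_cons] using hsum
      have hb : b₁ = p + q - b := by linear_combination hsum'
      have h1 : ({p, q} : Finset ℂ).erase p = {q} := by
        ext u; simp only [mem_erase, mem_insert, mem_singleton]; grind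
      have h2 : ({p, q} : Finset ℂ).erase q = {p} := by
        ext u; simp only [mem_erase, mem_insert, mem_singleton]; grind
      rw [partialFractionSum, sum_pair hpq, h1, h2, hb]
      simp only [Multiset.insert_eq_cons, Multiset.map_cons, Multiset.map_singleton,
        Multiset.prod_cons, Multiset.prod_singleton, prod_singleton]
      rw [show p - (p + q - b) = -(q - b) by ring, show q - (p + q - b) = -(p - b) by ring,
        h.map_sub_comm q p, h.odd, h.odd]
      ring
    | succ n =>
      obtain ⟨b, P, rfl⟩ := Multiset.card_pos_iff_exists_mem.mp (show 0 < P.card by omega) |>.imp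
        fun _ => Multiset.exists_cons_of_mem
      rw [Multiset.card_cons] at hcard
      obtain ⟨b₁, P, rfl⟩ := Multiset.card_pos_iff_exists_mem.mp (show 0 < P.card by omega) |>.imp
        fun _ => Multiset.exists_cons_of_mem
      rw [Multiset.card_cons] at hcard
      obtain ⟨b₂, P, rfl⟩ := Multiset.card_pos_iff_exists_mem.mp (show 0 < P.card by omega) |>.imp
        fun _ => Multiset.exists_cons_of_mem
      rw [Multiset.card_cons] at hcard
      have := h.eq_at_zero_of_generic (fun _ : Unit => q + p - (b + b₁)) (fun _ => -1) (by simp)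
        (h.continuous_partialFractionSum s P b b₁ b₂).continuousAt
        (continuousAt_const (y := (0 : ℂ))) ?_
      · simpa using this
      · intro t ht
        refine hgen _ _ _ ?_ ?_ ?_
        · simp only [Multiset.card_cons]; omega
        · rw [← hsum]; simp only [Multiset.sum_cons]; ring
        · convert ht () using 2; ring

/-- Products of `n` brackets in a variable `u`, with shifts adding up to `c`, span the space of
theta functions of degree `n` and characteristic `c`. -/
noncomputable def thetaSpace (br : ℂ → ℂ) (n : ℕ) (c : ℂ) : Submodule ℂ (ℂ → ℂ) :=
  Submodule.span ℂ {f | ∃ P : Multiset ℂ, P.card = n ∧ P.sum = c ∧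
    f = fun u => (P.map fun p => br (u + p)).prod}

lemma mem_thetaSpace_of_eq_prod {ι : Type*} (s : Finset ι) (p : ι → ℂ) {n : ℕ} {c : ℂ}
    {f : ℂ → ℂ} (a : ℂ) (hf : ∀ u, f u = a * ∏ i ∈ s, br (u + p i)) (hn : s.card = n)
    (hc : ∑ i ∈ s, p i = c) : f ∈ thetaSpace br n c := by
  have : f = a • fun u => ∏ i ∈ s, br (u + p i) := by
    ext u; simp [hf u]
  rw [this]
  refine Submodule.smul_mem _ _ (Submodule.subset_span ⟨s.val.map p, ?_, hc, ?_⟩)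
  · simpa using hn
  · ext u; simp only [Multiset.map_map, Function.comp_def, prod_map_val]

/-- Interpolation: a theta function vanishing at as many points as its degree vanishes, as long as
the points are not in special position. -/
lemma eq_zero_of_mem_thetaSpace_of_sum_ne (h : IsBracket br) {n : ℕ} {c : ℂ} {f : ℂ → ℂ}
    (hf : f ∈ thetaSpace br n c) (s : Finset ℂ) (hcard : s.card = n)
    (hs : ∀ w ∈ s, ∀ v ∈ s, w ≠ v → br (w - v) ≠ 0) (hzero : ∀ w ∈ s, f w = 0)
    (hsum : br (c + ∑ w ∈ s, w) ≠ 0) {u : ℂ} (hu : ∀ w ∈ s, br (u - w) ≠ 0) : f u = 0 := by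
  have hus : u ∉ s := fun hmem => hu u hmem (by rw [sub_self, h.map_zero])
  set q := u + c + ∑ w ∈ s, w with hq
  have hlin : ∑ w ∈ insert u s, f w * (br (w - q) / ∏ v ∈ (insert u s).erase w, br (w - v)) = 0 := by
    clear hzero
    induction hf using Submodule.span_induction with
    | mem g hg =>
      obtain ⟨P, hPn, hPc, rfl⟩ := hg
      have := h.partialFractionSum_eq_zero (insert u s) (insert_nonempty _ _) ?_
        (q ::ₘ P.map fun p => -p) ?_ ?_
      · rw [← this, partialFractionSum]
        refine sum_congr rfl fun w _ => ?_
        simp only [Multiset.map_cons, Multiset.prod_cons, Multiset.map_map, Function.comp_def,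
          sub_neg_eq_add]
        ring
      · intro w hw v hv hwv
        rcases mem_insert.mp hw with rfl | hw'
        · exact hu v (mem_of_mem_insert_of_ne hv hwv.symm)
        · rcases mem_insert.mp hv with rfl | hv'
          · rw [h.map_sub_comm]; exact neg_ne_zero.mpr (hu w hw')
          · exact hs w hw' v hv' hwv
      · rw [card_insert_of_notMem hus]; simp [hPn, hcard]
      · rw [sum_insert hus, Multiset.sum_cons, Multiset.sum_map_neg', hPc, hq]; ring
    | zero => simp
    | add g g' _ _ hg hg' =>
      simp only [Pi.add_apply, add_mul, sum_add_distrib, hg, hg', add_zero]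
    | smul a g _ hg =>
      simp only [Pi.smul_apply, smul_eq_mul, mul_assoc, ← mul_sum, hg, mul_zero]
  rw [sum_insert hus, sum_eq_zero (s := s) fun w hw => by rw [hzero w hw, zero_mul], add_zero] at hlin
  refine (mul_eq_zero.mp hlin).resolve_right (div_ne_zero ?_ ?_)
  · rw [show u - q = -(c + ∑ w ∈ s, w) by rw [hq]; ring, h.odd]
    exact neg_ne_zero.mpr hsum
  · rw [erase_insert hus]
    exact prod_ne_zero_iff.mpr hu

/-- A theta function of positive degree with more inequivalent zeros than its degree vanishes. -/
theorem eq_zero_of_mem_thetaSpace (h : IsBracket br) {n : ℕ} {c : ℂ} {f : ℂ → ℂ}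
    (hf : f ∈ thetaSpace br n c) (hn : 1 ≤ n) (s : Finset ℂ) (hcard : s.card = n + 1)
    (hs : ∀ w ∈ s, ∀ v ∈ s, w ≠ v → br (w - v) ≠ 0) (hzero : ∀ w ∈ s, f w = 0)
    {u : ℂ} (hu : ∀ w ∈ s, br (u - w) ≠ 0) : f u = 0 := by
  obtain ⟨p, hp, q, hq, hpq⟩ := one_lt_card.mp (show 1 < s.card by omega)
  have key : ∀ w ∈ s, br (c + ∑ v ∈ s.erase w, v) ≠ 0 → f u = 0 := fun w hw hne =>
    h.eq_zero_of_mem_thetaSpace_of_sum_ne hf (s.erase w) (by rw [card_erase_of_mem hw]; omega)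
      (fun a ha b hb => hs a (mem_of_mem_erase ha) b (mem_of_mem_erase hb))
      (fun a ha => hzero a (mem_of_mem_erase ha)) hne fun a ha => hu a (mem_of_mem_erase ha)
  by_contra hne
  have hp0 : br (c + ∑ v ∈ s.erase p, v) = 0 := by
    by_contra hc; exact hne (key p hp hc)
  have hq0 : br (c + ∑ v ∈ s.erase q, v) = 0 := by
    by_contra hc; exact hne (key q hq hc)
  refine hs q hq p hp hpq.symm ?_
  convert h.map_sub_eq_zero hp0 hq0 using 2
  have h1 := add_sum_erase s (fun v => v) hp
  have h2 := add_sum_erase s (fun v => v) hq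
  linear_combination h2 - h1

end IsBracket

namespace IsBracket

section Source

variable {br : ℂ → ℂ} {δ : ℂ} {ι κ : Type*} [DecidableEq ι] [DecidableEq κ]

/-- A summand of one side of the source identity, indexed by a subset `I` of `S`. -/
noncomputable def sourceTerm (br : ℂ → ℂ) (δ : ℂ) (x : ι → ℂ) (y : κ → ℂ) (S : Finset ι)
    (T : Finset κ) (I : Finset ι) : ℂ :=
  (∏ i ∈ I, ∏ j ∈ S \ I, br (x i - x j - δ) / br (x i - x j))
    * ∏ i ∈ I, ∏ j ∈ T, br (x i + y j + δ) / br (x i + y j)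

/-- One side of the source identity. -/
noncomputable def sourceSum (br : ℂ → ℂ) (δ : ℂ) (x : ι → ℂ) (y : κ → ℂ) (S : Finset ι)
    (T : Finset κ) (k : ℕ) : ℂ :=
  ∑ I ∈ S.powersetCard k, sourceTerm br δ x y S T I

lemma sourceTerm_insert_of_subset (h : IsBracket br) (x : ι → ℂ) (y : κ → ℂ) {S : Finset ι}
    (T : Finset κ) {I : Finset ι} {a : ι} (ha : a ∉ S) (hI : I ⊆ S) :
    sourceTerm br δ x y (insert a S) T I
      = sourceTerm br δ x y S T I * ∏ i ∈ I, br (x a - x i + δ) / br (x a - x i) := by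
  have haI : a ∉ I := fun hc => ha (hI hc)
  have haSI : a ∉ S \ I := fun hc => ha (mem_sdiff.mp hc).1
  have hratio : ∀ i, br (x i - x a - δ) / br (x i - x a) = br (x a - x i + δ) / br (x a - x i) := by
    intro i
    rw [show x i - x a - δ = -(x a - x i + δ) by ring, h.map_sub_comm (x i) (x a), h.odd,
      neg_div_neg_eq]
  unfold sourceTerm
  rw [insert_sdiff_of_notMem _ haI]
  simp only [prod_insert haSI, prod_mul_distrib, hratio]
  ring

lemma sourceTerm_insert_insert (x : ι → ℂ) (y : κ → ℂ) {S : Finset ι}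
    (T : Finset κ) {I : Finset ι} {a : ι} (ha : a ∉ S) (hI : I ⊆ S) :
    sourceTerm br δ x y (insert a S) T (insert a I)
      = sourceTerm br δ x y S T I * (∏ j ∈ S \ I, br (x a - x j - δ) / br (x a - x j))
        * ∏ j ∈ T, br (x a + y j + δ) / br (x a + y j) := by
  have haI : a ∉ I := fun hc => ha (hI hc)
  have hsd : insert a S \ insert a I = S \ I := by
    ext i; simp only [mem_sdiff, mem_insert]; grind
  unfold sourceTerm
  rw [hsd, prod_insert haI, prod_insert haI]
  ring

lemma sourceTerm_insert_right (x : ι → ℂ) (y : κ → ℂ) (S : Finset ι)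
    {T : Finset κ} (I : Finset ι) {b : κ} (hb : b ∉ T) :
    sourceTerm br δ x y S (insert b T) I
      = sourceTerm br δ x y S T I * ∏ i ∈ I, br (x i + y b + δ) / br (x i + y b) := by
  unfold sourceTerm
  simp only [prod_insert hb, prod_mul_distrib]
  ring

lemma sum_powersetCard_succ_insert {M : Type*} [AddCommMonoid M] {S : Finset ι} {a : ι}
    (ha : a ∉ S) (k : ℕ) (f : Finset ι → M) :
    ∑ I ∈ (insert a S).powersetCard (k + 1), f I
      = ∑ I ∈ S.powersetCard (k + 1), f I + ∑ I ∈ S.powersetCard k, f (insert a I) := by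
  rw [powersetCard_succ_insert ha, sum_union, sum_image]
  · intro I hI J hJ hIJ
    have hI' := fun hc => ha ((mem_powersetCard.mp hI).1 hc)
    have hJ' := fun hc => ha ((mem_powersetCard.mp hJ).1 hc)
    rw [← erase_insert hI', ← erase_insert hJ', hIJ]
  · rw [disjoint_left]
    intro I hI hI'
    obtain ⟨J, -, rfl⟩ := mem_image.mp hI'
    exact ha ((mem_powersetCard.mp hI).1 (mem_insert_self _ _))

lemma prod_ite_mem_eq_mul {S I : Finset ι} (hI : I ⊆ S) (f g : ι → ℂ) :
    ∏ i ∈ S, (if i ∈ I then f i else g i) = (∏ i ∈ S \ I, g i) * ∏ i ∈ I, f i := by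
  rw [← prod_sdiff hI]
  congr 1
  · exact prod_congr rfl fun i hi => if_neg (mem_sdiff.mp hi).2
  · exact prod_congr rfl fun i hi => if_pos hi

lemma prod_div_mul_prod_ite {S I : Finset ι} (hI : I ⊆ S) (f g : ι → ℂ)
    (hg : ∀ i ∈ I, g i ≠ 0) :
    (∏ i ∈ I, f i / g i) * ∏ i ∈ S, (if i ∈ I then g i else f i) = ∏ i ∈ S, f i := by
  rw [prod_ite_mem_eq_mul hI, prod_div_distrib, ← prod_sdiff hI]
  have := prod_ne_zero_iff.mpr hg
  field_simp

lemma prod_div_sdiff_mul_prod_ite {S I : Finset ι} (hI : I ⊆ S) (f g : ι → ℂ)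
    (hg : ∀ i ∈ S \ I, g i ≠ 0) :
    (∏ i ∈ S \ I, f i / g i) * ∏ i ∈ S, (if i ∈ I then f i else g i) = ∏ i ∈ S, f i := by
  rw [prod_ite_mem_eq_mul hI, prod_div_distrib, ← prod_sdiff hI]
  have := prod_ne_zero_iff.mpr hg
  field_simp

/-- The difference of the two sides of the source identity, as a function of one variable `u`
of the first family, after clearing denominators. -/
noncomputable def sourceNumerator (br : ℂ → ℂ) (δ : ℂ) (x : ι → ℂ) (y : κ → ℂ) (S : Finset ι)
    (T : Finset κ) (k : ℕ) (u : ℂ) : ℂ :=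
  ∑ I ∈ S.powersetCard (k + 1), sourceTerm br δ x y S T I *
      ((∏ i ∈ S, if i ∈ I then br (u - x i + δ) else br (u - x i)) * ∏ j ∈ T, br (u + y j))
    + ∑ I ∈ S.powersetCard k, sourceTerm br δ x y S T I *
      ((∏ i ∈ S, if i ∈ I then br (u - x i) else br (u - x i - δ)) * ∏ j ∈ T, br (u + y j + δ))
    - ∑ J ∈ T.powersetCard (k + 1), sourceTerm br δ y x T S J *
      ((∏ i ∈ S, br (u - x i)) * ∏ j ∈ T, if j ∈ J then br (u + y j + δ) else br (u + y j))

lemma sourceNumerator_apply (h : IsBracket br) (x : ι → ℂ) (y : κ → ℂ) {S : Finset ι}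
    (T : Finset κ) (k : ℕ) {a : ι} (ha : a ∉ S) (hx : ∀ i ∈ S, br (x a - x i) ≠ 0)
    (hxy : ∀ j ∈ T, br (x a + y j) ≠ 0) :
    sourceNumerator br δ x y S T k (x a)
      = ((∏ i ∈ S, br (x a - x i)) * ∏ j ∈ T, br (x a + y j)) *
        (sourceSum br δ x y (insert a S) T (k + 1)
          - sourceSum br δ y x T (insert a S) (k + 1)) := by
  unfold sourceNumerator sourceSum
  rw [sum_powersetCard_succ_insert ha, mul_sub, mul_add, mul_sum, mul_sum, mul_sum]
  congr 1
  · congr 1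
    · refine sum_congr rfl fun I hI => ?_
      have hI := (mem_powersetCard.mp hI).1
      rw [h.sourceTerm_insert_of_subset x y T ha hI, prod_ite_mem_eq_mul hI, prod_div_distrib,
        ← prod_sdiff hI (f := fun i => br (x a - x i))]
      have := prod_ne_zero_iff.mpr fun i hi => hx i (hI hi)
      field_simp
    · refine sum_congr rfl fun I hI => ?_
      have hI := (mem_powersetCard.mp hI).1
      rw [sourceTerm_insert_insert x y T ha hI, prod_ite_mem_eq_mul hI, prod_div_distrib,
        prod_div_distrib, ← prod_sdiff hI (f := fun i => br (x a - x i))]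
      have h1 := prod_ne_zero_iff.mpr fun i (hi : i ∈ S \ I) => hx i (sdiff_subset hi)
      have h2 := prod_ne_zero_iff.mpr hxy
      field_simp
  · refine sum_congr rfl fun J hJ => ?_
    have hJ := (mem_powersetCard.mp hJ).1
    simp only [sourceTerm_insert_right y x T J ha, prod_ite_mem_eq_mul hJ, prod_div_distrib,
      ← prod_sdiff hJ (f := fun j => br (x a + y j)), add_comm (y _) (x a)]
    have := prod_ne_zero_iff.mpr fun j hj => hxy j (hJ hj)
    field_simp

lemma mul_prod_mul_prod_mem_thetaSpace {S : Finset ι} {T : Finset κ} (p : ι → ℂ) (q : κ → ℂ)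
    {n : ℕ} {c : ℂ} {f : ℂ → ℂ} (a : ℂ)
    (hf : ∀ u, f u = a * ((∏ i ∈ S, br (u + p i)) * ∏ j ∈ T, br (u + q j)))
    (hn : S.card + T.card = n) (hc : ∑ i ∈ S, p i + ∑ j ∈ T, q j = c) :
    f ∈ thetaSpace br n c := by
  refine mem_thetaSpace_of_eq_prod (S.disjSum T) (Sum.elim p q) a (fun u => ?_) ?_ ?_
  · rw [hf, prod_disjSum]; rfl
  · rw [card_disjSum, hn]
  · rw [sum_disjSum, ← hc]; rfl

lemma sum_ite_mem_eq_card_mul {S I : Finset ι} (hI : I ⊆ S) (c : ℂ) :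
    ∑ i ∈ S, (if i ∈ I then c else 0) = I.card * c := by
  rw [sum_ite_mem, inter_eq_right.mpr hI, sum_const, nsmul_eq_mul]

lemma sourceNumerator_mem_thetaSpace (x : ι → ℂ) (y : κ → ℂ) {S : Finset ι} {T : Finset κ}
    (hST : T.card = S.card + 1) (k : ℕ) :
    sourceNumerator br δ x y S T k ∈ thetaSpace br (S.card + T.card)
      (-∑ i ∈ S, x i + ∑ j ∈ T, y j + (k + 1) * δ) := by
  have hcard : (T.card : ℂ) = S.card + 1 := by exact_mod_cast hST
  have hform : sourceNumerator br δ x y S T k =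
      ∑ I ∈ S.powersetCard (k + 1), (fun u => sourceTerm br δ x y S T I *
        ((∏ i ∈ S, br (u + (-x i + if i ∈ I then δ else 0))) * ∏ j ∈ T, br (u + y j)))
      + ∑ I ∈ S.powersetCard k, (fun u => sourceTerm br δ x y S T I *
        ((∏ i ∈ S, br (u + (-x i - δ + if i ∈ I then δ else 0))) * ∏ j ∈ T, br (u + (y j + δ))))
      - ∑ J ∈ T.powersetCard (k + 1), (fun u => sourceTerm br δ y x T S J *
        ((∏ i ∈ S, br (u + -x i)) * ∏ j ∈ T, br (u + (y j + if j ∈ J then δ else 0)))) := by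
    ext u
    simp only [sourceNumerator, Pi.add_apply, Pi.sub_apply, Finset.sum_apply]
    congr 1
    · congr 1
      · refine sum_congr rfl fun I _ => ?_
        congr 2
        refine prod_congr rfl fun i _ => ?_
        split_ifs <;> congr 1 <;> ring
      · refine sum_congr rfl fun I _ => ?_
        congr 2
        · refine prod_congr rfl fun i _ => ?_
          split_ifs <;> congr 1 <;> ring
        · simp only [add_assoc]
    · refine sum_congr rfl fun J _ => ?_
      congr 2
      refine prod_congr rfl fun j _ => ?_
      split_ifs <;> congr 1 <;> ring
  rw [hform]
  refine Submodule.sub_mem _ (Submodule.add_mem _ ?_ ?_) ?_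
  · refine Submodule.sum_mem _ fun I hI => ?_
    obtain ⟨hI, hIk⟩ := mem_powersetCard.mp hI
    refine mul_prod_mul_prod_mem_thetaSpace _ _ _ (fun u => rfl) rfl ?_
    rw [sum_add_distrib, sum_ite_mem_eq_card_mul hI, hIk, sum_neg_distrib]
    push_cast; ring
  · refine Submodule.sum_mem _ fun I hI => ?_
    obtain ⟨hI, hIk⟩ := mem_powersetCard.mp hI
    refine mul_prod_mul_prod_mem_thetaSpace _ _ _ (fun u => rfl) rfl ?_
    rw [sum_add_distrib, sum_ite_mem_eq_card_mul hI, hIk, sum_sub_distrib, sum_neg_distrib, sum_add_distrib, sum_const,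
      sum_const, nsmul_eq_mul, nsmul_eq_mul, hcard]
    ring
  · refine Submodule.sum_mem _ fun J hJ => ?_
    obtain ⟨hJ, hJk⟩ := mem_powersetCard.mp hJ
    refine mul_prod_mul_prod_mem_thetaSpace _ _ _ (fun u => rfl) rfl ?_
    rw [sum_add_distrib, sum_ite_mem_eq_card_mul hJ, hJk, sum_neg_distrib]
    push_cast; ring

lemma sourceNumerator_neg (h : IsBracket br) (x : ι → ℂ) (y : κ → ℂ) {S : Finset ι}
    {T : Finset κ} (k : ℕ) {b : κ} (hb : b ∉ T) (hxy : ∀ i ∈ S, br (x i + y b) ≠ 0)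
    (hyy : ∀ j ∈ T, br (y b - y j) ≠ 0)
    (ih : sourceSum br δ x y S T k = sourceSum br δ y x T S k) :
    sourceNumerator br δ x y S (insert b T) k (-y b) = 0 := by
  have hx : ∀ i, br (x i + y b + δ) / br (x i + y b) = br (-y b - x i - δ) / br (-y b - x i) := by
    intro i
    rw [show -y b - x i - δ = -(x i + y b + δ) by ring, show -y b - x i = -(x i + y b) by ring,
      h.odd, h.odd, neg_div_neg_eq]
  have hx' : ∀ i, br (y b + x i + δ) / br (y b + x i) = br (-y b - x i - δ) / br (-y b - x i) := by
    intro i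
    rw [add_comm (y b), hx]
  have hy : ∀ j, br (y b - y j - δ) / br (y b - y j) = br (-y b + y j + δ) / br (-y b + y j) := by
    intro j
    rw [show -y b + y j + δ = -(y b - y j - δ) by ring, show -y b + y j = -(y b - y j) by ring,
      h.odd, h.odd, neg_div_neg_eq]
  have hxne : ∀ i ∈ S, br (-y b - x i) ≠ 0 := fun i hi => by
    rw [show -y b - x i = -(x i + y b) by ring, h.odd]
    exact neg_ne_zero.mpr (hxy i hi)
  have hyne : ∀ j ∈ T, br (-y b + y j) ≠ 0 := fun j hj => by
    rw [show -y b + y j = -(y b - y j) by ring, h.odd]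
    exact neg_ne_zero.mpr (hyy j hj)
  set C := (∏ i ∈ S, br (-y b - x i - δ)) * (br δ * ∏ j ∈ T, br (-y b + y j + δ)) with hC
  have h1 : ∑ I ∈ S.powersetCard k, sourceTerm br δ x y S (insert b T) I *
      ((∏ i ∈ S, if i ∈ I then br (-y b - x i) else br (-y b - x i - δ))
        * ∏ j ∈ insert b T, br (-y b + y j + δ)) = C * sourceSum br δ x y S T k := by
    rw [sourceSum, mul_sum]
    refine sum_congr rfl fun I hI => ?_
    have hI := (mem_powersetCard.mp hI).1
    have key := prod_div_mul_prod_ite hI (fun i => br (-y b - x i - δ)) (fun i => br (-y b - x i))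
      fun i hi => hxne i (hI hi)
    rw [sourceTerm_insert_right x y S I hb, prod_congr rfl fun i _ => hx i, prod_insert hb, hC,
      neg_add_cancel, zero_add, ← key]
    ring
  have h2 : ∑ J ∈ (insert b T).powersetCard (k + 1), sourceTerm br δ y x (insert b T) S J *
      ((∏ i ∈ S, br (-y b - x i))
        * ∏ j ∈ insert b T, if j ∈ J then br (-y b + y j + δ) else br (-y b + y j))
      = C * sourceSum br δ y x T S k := by
    rw [sum_powersetCard_succ_insert hb, sum_eq_zero, zero_add, sourceSum, mul_sum]
    · refine sum_congr rfl fun J hJ => ?_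
      have hJ := (mem_powersetCard.mp hJ).1
      have hite : ∀ j ∈ T, (if j ∈ insert b J then br (-y b + y j + δ) else br (-y b + y j))
          = if j ∈ J then br (-y b + y j + δ) else br (-y b + y j) := by
        intro j hj
        have : j ≠ b := fun hc => hb (hc ▸ hj)
        simp [this]
      have key := prod_div_sdiff_mul_prod_ite hJ (fun j => br (-y b + y j + δ))
        (fun j => br (-y b + y j)) fun j hj => hyne j (sdiff_subset hj)
      rw [sourceTerm_insert_insert y x S hb hJ, prod_congr rfl fun i _ => hy i,
        prod_congr rfl fun i _ => hx' i, prod_insert hb, if_pos (mem_insert_self _ _),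
        prod_congr rfl hite, hC, neg_add_cancel, zero_add, ← key, prod_div_distrib (s := S)]
      have := prod_ne_zero_iff.mpr hxne
      field_simp
    · intro J hJ
      have hbJ : b ∉ J := fun hc => hb ((mem_powersetCard.mp hJ).1 hc)
      rw [prod_insert hb, if_neg hbJ, neg_add_cancel, h.map_zero]
      ring
  unfold sourceNumerator
  rw [h1, h2, ih, sum_eq_zero, zero_add, sub_self]
  intro I _
  rw [prod_insert hb, neg_add_cancel, h.map_zero]
  ring

lemma sourceNumerator_neg_sub (h : IsBracket br) (x : ι → ℂ) (y : κ → ℂ) {S : Finset ι}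
    {T : Finset κ} (k : ℕ) {b : κ} (hb : b ∉ T) (hxy : ∀ i ∈ S, br (x i + y b) ≠ 0)
    (hyy : ∀ j ∈ T, br (y b - y j) ≠ 0)
    (ih : sourceSum br δ x y S T (k + 1) = sourceSum br δ y x T S (k + 1)) :
    sourceNumerator br δ x y S (insert b T) k (-y b - δ) = 0 := by
  set u := -y b - δ with hu
  have hx : ∀ i, br (x i + y b + δ) / br (x i + y b) = br (u - x i) / br (u - x i + δ) := by
    intro i
    rw [show u - x i + δ = -(x i + y b) by rw [hu]; ring,
      show u - x i = -(x i + y b + δ) by rw [hu]; ring, h.odd, h.odd, neg_div_neg_eq]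
  have hy : ∀ j, br (y b - y j + δ) / br (y b - y j) = br (u + y j) / br (u + y j + δ) := by
    intro j
    rw [show u + y j + δ = -(y b - y j) by rw [hu]; ring,
      show u + y j = -(y b - y j + δ) by rw [hu]; ring, h.odd, h.odd, neg_div_neg_eq]
  have hxne : ∀ i ∈ S, br (u - x i + δ) ≠ 0 := fun i hi => by
    rw [show u - x i + δ = -(x i + y b) by rw [hu]; ring, h.odd]
    exact neg_ne_zero.mpr (hxy i hi)
  have hyne : ∀ j ∈ T, br (u + y j + δ) ≠ 0 := fun j hj => by
    rw [show u + y j + δ = -(y b - y j) by rw [hu]; ring, h.odd]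
    exact neg_ne_zero.mpr (hyy j hj)
  have hub : u + y b + δ = 0 := by rw [hu]; ring
  set C := (∏ i ∈ S, br (u - x i)) * (br (u + y b) * ∏ j ∈ T, br (u + y j)) with hC
  have h1 : ∑ I ∈ S.powersetCard (k + 1), sourceTerm br δ x y S (insert b T) I *
      ((∏ i ∈ S, if i ∈ I then br (u - x i + δ) else br (u - x i))
        * ∏ j ∈ insert b T, br (u + y j)) = C * sourceSum br δ x y S T (k + 1) := by
    rw [sourceSum, mul_sum]
    refine sum_congr rfl fun I hI => ?_
    have hI := (mem_powersetCard.mp hI).1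
    have key := prod_div_mul_prod_ite hI (fun i => br (u - x i)) (fun i => br (u - x i + δ))
      fun i hi => hxne i (hI hi)
    rw [sourceTerm_insert_right x y S I hb, prod_congr rfl fun i _ => hx i, prod_insert hb, hC,
      ← key]
    ring
  have h2 : ∑ J ∈ (insert b T).powersetCard (k + 1), sourceTerm br δ y x (insert b T) S J *
      ((∏ i ∈ S, br (u - x i))
        * ∏ j ∈ insert b T, if j ∈ J then br (u + y j + δ) else br (u + y j))
      = C * sourceSum br δ y x T S (k + 1) := by
    rw [sum_powersetCard_succ_insert hb, sum_eq_zero (s := T.powersetCard k), add_zero, sourceSum,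
      mul_sum]
    · refine sum_congr rfl fun J hJ => ?_
      have hJ := (mem_powersetCard.mp hJ).1
      have key := prod_div_mul_prod_ite hJ (fun j => br (u + y j)) (fun j => br (u + y j + δ))
        fun j hj => hyne j (hJ hj)
      rw [h.sourceTerm_insert_of_subset y x S hb hJ, prod_congr rfl fun i _ => hy i,
        prod_insert hb, if_neg fun hc => hb (hJ hc), hC, ← key]
      ring
    · intro J _
      rw [prod_insert hb, if_pos (mem_insert_self _ _), hub, h.map_zero]
      ring
  unfold sourceNumerator
  rw [h1, h2, ih, sum_eq_zero (s := S.powersetCard k), add_zero, sub_self]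
  intro I _
  rw [prod_insert hb, hub, h.map_zero]
  ring

lemma sourceSum_zero (x : ι → ℂ) (y : κ → ℂ) (S : Finset ι) (T : Finset κ) :
    sourceSum br δ x y S T 0 = 1 := by
  simp [sourceSum, sourceTerm]

/-- The source identity at points in general position. -/
lemma sourceSum_comm_of_generic (h : IsBracket br) (hδ : br δ ≠ 0) (x : ι → ℂ) (y : κ → ℂ)
    (S : Finset ι) (T : Finset κ) (hST : S.card = T.card)
    (hxx : ∀ i ∈ S, ∀ j ∈ S, i ≠ j → br (x i - x j) ≠ 0)
    (hyy : ∀ i ∈ T, ∀ j ∈ T, i ≠ j → br (y i - y j) ≠ 0 ∧ br (y i - y j + δ) ≠ 0)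
    (hxy : ∀ i ∈ S, ∀ j ∈ T, br (x i + y j) ≠ 0 ∧ br (x i + y j + δ) ≠ 0) (k : ℕ) :
    sourceSum br δ x y S T k = sourceSum br δ y x T S k := by
  induction S using Finset.induction_on generalizing T k with
  | empty =>
    rw [card_empty, eq_comm, card_eq_zero] at hST
    subst hST
    cases k with
    | zero => rw [sourceSum_zero, sourceSum_zero]
    | succ k =>
      rw [sourceSum, sourceSum, powersetCard_eq_empty.mpr (by simp),
        powersetCard_eq_empty.mpr (by simp), sum_empty, sum_empty]
  | insert a S ha ih =>
    cases k with
    | zero => rw [sourceSum_zero, sourceSum_zero]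
    | succ k =>
      rw [card_insert_of_notMem ha] at hST
      have hxa : ∀ i ∈ S, br (x a - x i) ≠ 0 := fun i hi =>
        hxx a (mem_insert_self _ _) i (mem_insert_of_mem hi) fun hc => ha (hc ▸ hi)
      have hxya : ∀ j ∈ T, br (x a + y j) ≠ 0 ∧ br (x a + y j + δ) ≠ 0 :=
        hxy a (mem_insert_self _ _)
      have ih' : ∀ b ∈ T, ∀ l, sourceSum br δ x y S (T.erase b) l
          = sourceSum br δ y x (T.erase b) S l := fun b hb l =>
        ih (T.erase b) (by rw [card_erase_of_mem hb]; omega)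
          (fun i hi j hj => hxx i (mem_insert_of_mem hi) j (mem_insert_of_mem hj))
          (fun i hi j hj => hyy i (mem_of_mem_erase hi) j (mem_of_mem_erase hj))
          (fun i hi j hj => hxy i (mem_insert_of_mem hi) j (mem_of_mem_erase hj)) l
      have hyyδ : ∀ i ∈ T, ∀ j ∈ T, br (y i - y j + δ) ≠ 0 := by
        intro i hi j hj
        by_cases hij : i = j
        · rwa [hij, sub_self, zero_add]
        · exact (hyy i hi j hj hij).2
      have hinj : Set.InjOn y T := by
        intro i hi j hj hij
        by_contra hne
        exact (hyy i hi j hj hne).1 (by rw [hij, sub_self, h.map_zero])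
      set Z := T.image (fun j => -y j) ∪ T.image (fun j => -y j - δ) with hZ
      have hmem : ∀ w ∈ Z, ∃ j ∈ T, w = -y j ∨ w = -y j - δ := by
        intro w hw
        rcases mem_union.mp hw with hw | hw <;> obtain ⟨j, hj, rfl⟩ := mem_image.mp hw
        · exact ⟨j, hj, Or.inl rfl⟩
        · exact ⟨j, hj, Or.inr rfl⟩
      have hnum : sourceNumerator br δ x y S T k (x a) = 0 := by
        refine h.eq_zero_of_mem_thetaSpace (sourceNumerator_mem_thetaSpace x y hST.symm k)
          (by omega) Z ?_ ?_ ?_ ?_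
        · rw [hZ, card_union_of_disjoint, card_image_of_injOn, card_image_of_injOn]
          · omega
          · intro i hi j hj hij
            exact hinj hi hj (neg_inj.mp (sub_left_inj.mp hij))
          · intro i hi j hj hij
            exact hinj hi hj (neg_inj.mp hij)
          · rw [disjoint_left]
            intro w hw hw'
            obtain ⟨i, hi, rfl⟩ := mem_image.mp hw
            obtain ⟨j, hj, hij⟩ := mem_image.mp hw'
            refine hyyδ j hj i hi ?_
            rw [show y j - y i + δ = -y i - (-y j - δ) by ring, hij, sub_self, h.map_zero]
        · intro w hw v hv hwv
          obtain ⟨i, hi, rfl | rfl⟩ := hmem w hw <;> obtain ⟨j, hj, rfl | rfl⟩ := hmem v hv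
          · have hij : j ≠ i := fun hc => hwv (by rw [hc])
            convert (hyy j hj i hi hij).1 using 2; ring
          · convert hyyδ j hj i hi using 2; ring
          · rw [h.map_sub_comm, neg_ne_zero]
            convert hyyδ i hi j hj using 2; ring
          · have hij : j ≠ i := fun hc => hwv (by rw [hc])
            convert (hyy j hj i hi hij).1 using 2; ring
        · intro w hw
          obtain ⟨b, hb, hwb⟩ := hmem w hw
          have h1 : ∀ i ∈ S, br (x i + y b) ≠ 0 := fun i hi => (hxy i (mem_insert_of_mem hi) b hb).1
          have h2 : ∀ j ∈ T.erase b, br (y b - y j) ≠ 0 := fun j hj =>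
            (hyy b hb j (mem_of_mem_erase hj) (ne_of_mem_erase hj).symm).1
          rw [← insert_erase hb]
          rcases hwb with rfl | rfl
          · exact h.sourceNumerator_neg x y k (notMem_erase _ _) h1 h2 (ih' b hb k)
          · exact h.sourceNumerator_neg_sub x y k (notMem_erase _ _) h1 h2 (ih' b hb (k + 1))
        · intro w hw
          obtain ⟨j, hj, rfl | rfl⟩ := hmem w hw
          · rw [sub_neg_eq_add]; exact (hxya j hj).1
          · convert (hxya j hj).2 using 2; ring
      rw [h.sourceNumerator_apply x y T k ha hxa fun j hj => (hxya j hj).1] at hnum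
      refine sub_eq_zero.mp ((mul_eq_zero.mp hnum).resolve_left (mul_ne_zero ?_ ?_))
      · exact prod_ne_zero_iff.mpr hxa
      · exact prod_ne_zero_iff.mpr fun j hj => (hxya j hj).1

lemma continuousAt_sourceSum (h : IsBracket br) {x : ℂ → ι → ℂ} {y : ℂ → κ → ℂ}
    (S : Finset ι) (T : Finset κ) (k : ℕ) (hxc : ∀ i, Continuous fun t => x t i)
    (hyc : ∀ j, Continuous fun t => y t j)
    (hxx : ∀ i ∈ S, ∀ j ∈ S, i ≠ j → br (x 0 i - x 0 j) ≠ 0)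
    (hxy : ∀ i ∈ S, ∀ j ∈ T, br (x 0 i + y 0 j) ≠ 0) :
    ContinuousAt (fun t => sourceSum br δ (x t) (y t) S T k) 0 := by
  have hc := h.continuous
  unfold sourceSum sourceTerm
  refine tendsto_finsetSum _ fun I hI => ?_
  have hI := (mem_powersetCard.mp hI).1
  refine Filter.Tendsto.mul ?_ ?_
  · refine tendsto_finsetProd _ fun i hi => tendsto_finsetProd _ fun j hj => ?_
    refine ContinuousAt.div (by fun_prop) (by fun_prop) ?_
    obtain ⟨hjS, hjI⟩ := mem_sdiff.mp hj
    exact hxx i (hI hi) j hjS fun hc => hjI (hc ▸ hi)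
  · refine tendsto_finsetProd _ fun i hi => tendsto_finsetProd _ fun j hj => ?_
    exact ContinuousAt.div (by fun_prop) (by fun_prop) (hxy i (hI hi) j hj)

/-- The source identity. -/
theorem sourceSum_comm [Countable ι] [Countable κ] (h : IsBracket br) (hδ : br δ ≠ 0)
    (x : ι → ℂ) (y : κ → ℂ) (S : Finset ι) (T : Finset κ) (hST : S.card = T.card)
    (hxx : ∀ i ∈ S, ∀ j ∈ S, i ≠ j → br (x i - x j) ≠ 0)
    (hyy : ∀ i ∈ T, ∀ j ∈ T, i ≠ j → br (y i - y j) ≠ 0)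
    (hxy : ∀ i ∈ S, ∀ j ∈ T, br (x i + y j) ≠ 0) (k : ℕ) :
    sourceSum br δ x y S T k = sourceSum br δ y x T S k := by
  obtain ⟨f, hf⟩ := exists_injective_nat ι
  obtain ⟨g, hg⟩ := exists_injective_nat κ
  set xt : ℂ → ι → ℂ := fun t i => x i + (f i + 1) * t with hxt
  set yt : ℂ → κ → ℂ := fun t j => y j + (g j + 1) * t with hyt
  have hx0 : xt 0 = x := by ext i; simp [hxt]
  have hy0 : yt 0 = y := by ext i; simp [hyt]
  have hxc : ∀ i, Continuous fun t => xt t i := fun i => by fun_prop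
  have hyc : ∀ j, Continuous fun t => yt t j := fun j => by fun_prop
  have key := h.eq_at_zero_of_generic
    (β := {p : ι × ι // p.1 ≠ p.2} ⊕ ({p : κ × κ // p.1 ≠ p.2} × Bool) ⊕ ((ι × κ) × Bool))
    (Sum.elim (fun p => x p.1.1 - x p.1.2) (Sum.elim
      (fun p => y p.1.1.1 - y p.1.1.2 + if p.2 then δ else 0)
      (fun p => x p.1.1 + y p.1.2 + if p.2 then δ else 0)))
    (Sum.elim (fun p => (f p.1.1 : ℂ) - f p.1.2) (Sum.elim
      (fun p => (g p.1.1.1 : ℂ) - g p.1.1.2)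
      (fun p => (f p.1.1 : ℂ) + g p.1.2 + 2))) ?_
    (F := fun t => sourceSum br δ (xt t) (yt t) S T k)
    (G := fun t => sourceSum br δ (yt t) (xt t) T S k) ?_ ?_ ?_
  · simpa only [hx0, hy0] using key
  · rintro (⟨p, hp⟩ | ⟨⟨p, hp⟩, b⟩ | ⟨p, b⟩)
    · simpa [sub_eq_zero] using fun hc => hp (hf hc)
    · simpa [sub_eq_zero] using fun hc => hp (hg hc)
    · simp only [Sum.elim_inr]
      exact_mod_cast (by omega : f p.1 + g p.2 + 2 ≠ 0)
  · exact h.continuousAt_sourceSum S T k hxc hyc (by rwa [hx0]) (by rwa [hx0, hy0])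
  · exact h.continuousAt_sourceSum T S k hyc hxc (by rwa [hy0])
      (by rw [hx0, hy0]; intro j hj i hi; rw [add_comm]; exact hxy i hi j hj)
  · intro t ht
    refine h.sourceSum_comm_of_generic hδ _ _ S T hST ?_ ?_ ?_ k
    · intro i _ j _ hij
      convert ht (Sum.inl ⟨(i, j), hij⟩) using 2
      simp only [hxt, Sum.elim_inl]; ring
    · intro i _ j _ hij
      constructor
      · convert ht (Sum.inr (Sum.inl (⟨(i, j), hij⟩, false))) using 2
        simp [hyt]; ring
      · convert ht (Sum.inr (Sum.inl (⟨(i, j), hij⟩, true))) using 2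
        simp [hyt]; ring
    · intro i _ j _
      constructor
      · convert ht (Sum.inr (Sum.inr ((i, j), false))) using 2
        simp [hxt, hyt]; ring
      · convert ht (Sum.inr (Sum.inr ((i, j), true))) using 2
        simp [hxt, hyt]; ring

end Source

end IsBracket

namespace IsBracket

section Strings

variable {br : ℂ → ℂ} {δ : ℂ} {ι κ : Type*} [Fintype ι] [DecidableEq ι] [Fintype κ]
  [DecidableEq κ]

/-- The shifted factorial with a natural number of factors. -/
noncomputable def rising (br : ℂ → ℂ) (δ z : ℂ) (n : ℕ) : ℂ :=
  ∏ l ∈ range n, br (z + l * δ)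

/-- One side of the Kajihara–Noumi transformation without deformed variables, with the
factors coming from the first family written symmetrically. -/
noncomputable def knSum {α : Type*} [Fintype α] (br : ℂ → ℂ) (δ : ℂ) (x : ι → ℂ) (X : κ → ℂ)
    (a : α → ℂ) (k : ℕ) : ℂ :=
  ∑ μ ∈ piAntidiag (univ : Finset ι) k, ∏ i, (∏ j, rising br δ (x i + a j) (μ i)) /
    ((∏ j, rising br δ (x i - x j - μ j * δ) (μ i)) * ∏ j, rising br δ (x i + X j) (μ i))

/-- No two of the variables differ by a multiple of `δ`, up to zeros of the bracket. -/
structure InGeneralPosition (br : ℂ → ℂ) (δ : ℂ) (x : ι → ℂ) (X : κ → ℂ) : Prop where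
  left : ∀ i j, i ≠ j → ∀ n : ℤ, br (x i - x j + n * δ) ≠ 0
  right : ∀ i j, i ≠ j → ∀ n : ℤ, br (X i - X j + n * δ) ≠ 0
  cross : ∀ i j, ∀ n : ℤ, br (x i + X j + n * δ) ≠ 0

lemma InGeneralPosition.symm {x : ι → ℂ} {X : κ → ℂ} (hg : InGeneralPosition br δ x X) :
    InGeneralPosition br δ X x :=
  ⟨hg.right, hg.left, fun i j n => by rw [add_comm (X i)]; exact hg.cross j i n⟩

lemma map_int_mul_ne_zero (h : IsBracket br) (hδ : ∀ n : ℕ, 1 ≤ n → br (n * δ) ≠ 0) {n : ℤ}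
    (hn : n ≠ 0) : br (n * δ) ≠ 0 := by
  obtain ⟨l, rfl | rfl⟩ := Int.eq_nat_or_neg n
  · exact_mod_cast hδ l (by omega)
  · rw [Int.cast_neg, neg_mul, h.odd, neg_ne_zero]
    exact_mod_cast hδ l (by omega)

lemma prod_Ico_div_of_ne_zero {f : ℕ → ℂ} {m n : ℕ} (hmn : m ≤ n)
    (hf : ∀ l, m ≤ l → f l ≠ 0) : ∏ l ∈ Ico m n, f (l + 1) / f l = f n / f m := by
  induction n, hmn using Nat.le_induction with
  | base => simp [hf m le_rfl]
  | succ n hmn ih =>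
    rw [prod_Ico_succ_top hmn, ih]
    have h1 := hf m le_rfl
    have h2 := hf n hmn
    field_simp

/-- The disjoint union of strings of lengths `M`. -/
def strings (M : ι → ℕ) : Finset (Σ _ : ι, ℕ) := univ.sigma fun i => range (M i)

lemma mem_strings {M : ι → ℕ} {p : Σ _ : ι, ℕ} : p ∈ strings M ↔ p.2 < M p.1 := by
  simp [strings]

lemma card_strings (M : ι → ℕ) : (strings M).card = ∑ i, M i := by
  simp [strings]

lemma strings_sdiff (M μ : ι → ℕ) :
    strings M \ strings μ = univ.sigma fun i => Ico (μ i) (M i) := by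
  ext p
  simp only [mem_sdiff, mem_strings, mem_sigma, mem_univ, true_and, mem_Ico]
  omega

lemma sourceTerm_strings_eq_zero (h : IsBracket br) (x : ι → ℂ) (y : (Σ _ : κ, ℕ) → ℂ)
    (M : ι → ℕ) (T : Finset (Σ _ : κ, ℕ)) {I : Finset (Σ _ : ι, ℕ)} (hI : I ⊆ strings M)
    (hI' : ∀ μ : ι → ℕ, strings μ ≠ I) :
    sourceTerm br δ (fun p => x p.1 + p.2 * δ) y (strings M) T I = 0 := by
  have hex : ∃ (i : ι) (l : ℕ), (⟨i, l + 1⟩ : Σ _ : ι, ℕ) ∈ I ∧ (⟨i, l⟩ : Σ _ : ι, ℕ) ∉ I := by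
    by_contra! hc
    have hfin : ∀ i, ∃ l, (⟨i, l⟩ : Σ _ : ι, ℕ) ∉ I := fun i =>
      ⟨M i, fun hmem => lt_irrefl _ (mem_strings.mp (hI hmem))⟩
    refine hI' (fun i => Nat.find (hfin i)) ?_
    ext ⟨i, l⟩
    rw [mem_strings]
    refine ⟨fun hl => by_contra fun hmem => Nat.find_min (hfin i) hl hmem, fun hmem => ?_⟩
    by_contra! hl
    have : ∀ l, Nat.find (hfin i) ≤ l → (⟨i, l⟩ : Σ _ : ι, ℕ) ∉ I := by
      intro l hl
      induction l, hl using Nat.le_induction with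
      | base => exact Nat.find_spec (hfin i)
      | succ l _ ih => exact fun hmem => ih (hc i l hmem)
    exact this l hl hmem
  obtain ⟨i, l, hmem, hnot⟩ := hex
  have hlM : (⟨i, l⟩ : Σ _ : ι, ℕ) ∈ strings M \ I := by
    refine mem_sdiff.mpr ⟨mem_strings.mpr ?_, hnot⟩
    have : l + 1 < M i := mem_strings.mp (hI hmem)
    exact (Nat.lt_succ_self l).trans this
  unfold sourceTerm
  refine mul_eq_zero_of_left (prod_eq_zero hmem (prod_eq_zero hlM ?_)) _
  rw [show x i + ((l + 1 : ℕ) : ℂ) * δ - (x i + (l : ℂ) * δ) - δ = 0 by push_cast; ring,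
    h.map_zero, zero_div]

lemma prod_range_prod_div_eq (z : ℂ) (n m₀ m₁ : ℕ) (hm : m₀ ≤ m₁)
    (hz : ∀ l < n, ∀ l', m₀ ≤ l' → br (z + l * δ - l' * δ) ≠ 0) :
    ∏ l ∈ range n, ∏ l' ∈ Ico m₀ m₁, br (z + l * δ - l' * δ - δ) / br (z + l * δ - l' * δ)
      = rising br δ (z - m₁ * δ) n / rising br δ (z - m₀ * δ) n := by
  unfold rising
  rw [← prod_div_distrib]
  refine prod_congr rfl fun l hl => ?_
  have key := prod_Ico_div_of_ne_zero (f := fun l' : ℕ => br (z + l * δ - l' * δ)) hm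
    (hz l (mem_range.mp hl))
  convert key using 2
  · congr 2
    push_cast; ring
  · congr 1; ring
  · congr 1; ring

lemma prod_range_prod_range_div_eq (z : ℂ) (n m : ℕ)
    (hz : ∀ l < n, ∀ l' : ℕ, br (z + l * δ + l' * δ) ≠ 0) :
    ∏ l ∈ range n, ∏ l' ∈ range m, br (z + l * δ + l' * δ + δ) / br (z + l * δ + l' * δ)
      = rising br δ (z + m * δ) n / rising br δ z n := by
  unfold rising
  rw [← prod_div_distrib]
  refine prod_congr rfl fun l hl => ?_
  have key := prod_Ico_div_of_ne_zero (f := fun l' : ℕ => br (z + l * δ + l' * δ)) (Nat.zero_le m)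
    fun l' _ => hz l (mem_range.mp hl) l'
  rw [← range_eq_Ico] at key
  convert key using 2
  · congr 2
    push_cast; ring
  · congr 1; ring
  · congr 1; push_cast; ring

lemma sourceTerm_strings (h : IsBracket br) (hδ : ∀ n : ℕ, 1 ≤ n → br (n * δ) ≠ 0) {x : ι → ℂ}
    {X : κ → ℂ} (hg : InGeneralPosition br δ x X) (M : ι → ℕ) (N : κ → ℕ) {μ : ι → ℕ}
    (hμ : ∀ i, μ i ≤ M i) :
    sourceTerm br δ (fun p => x p.1 + p.2 * δ) (fun p => X p.1 + p.2 * δ) (strings M) (strings N)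
        (strings μ)
      = ∏ i, ((∏ j, rising br δ (x i - x j - M j * δ) (μ i))
          * ∏ j, rising br δ (x i + X j + N j * δ) (μ i)) /
        ((∏ j, rising br δ (x i - x j - μ j * δ) (μ i)) * ∏ j, rising br δ (x i + X j) (μ i)) := by
  unfold sourceTerm
  rw [strings_sdiff]
  simp only [strings, prod_sigma, mul_div_mul_comm, ← prod_div_distrib, prod_mul_distrib]
  congr 1
  · refine prod_congr rfl fun i _ => ?_
    rw [prod_comm]
    refine prod_congr rfl fun j _ => ?_
    rw [← prod_range_prod_div_eq (x i - x j) (μ i) (μ j) (M j) (hμ j)]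
    · refine prod_congr rfl fun l _ => prod_congr rfl fun l' _ => ?_
      congr 2 <;> ring
    · intro l hl l' hl'
      by_cases hij : i = j
      · subst hij
        convert h.map_int_mul_ne_zero hδ (n := (l : ℤ) - l') (by omega) using 2
        push_cast; ring
      · convert hg.left i j hij ((l : ℤ) - l') using 2
        push_cast; ring
  · refine prod_congr rfl fun i _ => ?_
    rw [prod_comm]
    refine prod_congr rfl fun j _ => ?_
    rw [← prod_range_prod_range_div_eq (x i + X j) (μ i) (N j)]
    · refine prod_congr rfl fun l _ => prod_congr rfl fun l' _ => ?_
      congr 2 <;> ring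
    · intro l _ l'
      convert hg.cross i j ((l : ℤ) + l') using 2
      push_cast; ring

lemma rising_neg_mul_eq_zero (h : IsBracket br) {m n : ℕ} (hmn : m < n) :
    rising br δ (-(m * δ)) n = 0 := by
  refine prod_eq_zero (mem_range.mpr hmn) ?_
  rw [neg_add_cancel, h.map_zero]

lemma sourceSum_strings (h : IsBracket br) (hδ : ∀ n : ℕ, 1 ≤ n → br (n * δ) ≠ 0) {x : ι → ℂ}
    {X : κ → ℂ} (hg : InGeneralPosition br δ x X) (M : ι → ℕ) (N : κ → ℕ) (k : ℕ) :
    sourceSum br δ (fun p => x p.1 + p.2 * δ) (fun p => X p.1 + p.2 * δ) (strings M) (strings N) k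
      = ∑ μ ∈ piAntidiag (univ : Finset ι) k,
        ∏ i, ((∏ j, rising br δ (x i - x j - M j * δ) (μ i))
          * ∏ j, rising br δ (x i + X j + N j * δ) (μ i)) /
        ((∏ j, rising br δ (x i - x j - μ j * δ) (μ i)) * ∏ j, rising br δ (x i + X j) (μ i)) := by
  rw [← sum_filter_of_ne (p := fun μ => ∀ i, μ i ≤ M i)]
  · symm
    refine sum_of_injOn strings ?_ ?_ ?_ ?_
    · intro μ _ ν _ hμν
      funext i
      have : ∀ l, l < μ i ↔ l < ν i := fun l => by
        rw [← mem_strings (p := ⟨i, l⟩), hμν, mem_strings]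
      exact le_antisymm (by by_contra! hc; exact lt_irrefl _ ((this _).mp hc))
        (by by_contra! hc; exact lt_irrefl _ ((this _).mpr hc))
    · intro μ hμ
      obtain ⟨hμk, hμM⟩ := mem_filter.mp hμ
      refine mem_powersetCard.mpr ⟨fun p hp => ?_, ?_⟩
      · exact mem_strings.mpr ((mem_strings.mp hp).trans_le (hμM p.1))
      · rw [card_strings, (mem_piAntidiag.mp hμk).1]
    · intro I hI hnot
      obtain ⟨hIM, hIk⟩ := mem_powersetCard.mp hI
      refine h.sourceTerm_strings_eq_zero x _ M _ hIM fun μ hμ => hnot ⟨μ, ?_, hμ⟩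
      subst hμ
      refine mem_filter.mpr ⟨mem_piAntidiag.mpr ⟨by rw [← card_strings, hIk], by simp⟩, fun i => ?_⟩
      by_contra! hc
      have hmem : (⟨i, M i⟩ : Σ _ : ι, ℕ) ∈ strings M := hIM (mem_strings.mpr hc)
      exact lt_irrefl _ (mem_strings.mp hmem)
    · intro μ hμ
      exact (h.sourceTerm_strings hδ hg M N (mem_filter.mp hμ).2).symm
  · intro μ _ hne i
    by_contra! hc
    refine hne (prod_eq_zero (mem_univ i) ?_)
    rw [prod_eq_zero (mem_univ i), zero_mul, zero_div]
    rw [sub_self, zero_sub]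
    exact h.rising_neg_mul_eq_zero hc

/-- The transformation when the parameters `a` differ from the variables by multiples of `δ`. -/
theorem knSum_comm_strings (h : IsBracket br) (hδ : ∀ n : ℕ, 1 ≤ n → br (n * δ) ≠ 0) {x : ι → ℂ}
    {X : κ → ℂ} (hg : InGeneralPosition br δ x X) (M : ι → ℕ) (N : κ → ℕ)
    (hMN : ∑ i, M i = ∑ j, N j) (k : ℕ) :
    knSum br δ x X (Sum.elim (fun i => -x i - M i * δ) fun j => X j + N j * δ) k
      = knSum br δ X x (fun p => -(Sum.elim (fun i => -x i - M i * δ) (fun j => X j + N j * δ) p))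
        k := by
  have h1 : br δ ≠ 0 := by simpa using hδ 1 le_rfl
  have key := h.sourceSum_comm h1 (fun p : Σ _ : ι, ℕ => x p.1 + p.2 * δ)
    (fun p : Σ _ : κ, ℕ => X p.1 + p.2 * δ) (strings M) (strings N)
    (by rw [card_strings, card_strings, hMN]) ?_ ?_ ?_ k
  · rw [h.sourceSum_strings hδ hg, h.sourceSum_strings hδ hg.symm] at key
    unfold knSum
    simp only [Fintype.prod_sum_type, Sum.elim_inl, Sum.elim_inr]
    convert key using 1
    · refine sum_congr rfl fun μ _ => prod_congr rfl fun i _ => ?_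
      congr 2
      · exact prod_congr rfl fun j _ => congrArg (rising br δ · _) (by ring)
      · exact prod_congr rfl fun j _ => congrArg (rising br δ · _) (by ring)
    · refine sum_congr rfl fun μ _ => prod_congr rfl fun i _ => ?_
      rw [mul_comm]
      congr 2
      · exact prod_congr rfl fun j _ => congrArg (rising br δ · _) (by ring)
      · exact prod_congr rfl fun j _ => congrArg (rising br δ · _) (by ring)
  · rintro ⟨i, l⟩ _ ⟨j, l'⟩ _ hne
    by_cases hij : i = j
    · subst hij
      convert h.map_int_mul_ne_zero hδ (n := (l : ℤ) - l') (by grind) using 2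
      push_cast; ring
    · convert hg.left i j hij ((l : ℤ) - l') using 2
      push_cast; ring
  · rintro ⟨i, l⟩ _ ⟨j, l'⟩ _ hne
    by_cases hij : i = j
    · subst hij
      convert h.map_int_mul_ne_zero hδ (n := (l : ℤ) - l') (by grind) using 2
      push_cast; ring
    · convert hg.right i j hij ((l : ℤ) - l') using 2
      push_cast; ring
  · rintro ⟨i, l⟩ _ ⟨j, l'⟩ _
    convert hg.cross i j ((l : ℤ) + l') using 2
    push_cast; ring

end Strings

end IsBracket

namespace IsBracket

section Continuation

variable {br : ℂ → ℂ} {δ : ℂ} {ι κ α : Type*} [Fintype ι] [DecidableEq ι] [Fintype κ]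
  [DecidableEq κ] [Fintype α] [DecidableEq α]

lemma knSum_zero (x : ι → ℂ) (X : κ → ℂ) (a : α → ℂ) : knSum br δ x X a 0 = 1 := by
  simp [knSum, rising]

/-- If two of the parameters move in opposite directions, one side of the transformation is a
theta function. -/
lemma knSum_mem_thetaSpace (x : ι → ℂ) (X : κ → ℂ) (b : ℂ → α → ℂ) (c e e' : ℂ → ℂ) (D : ℂ)
    (he : ∀ z, e z + e' z = D)
    (hb : ∀ t z, ∏ j, br (z + b t j) = c z * (br (t + e z) * br (t + e' z))) (k : ℕ) :
    (fun t => knSum br δ x X (b t) k) ∈ thetaSpace br (k + k) (k * D) := by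
  have hform : (fun t => knSum br δ x X (b t) k) = ∑ μ ∈ piAntidiag (univ : Finset ι) k,
      fun t => ∏ i, (∏ j, rising br δ (x i + b t j) (μ i)) /
        ((∏ j, rising br δ (x i - x j - μ j * δ) (μ i)) * ∏ j, rising br δ (x i + X j) (μ i)) := by
    ext t; simp only [knSum, Finset.sum_apply]
  rw [hform]
  refine Submodule.sum_mem _ fun μ hμ => ?_
  have hμk : (strings μ).card = k := by rw [card_strings, (mem_piAntidiag.mp hμ).1]
  refine mul_prod_mul_prod_mem_thetaSpace (S := strings μ) (T := strings μ)
    (fun p => e (x p.1 + p.2 * δ)) (fun p => e' (x p.1 + p.2 * δ))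
    ((∏ p ∈ strings μ, c (x p.1 + p.2 * δ)) / ∏ i, ((∏ j, rising br δ (x i - x j - μ j * δ) (μ i))
      * ∏ j, rising br δ (x i + X j) (μ i))) (fun t => ?_) (by rw [hμk]) ?_
  · have hnum : ∏ i, ∏ j, rising br δ (x i + b t j) (μ i)
        = ∏ p ∈ strings μ, ∏ j, br (x p.1 + p.2 * δ + b t j) := by
      rw [strings, prod_sigma]
      refine prod_congr rfl fun i _ => ?_
      unfold rising
      rw [prod_comm]
      refine prod_congr rfl fun l _ => prod_congr rfl fun j _ => ?_
      congr 1; ring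
    rw [prod_div_distrib, hnum]
    simp only [hb, prod_mul_distrib]
    ring
  · rw [← sum_add_distrib]
    simp only [he, sum_const, hμk, nsmul_eq_mul]

/-- Move the amount `t` from the parameter at `q` to the one at `p`. -/
def transfer (a : α → ℂ) (p q : α) (t : ℂ) : α → ℂ := a + Pi.single p t - Pi.single q t

lemma transfer_left (a : α → ℂ) {p q : α} (hpq : p ≠ q) (t : ℂ) : transfer a p q t p = a p + t := by
  simp [transfer, hpq]

lemma transfer_right (a : α → ℂ) {p q : α} (hpq : p ≠ q) (t : ℂ) :
    transfer a p q t q = a q - t := by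
  simp [transfer, hpq.symm]

lemma transfer_of_ne (a : α → ℂ) {p q j : α} (hp : j ≠ p) (hq : j ≠ q) (t : ℂ) :
    transfer a p q t j = a j := by
  simp [transfer, hp, hq]

lemma transfer_zero (a : α → ℂ) (p q : α) : transfer a p q 0 = a := by
  simp [transfer]

lemma sum_transfer (a : α → ℂ) (p q : α) (t : ℂ) : ∑ j, transfer a p q t j = ∑ j, a j := by
  simp [transfer, sum_add_distrib, sum_sub_distrib]

lemma prod_transfer {a : α → ℂ} {p q : α} (hpq : p ≠ q) (f : ℂ → ℂ) (t : ℂ) :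
    ∏ j, f (transfer a p q t j)
      = f (a p + t) * (f (a q - t) * ∏ j ∈ (univ.erase p).erase q, f (a j)) := by
  rw [← mul_prod_erase univ _ (mem_univ p),
    ← mul_prod_erase (univ.erase p) _ (mem_erase.mpr ⟨hpq.symm, mem_univ q⟩),
    transfer_left a hpq, transfer_right a hpq]
  congr 2
  refine prod_congr rfl fun j hj => ?_
  obtain ⟨hq, hj⟩ := mem_erase.mp hj
  rw [transfer_of_ne a (ne_of_mem_erase hj) hq]

/-- The transformation extends from an arithmetic progression of values of one parameter. -/
lemma knSum_comm_of_progression (h : IsBracket br) {x : ι → ℂ} {X : κ → ℂ} {k : ℕ}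
    (a : α → ℂ) {p q : α} (hpq : p ≠ q) {ε : ℂ} (hε : ∀ n : ℕ, 1 ≤ n → br (n * ε) ≠ 0) (t₀ : ℂ)
    (n₀ : ℕ) (ha : ∀ n, n₀ ≤ n → knSum br δ x X (transfer a p q (t₀ + n * ε)) k
      = knSum br δ X x (fun j => -transfer a p q (t₀ + n * ε) j) k) :
    knSum br δ x X a k = knSum br δ X x (fun j => -a j) k := by
  rcases Nat.eq_zero_or_pos k with rfl | hk
  · rw [knSum_zero, knSum_zero]
  have hε' : ∀ n m : ℕ, n ≠ m → br ((t₀ + n * ε) - (t₀ + m * ε)) ≠ 0 := by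
    intro n m hnm
    convert h.map_int_mul_ne_zero hε (n := (n : ℤ) - m) (by omega) using 2
    push_cast; ring
  obtain ⟨n₁, hn₁, hne⟩ : ∃ n₁, n₀ ≤ n₁ ∧ ∀ n, n₁ ≤ n → br (0 - (t₀ + n * ε)) ≠ 0 := by
    by_cases hbad : ∃ m : ℕ, br (0 - (t₀ + m * ε)) = 0
    · obtain ⟨m, hm⟩ := hbad
      refine ⟨max n₀ (m + 1), le_max_left _ _, fun n hn hc => hε' m n (by omega) ?_⟩
      convert h.map_sub_eq_zero hc hm using 2
      ring
    · push Not at hbad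
      exact ⟨n₀, le_rfl, fun n _ => hbad n⟩
  have hL := knSum_mem_thetaSpace (br := br) (δ := δ) x X (transfer a p q)
    (fun z => -∏ j ∈ (univ.erase p).erase q, br (z + a j)) (fun z => z + a p) (fun z => -z - a q)
    (a p - a q) (fun z => by ring) (fun t z => by
      rw [prod_transfer hpq fun w => br (z + w), show z + (a q - t) = -(t + (-z - a q)) by ring,
        h.odd, show z + (a p + t) = t + (z + a p) by ring]
      ring) k
  have hR := knSum_mem_thetaSpace (br := br) (δ := δ) X x (fun t j => -transfer a p q t j)
    (fun z => -∏ j ∈ (univ.erase p).erase q, br (z + -a j)) (fun z => a p - z) (fun z => z - a q)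
    (a p - a q) (fun z => by ring) (fun t z => by
      rw [prod_transfer hpq fun w => br (z + -w), show z + -(a p + t) = -(t + (a p - z)) by ring,
        h.odd, show z + -(a q - t) = t + (z - a q) by ring]
      ring) k
  have key := h.eq_zero_of_mem_thetaSpace (Submodule.sub_mem _ hL hR) (by omega)
    ((range (k + k + 1)).image fun n : ℕ => t₀ + (n₁ + n : ℕ) * ε) ?_ ?_ ?_ (u := 0) ?_
  · simpa only [Pi.sub_apply, transfer_zero, sub_eq_zero] using key
  · rw [card_image_of_injective, card_range]
    intro n m hnm
    by_contra hc
    exact hε' (n₁ + n) (n₁ + m) (by omega) (by rw [sub_eq_zero.mpr hnm, h.map_zero])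
  · simp only [mem_image]
    rintro _ ⟨n, -, rfl⟩ _ ⟨m, -, rfl⟩ hnm
    exact hε' _ _ fun hc => hnm (by rw [hc])
  · simp only [mem_image]
    rintro _ ⟨n, -, rfl⟩
    exact sub_eq_zero.mpr (ha _ (by omega))
  · simp only [mem_image]
    rintro _ ⟨n, -, rfl⟩
    exact hne _ (by omega)

/-- The transformation when all but two of the parameters differ from the variables by multiples
of `δ`. -/
lemma knSum_comm_of_strings_off_pair (h : IsBracket br) (hδ : ∀ n : ℕ, 1 ≤ n → br (n * δ) ≠ 0)
    {x : ι → ℂ} {X : κ → ℂ} (hg : InGeneralPosition br δ x X) (i₀ : ι) (j₀ : κ) (M : ι → ℕ)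
    (N : κ → ℕ) (a : ι ⊕ κ → ℂ) (hbal : ∑ i, x i + ∑ p, a p = ∑ j, X j)
    (hM : ∀ i, i ≠ i₀ → a (Sum.inl i) = -x i - M i * δ)
    (hN : ∀ j, j ≠ j₀ → a (Sum.inr j) = X j + N j * δ) (k : ℕ) :
    knSum br δ x X a k = knSum br δ X x (fun p => -a p) k := by
  have hpq : (Sum.inl i₀ : ι ⊕ κ) ≠ Sum.inr j₀ := Sum.inl_ne_inr
  set m := ∑ i ∈ univ.erase i₀, M i with hm
  set n' := ∑ j ∈ univ.erase j₀, N j with hn'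
  have hC : a (Sum.inl i₀) + a (Sum.inr j₀) = -x i₀ + X j₀ + m * δ - n' * δ := by
    rw [Fintype.sum_sum_type, ← add_sum_erase univ (fun i => a (Sum.inl i)) (mem_univ i₀),
      ← add_sum_erase univ (fun j => a (Sum.inr j)) (mem_univ j₀),
      ← add_sum_erase univ x (mem_univ i₀), ← add_sum_erase univ X (mem_univ j₀),
      sum_congr rfl fun i hi => hM i (ne_of_mem_erase hi),
      sum_congr rfl fun j hj => hN j (ne_of_mem_erase hj), sum_sub_distrib, sum_neg_distrib,
      sum_add_distrib, ← sum_mul, ← sum_mul] at hbal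
    rw [hm, hn']
    push_cast
    linear_combination hbal
  refine h.knSum_comm_of_progression a hpq (ε := -δ) (fun n hn => ?_) (-x i₀ - a (Sum.inl i₀)) n'
    fun n hn => ?_
  · rw [mul_neg, h.odd]
    exact neg_ne_zero.mpr (hδ n hn)
  · have hsub : ((n + m - n' : ℕ) : ℂ) = n + m - n' := by
      rw [Nat.cast_sub (by omega), Nat.cast_add]
    have ha : transfer a (Sum.inl i₀) (Sum.inr j₀) (-x i₀ - a (Sum.inl i₀) + n * -δ)
        = Sum.elim (fun i => -x i - Function.update M i₀ n i * δ)
          (fun j => X j + Function.update N j₀ (n + m - n') j * δ) := by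
      funext p
      rcases p with i | j
      · by_cases hi : i = i₀
        · subst hi
          rw [transfer_left _ hpq, Sum.elim_inl, Function.update_self]
          ring
        · rw [transfer_of_ne _ (by simpa using hi) (by simp), hM i hi, Sum.elim_inl,
            Function.update_of_ne hi]
      · by_cases hj : j = j₀
        · subst hj
          rw [transfer_right _ hpq, Sum.elim_inr, Function.update_self, hsub]
          linear_combination hC
        · rw [transfer_of_ne _ (by simp) (by simpa using hj), hN j hj, Sum.elim_inr,
            Function.update_of_ne hj]
    rw [ha]
    refine h.knSum_comm_strings hδ hg _ _ ?_ k
    rw [sum_update_of_mem (mem_univ _), sum_update_of_mem (mem_univ _), sdiff_singleton_eq_erase,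
      sdiff_singleton_eq_erase]
    omega

/-- The value of a parameter differs from a variable by a multiple of `δ`. -/
def IsStringValue (δ : ℂ) (x : ι → ℂ) (X : κ → ℂ) (p : ι ⊕ κ) (v : ℂ) : Prop :=
  Sum.elim (fun i => ∃ n : ℕ, v = -x i - n * δ) (fun j => ∃ n : ℕ, v = X j + n * δ) p

lemma knSum_comm_of_strings_off (h : IsBracket br) (hδ : ∀ n : ℕ, 1 ≤ n → br (n * δ) ≠ 0)
    {x : ι → ℂ} {X : κ → ℂ} (hg : InGeneralPosition br δ x X) (i₀ : ι) (j₀ : κ)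
    (U : Finset (ι ⊕ κ)) (a : ι ⊕ κ → ℂ) (hbal : ∑ i, x i + ∑ p, a p = ∑ j, X j)
    (ha : ∀ p, p ∉ U → p ≠ Sum.inl i₀ → p ≠ Sum.inr j₀ → IsStringValue δ x X p (a p)) (k : ℕ) :
    knSum br δ x X a k = knSum br δ X x (fun p => -a p) k := by
  induction U using Finset.induction_on generalizing a with
  | empty =>
    have hM : ∀ i, ∃ n : ℕ, i ≠ i₀ → a (Sum.inl i) = -x i - n * δ := by
      intro i
      by_cases hi : i = i₀
      · exact ⟨0, fun hc => absurd hi hc⟩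
      · obtain ⟨n, hn⟩ := ha (Sum.inl i) (notMem_empty _) (by simpa using hi) (by simp)
        exact ⟨n, fun _ => hn⟩
    have hN : ∀ j, ∃ n : ℕ, j ≠ j₀ → a (Sum.inr j) = X j + n * δ := by
      intro j
      by_cases hj : j = j₀
      · exact ⟨0, fun hc => absurd hj hc⟩
      · obtain ⟨n, hn⟩ := ha (Sum.inr j) (notMem_empty _) (by simp) (by simpa using hj)
        exact ⟨n, fun _ => hn⟩
    choose M hM using hM
    choose N hN using hN
    exact h.knSum_comm_of_strings_off_pair hδ hg i₀ j₀ M N a hbal hM hN k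
  | insert p U _ ih =>
    by_cases hp : p = Sum.inl i₀ ∨ p = Sum.inr j₀
    · refine ih a hbal fun p' hp' h1 h2 => ha p' ?_ h1 h2
      rw [mem_insert]
      rintro (rfl | hc)
      · exact hp.elim h1 h2
      · exact hp' hc
    · push Not at hp
      have hstep : ∀ t, IsStringValue δ x X p (a p + t) →
          knSum br δ x X (transfer a p (Sum.inr j₀) t) k
            = knSum br δ X x (fun j => -transfer a p (Sum.inr j₀) t j) k := by
        intro t ht
        refine ih _ (by rw [sum_transfer, hbal]) fun p' hp' h1 h2 => ?_
        by_cases hpp : p' = p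
        · subst hpp
          rwa [transfer_left a hp.2]
        · rw [transfer_of_ne a hpp h2]
          exact ha p' (by rw [mem_insert]; tauto) h1 h2
      rcases p with i | j
      · refine h.knSum_comm_of_progression a hp.2 (ε := -δ) (fun n hn => ?_)
          (-x i - a (Sum.inl i)) 0 fun n _ => hstep _ ⟨n, by ring⟩
        rw [mul_neg, h.odd]
        exact neg_ne_zero.mpr (hδ n hn)
      · exact h.knSum_comm_of_progression a hp.2 hδ (X j - a (Sum.inr j)) 0
          fun n _ => hstep _ ⟨n, by ring⟩

end Continuation

section Dummy

variable {br : ℂ → ℂ} {δ : ℂ} {ι κ α β : Type*} [Fintype ι] [DecidableEq ι] [Fintype κ]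
  [DecidableEq κ] [Fintype α] [Fintype β]

lemma rising_ne_zero {z : ℂ} (n : ℕ) (hz : ∀ l : ℤ, br (z + l * δ) ≠ 0) : rising br δ z n ≠ 0 :=
  prod_ne_zero_iff.mpr fun l _ => by exact_mod_cast hz l

/-- A variable of each family that is cancelled by a parameter can be dropped. -/
lemma knSum_option (h : IsBracket br) (x : ι → ℂ) (X : κ → ℂ) (x₀ X₀ : ℂ) (a : α → ℂ) (b : β → ℂ)
    (hab : ∀ f : ℂ → ℂ, ∏ j, f (b j) = f (-x₀) * f X₀ * ∏ j, f (a j))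
    (hx : ∀ i, ∀ l : ℤ, br (x i - x₀ + l * δ) ≠ 0) (hX : ∀ i, ∀ l : ℤ, br (x i + X₀ + l * δ) ≠ 0)
    (k : ℕ) :
    knSum br δ (fun i => Option.elim i x₀ x) (fun j => Option.elim j X₀ X) b k
      = knSum br δ x X a k := by
  symm
  refine sum_of_injOn (fun μ i => Option.elim i 0 μ) ?_ ?_ ?_ ?_
  · intro μ _ ν _ hμν
    funext i
    exact congrFun hμν (some i)
  · intro μ hμ
    simpa [Fintype.sum_option] using hμ
  · intro ν hν hnot
    refine prod_eq_zero (mem_univ none) ?_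
    have hpos : 0 < ν none := by
      by_contra! hc
      refine hnot ⟨fun i => ν (some i), ?_, ?_⟩
      · simpa [Fintype.sum_option, Nat.le_zero.mp hc] using hν
      · funext i
        cases i with
        | none => exact (Nat.le_zero.mp hc).symm
        | some i => rfl
    rw [hab fun w => rising br δ (Option.elim none x₀ x + w) (ν none)]
    have := h.rising_neg_mul_eq_zero (δ := δ) hpos
    rw [Nat.cast_zero, zero_mul, neg_zero] at this
    rw [Option.elim_none, add_neg_cancel, this]
    simp
  · intro μ _
    simp only [Fintype.prod_option, Option.elim_none, Option.elim_some]
    rw [prod_eq_one (s := (univ : Finset β)) fun j _ => by simp [rising],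
      prod_eq_one (s := (univ : Finset ι)) (f := fun j => rising br δ (x₀ - x j - μ j * δ) 0)
        fun j _ => by simp [rising],
      prod_eq_one (s := (univ : Finset κ)) (f := fun j => rising br δ (x₀ + X j) 0)
        fun j _ => by simp [rising]]
    simp only [rising, range_zero, prod_empty, mul_one, div_one, one_mul]
    refine prod_congr rfl fun i _ => ?_
    have := hab fun w => rising br δ (x i + w) (μ i)
    unfold rising at this
    rw [this]
    have h1 := rising_ne_zero (μ i) (hx i)
    have h2 := rising_ne_zero (μ i) (hX i)
    unfold rising at h1 h2
    rw [Nat.cast_zero, zero_mul, sub_zero, ← sub_eq_add_neg]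
    rw [mul_assoc, mul_div_mul_comm, mul_div_mul_left _ _ h2, div_mul_cancel_left₀ h1]
    ring

/-- The Kajihara–Noumi transformation in general position. -/
theorem knSum_comm (h : IsBracket br) (hδ : ∀ n : ℕ, 1 ≤ n → br (n * δ) ≠ 0)
    {x : ι → ℂ} {X : κ → ℂ} (hg : InGeneralPosition br δ x X) (a : ι ⊕ κ → ℂ)
    (hbal : ∑ i, x i + ∑ p, a p = ∑ j, X j) (k : ℕ) :
    knSum br δ x X a k = knSum br δ X x (fun p => -a p) k := by
  obtain ⟨t, ht⟩ := (h.dense_forall_ne_zero (β := ((ι ⊕ κ) × Bool × ℤ) ⊕ ℤ)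
    (Sum.elim (fun p => (if p.2.1 then 1 else -1) * Sum.elim x X p.1 + p.2.2 * δ)
      (fun l => l * δ)) (Sum.elim (fun _ => 1) fun _ => 2)
    (by rintro (_ | _) <;> simp)).nonempty
  have hone : ∀ p (l : ℤ), br (t + Sum.elim x X p + l * δ) ≠ 0 := by
    intro p l
    convert ht (Sum.inl (p, true, l)) using 2
    simp only [Sum.elim_inl, if_true]; ring
  have hneg : ∀ p (l : ℤ), br (t - Sum.elim x X p + l * δ) ≠ 0 := by
    intro p l
    convert ht (Sum.inl (p, false, l)) using 2
    simp only [Sum.elim_inl, Bool.false_eq_true, if_false]; ring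
  have hneg' : ∀ p (l : ℤ), br (Sum.elim x X p - t + l * δ) ≠ 0 := by
    intro p l
    rw [← neg_ne_zero, ← h.odd]
    convert hneg p (-l) using 2
    push_cast; ring
  have hone' : ∀ p (l : ℤ), br (Sum.elim x X p + t + l * δ) ≠ 0 := by
    intro p l
    rw [add_comm _ t]
    exact hone p l
  have hg' : InGeneralPosition br δ (fun i : Option ι => Option.elim i t x)
      (fun j : Option κ => Option.elim j t X) := by
    refine ⟨?_, ?_, ?_⟩
    · rintro (_ | i) (_ | j) hij l
      · exact absurd rfl hij
      · exact hneg (Sum.inl j) l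
      · exact hneg' (Sum.inl i) l
      · exact hg.left i j (fun hc => hij (by rw [hc])) l
    · rintro (_ | i) (_ | j) hij l
      · exact absurd rfl hij
      · exact hneg (Sum.inr j) l
      · exact hneg' (Sum.inr i) l
      · exact hg.right i j (fun hc => hij (by rw [hc])) l
    · rintro (_ | i) (_ | j) l
      · convert ht (Sum.inr l) using 2
        simp only [Option.elim_none, Sum.elim_inr]; ring
      · exact hone (Sum.inr j) l
      · exact hone' (Sum.inl i) l
      · exact hg.cross i j l
  set b : Option ι ⊕ Option κ → ℂ := Sum.elim (fun i => Option.elim i (-t) fun i => a (Sum.inl i))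
    (fun j => Option.elim j t fun j => a (Sum.inr j)) with hb
  have key := h.knSum_comm_of_strings_off hδ hg' none none univ b ?_ (by simp) k
  · rw [h.knSum_option x X t t a b (fun f => ?_) (fun i => hneg' (Sum.inl i))
      (fun i => hone' (Sum.inl i)), h.knSum_option X x t t (fun p => -a p) _ (fun f => ?_)
      (fun i => hneg' (Sum.inr i)) (fun i => hone' (Sum.inr i))] at key
    · exact key
    · simp only [hb, Fintype.prod_sum_type, Fintype.prod_option, Sum.elim_inl, Sum.elim_inr,
        Option.elim_none, Option.elim_some, neg_neg]
      ring
    · simp only [hb, Fintype.prod_sum_type, Fintype.prod_option, Sum.elim_inl, Sum.elim_inr,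
        Option.elim_none, Option.elim_some]
      ring
  · simp only [hb, Fintype.sum_sum_type, Fintype.sum_option, Sum.elim_inl, Sum.elim_inr,
      Option.elim_none, Option.elim_some] at hbal ⊢
    linear_combination hbal

end Dummy

end IsBracket

namespace IsBracket

section Deformed

variable {br : ℂ → ℂ} {δ : ℂ}

lemma sfac_natCast (z : ℂ) (n : ℕ) : sfac br δ z (n : ℤ) = rising br δ z n := by
  simp [sfac, rising]

lemma rising_add (z : ℂ) (m n : ℕ) :
    rising br δ z (m + n) = rising br δ z m * rising br δ (z + m * δ) n := by
  unfold rising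
  rw [prod_range_add]
  congr 1
  refine prod_congr rfl fun l _ => ?_
  congr 1; push_cast; ring

lemma rising_one (z : ℂ) : rising br δ z 1 = br z := by
  simp [rising]

lemma rising_mul_shift (z : ℂ) (n : ℕ) :
    rising br δ z n * br (z + n * δ) = br z * rising br δ (z + δ) n := by
  have h1 := rising_add (br := br) (δ := δ) z n 1
  have h2 := rising_add (br := br) (δ := δ) z 1 n
  rw [rising_one] at h1 h2
  rw [← h1, add_comm, h2, Nat.cast_one, one_mul]

lemma rising_neg (h : IsBracket br) (z : ℂ) (n : ℕ) :
    rising br δ (-z - n * δ) n = (-1) ^ n * rising br δ (z + δ) n := by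
  unfold rising
  rw [← prod_range_reflect, show (-1 : ℂ) ^ n = ∏ _l ∈ range n, (-1 : ℂ) by simp,
    ← prod_mul_distrib]
  refine prod_congr rfl fun l hl => ?_
  have hl := mem_range.mp hl
  rw [neg_one_mul, ← h.odd]
  congr 1
  rw [Nat.cast_sub (by omega), Nat.cast_sub (by omega)]
  push_cast; ring

lemma prod_prod_eq_prod_diag {ι : Type*} [Fintype ι] [DecidableEq ι] (G : ι → ι → ℂ)
    (hG : ∀ i j, i ≠ j → G i j * G j i = 1) : ∏ i, ∏ j, G i j = ∏ i, G i i := by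
  rw [← prod_product', ← diag_union_offDiag, prod_union (disjoint_diag_offDiag _), prod_diag,
    prod_involution (s := offDiag univ) (fun p _ => p.swap), mul_one]
  · intro p hp
    exact hG p.1 p.2 (mem_offDiag.mp hp).2.2
  · intro p hp _ hc
    exact (mem_offDiag.mp hp).2.2 (congrArg Prod.snd hc)
  · intro p hp
    simpa [eq_comm] using hp
  · intro p _
    exact Prod.swap_swap p

/-- The factors of a summand coming from pairs of variables of the first family. -/
lemma inv_prod_rising_eq (h : IsBracket br) (hδ : ∀ n : ℕ, 1 ≤ n → br (n * δ) ≠ 0) {m : ℕ}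
    (x : Fin m → ℂ) (hx : ∀ i j, i ≠ j → ∀ n : ℤ, br (x i - x j + n * δ) ≠ 0) (μ : Fin m → ℕ) :
    (∏ i, ∏ j, rising br δ (x i - x j - μ j * δ) (μ i))⁻¹ = (-1) ^ (∑ i, μ i) *
      ((∏ i, ∏ j, if i < j then br (x i - x j + ((μ i : ℂ) - μ j) * δ) / br (x i - x j) else 1)
        * (∏ i, ∏ j, rising br δ (x i - x j + δ) (μ i))⁻¹) := by
  have hδ' : ∀ n, rising br δ δ n ≠ 0 := fun n => prod_ne_zero_iff.mpr fun l _ => by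
    convert hδ (l + 1) (by omega) using 2
    push_cast; ring
  have hA : ∀ i j, rising br δ (x i - x j + δ) (μ i) ≠ 0 := by
    intro i j
    by_cases hij : i = j
    · rw [hij, sub_self, zero_add]; exact hδ' _
    · refine rising_ne_zero _ fun l => ?_
      convert hx i j hij (l + 1) using 2
      push_cast; ring
  set G : Fin m → Fin m → ℂ := fun i j =>
    (if i < j then br (x i - x j + ((μ i : ℂ) - μ j) * δ) / br (x i - x j) else 1)
      * rising br δ (x i - x j - μ j * δ) (μ i) / rising br δ (x i - x j + δ) (μ i) with hG
  have hlt : ∀ i j, i < j → G i j * G j i = 1 := by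
    intro i j hij
    have hz : br (x i - x j) ≠ 0 := by simpa using hx i j hij.ne 0
    have h1 := h.rising_neg (δ := δ) (x i - x j + (μ i - μ j) * δ) (μ j)
    have h2 := h.rising_neg (δ := δ) (x j - x i) (μ j)
    have h3 := rising_add (br := br) (δ := δ) (x i - x j - μ j * δ) (μ i + 1) (μ j)
    have h4 := rising_add (br := br) (δ := δ) (x i - x j - μ j * δ) (μ j) (1 + μ i)
    rw [rising_add _ (μ i) 1, rising_one, Nat.cast_add, Nat.cast_one] at h3
    rw [rising_add _ 1 (μ i), rising_one, Nat.cast_one, sub_add_cancel, one_mul,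
      show μ j + (1 + μ i) = μ i + 1 + μ j by ring, h3] at h4
    rw [show -(x i - x j + (μ i - μ j) * δ) - μ j * δ = x j - x i - μ i * δ by ring,
      show x i - x j + (μ i - μ j) * δ + δ = x i - x j - μ j * δ + (μ i + 1) * δ by ring] at h1
    rw [show -(x j - x i) - μ j * δ = x i - x j - μ j * δ by ring] at h2
    rw [show x i - x j - μ j * δ + μ i * δ = x i - x j + (μ i - μ j) * δ by ring] at h4
    simp only [hG, if_pos hij, if_neg hij.not_gt, one_mul]
    rw [div_mul_div_comm, div_eq_one_iff_eq (mul_ne_zero (hA i j) (hA j i)), div_mul_eq_mul_div,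
      div_mul_eq_mul_div, div_eq_iff hz, h1]
    rw [h2] at h4
    have hs : ((-1 : ℂ) ^ μ j) * (-1) ^ μ j = 1 := by
      rw [← mul_pow]; norm_num
    linear_combination (-1 : ℂ) ^ μ j * h4
      + (br (x i - x j) * rising br δ (x i - x j + δ) (μ i) * rising br δ (x j - x i + δ) (μ j)) * hs
  have hprod := prod_prod_eq_prod_diag G fun i j hij => by
    rcases lt_or_gt_of_ne hij with hij | hij
    · exact hlt i j hij
    · rw [mul_comm]; exact hlt j i hij
  have hdiag : ∀ i, G i i = (-1) ^ μ i := by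
    intro i
    have := h.rising_neg (δ := δ) 0 (μ i)
    rw [neg_zero, zero_add] at this
    simp only [hG, lt_self_iff_false, if_false, sub_self, zero_add, one_mul, this]
    exact mul_div_cancel_right₀ _ (hδ' _)
  simp only [hdiag, prod_pow_eq_pow_sum] at hprod
  simp only [hG, prod_div_distrib, prod_mul_distrib] at hprod
  rw [mul_div_right_comm, div_eq_mul_inv] at hprod
  refine inv_eq_of_mul_eq_one_left ?_
  rw [mul_assoc, hprod, ← mul_pow]
  norm_num

variable {m r n s N : ℕ}

lemma prod_div_ite_mem (I : Finset (Fin r)) (f g : Fin r → ℂ) (hf : ∀ j ∈ I, f j ≠ 0) :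
    (∏ j, f j) / ∏ j, (if j ∈ I then f j else g j) = ∏ j ∈ Iᶜ, f j / g j := by
  rw [← prod_div_distrib, ← prod_mul_prod_compl I, prod_eq_one, one_mul]
  · exact prod_congr rfl fun j hj => by rw [if_neg (mem_compl.mp hj)]
  · intro j hj
    rw [if_pos hj, div_self (hf j hj)]

lemma knSum_factor_left (x : Fin m → ℂ) (y : Fin r → ℂ) (X : Fin n → ℂ) (Y : Fin s → ℂ)
    (hg : InGeneralPosition br δ (Sum.elim x y) (Sum.elim X Y)) (a : Fin N → ℂ) (μ : Fin m → ℕ)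
    (I : Finset (Fin r)) (i : Fin m) :
    ((∏ j, rising br δ (x i + a j) (μ i)) * (∏ j, rising br δ (x i + (-y j - δ)) (μ i))
        * ∏ j, rising br δ (x i + (Y j + δ)) (μ i)) /
      (((∏ j, rising br δ (x i - x j - μ j * δ) (μ i))
        * ∏ j, rising br δ (x i - y j - ((if j ∈ I then 1 else 0 : ℕ) : ℂ) * δ) (μ i))
        * ((∏ j, rising br δ (x i + X j) (μ i)) * ∏ j, rising br δ (x i + Y j) (μ i)))
      = (∏ j, rising br δ (x i + a j) (μ i)) /
          ((∏ j, rising br δ (x i - x j - μ j * δ) (μ i)) * ∏ j, rising br δ (x i + X j) (μ i))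
        * ((∏ j ∈ Iᶜ, br (x i - y j - δ) / br (x i - y j + ((μ i : ℂ) - 1) * δ))
          * ∏ j, br (x i + Y j + μ i * δ) / br (x i + Y j)) := by
  have hxy : ∀ j, ∀ l : ℤ, br (x i - y j + l * δ) ≠ 0 := fun j l =>
    hg.left (Sum.inl i) (Sum.inr j) Sum.inl_ne_inr l
  have hxY : ∀ j, ∀ l : ℤ, br (x i + Y j + l * δ) ≠ 0 := fun j l =>
    hg.cross (Sum.inl i) (Sum.inr j) l
  have h1 : ∀ j, br (x i - y j - δ) / br (x i - y j + ((μ i : ℂ) - 1) * δ)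
      = rising br δ (x i - y j - δ) (μ i) / rising br δ (x i - y j) (μ i) := by
    intro j
    have := rising_mul_shift (br := br) (δ := δ) (x i - y j - δ) (μ i)
    rw [sub_add_cancel, show x i - y j - δ + μ i * δ = x i - y j + ((μ i : ℂ) - 1) * δ by ring]
      at this
    rw [div_eq_div_iff _ (rising_ne_zero _ (hxy j)), this]
    exact_mod_cast hxy j ((μ i : ℤ) - 1)
  have h2 : ∀ j, br (x i + Y j + μ i * δ) / br (x i + Y j)
      = rising br δ (x i + (Y j + δ)) (μ i) / rising br δ (x i + Y j) (μ i) := by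
    intro j
    have := rising_mul_shift (br := br) (δ := δ) (x i + Y j) (μ i)
    rw [← add_assoc, div_eq_div_iff _ (rising_ne_zero _ (hxY j)), mul_comm, this, mul_comm]
    simpa using hxY j 0
  simp only [h1, h2]
  rw [← prod_div_ite_mem, prod_div_distrib]
  · have : ∀ j, rising br δ (x i - y j - ((if j ∈ I then 1 else 0 : ℕ) : ℂ) * δ) (μ i)
        = if j ∈ I then rising br δ (x i - y j - δ) (μ i) else rising br δ (x i - y j) (μ i) := by
      intro j
      split_ifs <;> simp
    simp only [this, show ∀ j, x i + (-y j - δ) = x i - y j - δ from fun j => by ring]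
    simp only [div_eq_mul_inv, mul_inv]
    ring
  · intro j _
    refine rising_ne_zero _ fun l => ?_
    convert hxy j (l - 1) using 2
    push_cast; ring

lemma knSum_factor_right (h : IsBracket br) (hδ : br δ ≠ 0) (x : Fin m → ℂ) (y : Fin r → ℂ)
    (X : Fin n → ℂ) (Y : Fin s → ℂ)
    (hg : InGeneralPosition br δ (Sum.elim x y) (Sum.elim X Y)) (a : Fin N → ℂ) (μ : Fin m → ℕ)
    (I : Finset (Fin r)) (i : Fin r) :
    ((∏ j, br (y i + a j)) * (∏ j, br (y i + (-y j - δ))) * ∏ j, br (y i + (Y j + δ))) /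
      (((∏ j, br (y i - x j - μ j * δ))
        * ∏ j, br (y i - y j - ((if j ∈ I then 1 else 0 : ℕ) : ℂ) * δ))
        * ((∏ j, br (y i + X j)) * ∏ j, br (y i + Y j)))
      = (∏ j ∈ Iᶜ, br (y i - y j - δ) / br (y i - y j)) *
        ((∏ j, br (y i + a j)) / ((∏ j, br (y i - x j - μ j * δ)) * ∏ j, br (y i + X j))
          * ∏ j, br (y i + Y j + δ) / br (y i + Y j)) := by
  rw [← prod_div_ite_mem, prod_div_distrib]
  · have : ∀ j, br (y i - y j - ((if j ∈ I then 1 else 0 : ℕ) : ℂ) * δ)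
        = if j ∈ I then br (y i - y j - δ) else br (y i - y j) := by
      intro j
      split_ifs <;> simp
    simp only [this, show ∀ j, y i + (-y j - δ) = y i - y j - δ from fun j => by ring, add_assoc]
    simp only [div_eq_mul_inv, mul_inv]
    ring
  · intro j _
    by_cases hij : i = j
    · rw [hij, sub_self, zero_sub, h.odd]
      exact neg_ne_zero.mpr hδ
    · convert hg.left (Sum.inr i) (Sum.inr j) (by simpa using hij) (-1) using 2
      simp only [Sum.elim_inr]; push_cast; ring

lemma mem_idxSet {k : ℕ} {p : (Fin m → ℕ) × Finset (Fin r)} :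
    p ∈ idxSet m r k ↔ ∑ i, p.1 i + p.2.card = k := by
  simp only [idxSet, mem_filter, mem_product, Fintype.mem_piFinset, mem_range, mem_univ, and_true,
    and_iff_right_iff_imp]
  intro hk i
  have := single_le_sum (f := p.1) (fun _ _ => Nat.zero_le _) (mem_univ i)
  omega

/-- One side of the transformation with deformed variables is, up to sign, one side of the
undeformed transformation in more variables, with specialized parameters. -/
theorem KNside_eq_knSum (h : IsBracket br) (hδ : ∀ n : ℕ, 1 ≤ n → br (n * δ) ≠ 0) {α : Type*}
    [Fintype α] (x : Fin m → ℂ) (y : Fin r → ℂ) (X : Fin n → ℂ) (Y : Fin s → ℂ)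
    (hg : InGeneralPosition br δ (Sum.elim x y) (Sum.elim X Y)) (a : Fin N → ℂ) (b : α → ℂ)
    (hb : ∀ f : ℂ → ℂ, ∏ j, f (b j)
      = (∏ j, f (a j)) * (∏ j, f (-y j - δ)) * ∏ j, f (Y j + δ)) (k : ℕ) :
    KNside br δ a x y X Y k = (-1) ^ k * knSum br δ (Sum.elim x y) (Sum.elim X Y) b k := by
  have hδ1 : br δ ≠ 0 := by simpa using hδ 1 le_rfl
  unfold KNside knSum
  rw [mul_sum]
  refine sum_of_injOn (fun p => Sum.elim p.1 fun i => if i ∈ p.2 then 1 else 0) ?_ ?_ ?_ ?_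
  · rintro ⟨μ, I⟩ _ ⟨ν, J⟩ _ heq
    simp only [Prod.mk.injEq]
    refine ⟨funext fun i => congrFun heq (Sum.inl i), ext fun i => ?_⟩
    have := congrFun heq (Sum.inr i)
    simp only [Sum.elim_inr] at this
    grind
  · intro p hp
    have := mem_idxSet.mp hp
    simpa [Fintype.sum_sum_type, mem_piAntidiag] using this
  · intro ν hν hnot
    have hex : ∃ i, 1 < ν (Sum.inr i) := by
      by_contra! hc
      refine hnot ⟨(fun i => ν (Sum.inl i), univ.filter fun i => ν (Sum.inr i) = 1), ?_, ?_⟩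
      · refine mem_idxSet.mpr ?_
        rw [← (mem_piAntidiag.mp hν).1, Fintype.sum_sum_type, card_filter]
        congr 1
        refine sum_congr rfl fun i _ => ?_
        have := hc i
        split_ifs <;> omega
      · funext p
        rcases p with i | i
        · rfl
        · have := hc i
          simp only [Sum.elim_inr, mem_filter, mem_univ, true_and]
          split_ifs <;> omega
    obtain ⟨i, hi⟩ := hex
    refine mul_eq_zero_of_right _ (prod_eq_zero (mem_univ (Sum.inr i)) ?_)
    rw [hb fun w => rising br δ (Sum.elim x y (Sum.inr i) + w) (ν (Sum.inr i)),
      prod_eq_zero (s := (univ : Finset (Fin r))) (mem_univ i), mul_zero, zero_mul, zero_div]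
    rw [Sum.elim_inr, show y i + (-y i - δ) = -((1 : ℕ) * δ) by push_cast; ring]
    exact h.rising_neg_mul_eq_zero hi
  · rintro ⟨μ, I⟩ hp
    have hk := mem_idxSet.mp hp
    simp only at hk ⊢
    rw [Fintype.prod_sum_type]
    have hleft : ∀ i, (∏ j, rising br δ (x i + b j) (μ i)) = _ := fun i =>
      hb fun w => rising br δ (x i + w) (μ i)
    have hright : ∀ i, (∏ j, br (y i + b j)) = _ := fun i => hb fun w => br (y i + w)
    simp only [Sum.elim_inl, Sum.elim_inr, Fintype.prod_sum_type, hleft,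
      knSum_factor_left x y X Y hg a μ I]
    rw [← prod_subset (subset_univ I)]
    · have hI : ∀ i ∈ I, (∏ j, rising br δ (y i + b j) (if i ∈ I then 1 else 0)) /
          (((∏ j, rising br δ (y i - x j - μ j * δ) (if i ∈ I then 1 else 0))
            * ∏ j, rising br δ (y i - y j - ((if j ∈ I then 1 else 0 : ℕ) : ℂ) * δ)
                (if i ∈ I then 1 else 0))
            * ((∏ j, rising br δ (y i + X j) (if i ∈ I then 1 else 0))
              * ∏ j, rising br δ (y i + Y j) (if i ∈ I then 1 else 0))) = _ := fun i hi => by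
        simp only [if_pos hi, rising_one, hright]
        exact h.knSum_factor_right hδ1 x y X Y hg a μ I i
      rw [prod_congr rfl hI]
      have hpair := h.inv_prod_rising_eq hδ x
        (fun i j hij => hg.left (Sum.inl i) (Sum.inl j) (by simpa using hij)) μ
      rw [← hk, pow_add]
      simp only [sfac_natCast, div_eq_mul_inv (∏ j, rising br δ _ _), mul_inv, prod_mul_distrib,
        prod_inv_distrib, hpair]
      rcases neg_one_pow_eq_or ℂ (∑ i, μ i) with hs | hs <;> rw [hs] <;> ring
    · intro i _ hi
      simp [hi, rising]

end Deformed

end IsBracket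

namespace IsBracket

section Transformation

variable {br : ℂ → ℂ} {δ : ℂ} {m r n s : ℕ}

theorem KNside_comm_of_inGeneralPosition (h : IsBracket br)
    (hδ : ∀ n : ℕ, 1 ≤ n → br (n * δ) ≠ 0) {x : Fin m → ℂ} {y : Fin r → ℂ} {X : Fin n → ℂ}
    {Y : Fin s → ℂ} (hg : InGeneralPosition br δ (Sum.elim x y) (Sum.elim X Y))
    (a : Fin (m + n) → ℂ)
    (hbal : (∑ i, x i) + (∑ j, a j) + (s : ℂ) * δ = (∑ i, X i) + (r : ℂ) * δ) (k : ℕ) :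
    KNside br δ a x y X Y k = KNside br δ (fun j => -a j) X Y x y k := by
  set b : (Fin m ⊕ Fin r) ⊕ (Fin n ⊕ Fin s) → ℂ :=
    Sum.elim (Sum.elim (fun i => a (Fin.castAdd n i)) fun i => -y i - δ)
      (Sum.elim (fun j => a (Fin.natAdd m j)) fun j => Y j + δ) with hb
  rw [h.KNside_eq_knSum hδ x y X Y hg a b, h.KNside_eq_knSum hδ X Y x y hg.symm _ (fun p => -b p),
    h.knSum_comm hδ hg]
  · simp only [hb, Fintype.sum_sum_type, Sum.elim_inl, Sum.elim_inr, sum_add_distrib,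
      sum_sub_distrib, sum_neg_distrib, sum_const, card_univ, Fintype.card_fin, nsmul_eq_mul]
    rw [Fin.sum_univ_add] at hbal
    linear_combination hbal
  · intro f
    simp only [hb, Fintype.prod_sum_type, Sum.elim_inl, Sum.elim_inr, Fin.prod_univ_add,
      neg_sub, neg_add', sub_neg_eq_add, add_comm δ]
    ring
  · intro f
    simp only [hb, Fintype.prod_sum_type, Sum.elim_inl, Sum.elim_inr, Fin.prod_univ_add]
    ring

lemma continuous_sfac (h : IsBracket br) {f : ℂ → ℂ} (hf : Continuous f) (n : ℕ) :
    Continuous fun t => sfac br δ (f t) (n : ℤ) := by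
  simp only [sfac_natCast, rising]
  exact continuous_finsetProd _ fun l _ => h.continuous.comp (hf.add continuous_const)

lemma continuousAt_KNside (h : IsBracket br) {N : ℕ} {a : ℂ → Fin N → ℂ} {x : ℂ → Fin m → ℂ}
    {y : ℂ → Fin r → ℂ} {X : ℂ → Fin n → ℂ} {Y : ℂ → Fin s → ℂ} (ha : Continuous a)
    (hx : Continuous x) (hy : Continuous y) (hX : Continuous X) (hY : Continuous Y) (k : ℕ) (t : ℂ)
    (hne : ∀ p ∈ idxSet m r k, KNDenomNZ br δ p.1 p.2 (x t) (y t) (X t) (Y t)) :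
    ContinuousAt (fun t => KNside br δ (a t) (x t) (y t) (X t) (Y t) k) t := by
  have hbr := h.continuous
  have ha' := fun j => continuous_apply j |>.comp ha
  have hx' := fun j => continuous_apply j |>.comp hx
  have hy' := fun j => continuous_apply j |>.comp hy
  have hX' := fun j => continuous_apply j |>.comp hX
  have hY' := fun j => continuous_apply j |>.comp hY
  simp only [Function.comp_def] at ha' hx' hy' hX' hY'
  have hsfac : ∀ {f : ℂ → ℂ}, Continuous f → ∀ n : ℕ,
      Continuous fun t => sfac br δ (f t) (n : ℤ) := fun hf n => h.continuous_sfac hf n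
  unfold KNside
  refine tendsto_finsetSum _ fun p hp => ?_
  obtain ⟨hxx, hyy, hxy, hfxx, hfxX, hxY, hyx, hyX, hyY⟩ := hne p hp
  refine ContinuousAt.mul (ContinuousAt.mul (ContinuousAt.mul (ContinuousAt.mul (ContinuousAt.mul
    continuousAt_const ?_) ?_) ?_) ?_) ?_
  · refine tendsto_finsetProd _ fun i _ => tendsto_finsetProd _ fun j _ => ?_
    split_ifs with hij
    · exact ContinuousAt.div (by fun_prop) (by fun_prop) (hxx i j hij)
    · exact tendsto_const_nhds
  · exact tendsto_finsetProd _ fun i hi => tendsto_finsetProd _ fun j hj =>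
      ContinuousAt.div (by fun_prop) (by fun_prop) (hyy i hi j hj)
  · exact tendsto_finsetProd _ fun i hi => tendsto_finsetProd _ fun j hj =>
      ContinuousAt.div (by fun_prop) (by fun_prop) (hxy i j hj)
  · refine tendsto_finsetProd _ fun i _ => ContinuousAt.mul (ContinuousAt.div ?_ ?_ ?_)
      (tendsto_finsetProd _ fun j _ => ContinuousAt.div (by fun_prop) (by fun_prop) (hxY i j))
    · exact (continuous_finsetProd _ fun j _ => hsfac (by fun_prop) _).continuousAt
    · exact ((continuous_finsetProd _ fun j _ => hsfac (by fun_prop) _).mul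
        (continuous_finsetProd _ fun j _ => hsfac (by fun_prop) _)).continuousAt
    · exact mul_ne_zero (prod_ne_zero_iff.mpr fun j _ => hfxx i j)
        (prod_ne_zero_iff.mpr fun j _ => hfxX i j)
  · exact tendsto_finsetProd _ fun i hi => ContinuousAt.mul (ContinuousAt.div (by fun_prop)
      (by fun_prop) (mul_ne_zero (prod_ne_zero_iff.mpr fun j _ => hyx i hi j)
        (prod_ne_zero_iff.mpr fun j _ => hyX i hi j)))
      (tendsto_finsetProd _ fun j _ => ContinuousAt.div (by fun_prop) (by fun_prop) (hyY i hi j))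

/-- An injective labelling of a finite type by positive integers, with complex values. -/
noncomputable def label (α : Type*) [Fintype α] (p : α) : ℂ :=
  ((Fintype.equivFin α p : ℕ) + 1 : ℕ)

lemma label_sub_ne_zero {α : Type*} [Fintype α] {p q : α} (hpq : p ≠ q) :
    label α p - label α q ≠ 0 := by
  rw [sub_ne_zero]
  unfold label
  norm_cast
  simpa [Fin.val_inj] using hpq

lemma label_add_label_ne_zero {α β : Type*} [Fintype α] [Fintype β] (p : α) (q : β) :
    label α p + label β q ≠ 0 := by
  unfold label
  norm_cast

/-- Moving all variables in generic directions reaches general position. -/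
lemma eq_of_inGeneralPosition (h : IsBracket br) {ι κ : Type*} [Fintype ι] [DecidableEq ι]
    [Fintype κ] [DecidableEq κ] (x : ι → ℂ) (X : κ → ℂ) {F G : ℂ → ℂ} (hF : ContinuousAt F 0)
    (hG : ContinuousAt G 0)
    (hFG : ∀ t, InGeneralPosition br δ (fun i => x i + label ι i * t)
      (fun j => X j + label κ j * t) → F t = G t) : F 0 = G 0 := by
  refine h.eq_at_zero_of_generic
    (β := ({p : ι × ι // p.1 ≠ p.2} ⊕ {p : κ × κ // p.1 ≠ p.2} ⊕ ι × κ) × ℤ)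
    (fun b => Sum.elim (fun p => x p.1.1 - x p.1.2) (Sum.elim (fun p => X p.1.1 - X p.1.2)
      fun p => x p.1 + X p.2) b.1 + b.2 * δ)
    (fun b => Sum.elim (fun p => label ι p.1.1 - label ι p.1.2)
      (Sum.elim (fun p => label κ p.1.1 - label κ p.1.2) fun p => label ι p.1 + label κ p.2) b.1)
    ?_ hF hG fun t ht => hFG t ⟨fun i j hij n => ?_, fun i j hij n => ?_, fun i j n => ?_⟩
  · rintro ⟨⟨p, hp⟩ | ⟨p, hp⟩ | p, n⟩
    · exact label_sub_ne_zero hp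
    · exact label_sub_ne_zero hp
    · exact label_add_label_ne_zero _ _
  · convert ht (Sum.inl ⟨(i, j), hij⟩, n) using 2
    simp only [Sum.elim_inl]; ring
  · convert ht (Sum.inr (Sum.inl ⟨(i, j), hij⟩), n) using 2
    simp only [Sum.elim_inl, Sum.elim_inr]; ring
  · convert ht (Sum.inr (Sum.inr (i, j)), n) using 2
    simp only [Sum.elim_inr]; ring

end Transformation

end IsBracket

/-- Kajihara–Noumi type transformation with deformed variables,
under the balancing condition `|x| + |a| + sδ = |X| + rδ`. -/
theorem KN_transformation
    (br : ℂ → ℂ) (hodd : ∀ z : ℂ, br (-z) = -br z)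
    (hent : Differentiable ℂ br) (hnz : br ≠ 0)
    (hW : ∀ a b c d : ℂ,
      br (a + b) * br (a - b) * br (c + d) * br (c - d)
        + br (a + d) * br (a - d) * br (b + c) * br (b - c)
        = br (a + c) * br (a - c) * br (b + d) * br (b - d))
    (δ κ : ℂ)
    (hδ : ∀ n : ℕ, 1 ≤ n → br ((n : ℂ) * δ) ≠ 0)
    (hκ : ∀ n : ℕ, 1 ≤ n → br ((n : ℂ) * κ) ≠ 0)
    (m r n s k : ℕ) (a : Fin (m + n) → ℂ)
    (x : Fin m → ℂ) (y : Fin r → ℂ) (X : Fin n → ℂ) (Y : Fin s → ℂ)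
    (hbal : (∑ i, x i) + (∑ j, a j) + (s : ℂ) * δ = (∑ i, X i) + (r : ℂ) * δ)
    (hL : ∀ p ∈ idxSet m r k, KNDenomNZ br δ p.1 p.2 x y X Y)
    (hR : ∀ p ∈ idxSet n s k, KNDenomNZ br δ p.1 p.2 X Y x y) :
    KNside br δ a x y X Y k = KNside br δ (fun j => -a j) X Y x y k := by
  have h : IsBracket br := ⟨hodd, hent, hnz, hW⟩
  set u := IsBracket.label (Fin m ⊕ Fin r)
  set v := IsBracket.label (Fin n ⊕ Fin s)
  obtain ⟨c, hc⟩ : ∃ c : ℂ, ∑ i, u (Sum.inl i) + (m + n : ℕ) * c = ∑ j, v (Sum.inl j) := by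
    rcases Nat.eq_zero_or_pos (m + n) with hmn | hmn
    · obtain ⟨rfl, rfl⟩ : m = 0 ∧ n = 0 := by omega
      exact ⟨0, by simp⟩
    · have : ((m + n : ℕ) : ℂ) ≠ 0 := Nat.cast_ne_zero.mpr hmn.ne'
      exact ⟨(∑ j, v (Sum.inl j) - ∑ i, u (Sum.inl i)) / (m + n : ℕ), by field_simp; ring⟩
  have key := h.eq_of_inGeneralPosition (δ := δ) (Sum.elim x y) (Sum.elim X Y)
    (h.continuousAt_KNside (δ := δ) (a := fun t j => a j + c * t)
      (x := fun t i => x i + u (Sum.inl i) * t) (y := fun t i => y i + u (Sum.inr i) * t)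
      (X := fun t j => X j + v (Sum.inl j) * t) (Y := fun t j => Y j + v (Sum.inr j) * t)
      (by fun_prop) (by fun_prop) (by fun_prop) (by fun_prop) (by fun_prop) k 0
      (by simpa using hL))
    (h.continuousAt_KNside (δ := δ) (a := fun t j => -(a j + c * t))
      (x := fun t j => X j + v (Sum.inl j) * t) (y := fun t j => Y j + v (Sum.inr j) * t)
      (X := fun t i => x i + u (Sum.inl i) * t) (Y := fun t i => y i + u (Sum.inr i) * t)
      (by fun_prop) (by fun_prop) (by fun_prop) (by fun_prop) (by fun_prop) k 0
      (by simpa using hR)) fun t ht => ?_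
  · simpa using key
  · refine h.KNside_comm_of_inGeneralPosition hδ ?_ _ ?_ k
    · convert ht using 1 <;> ext (i | i) <;> rfl
    · simp only [sum_add_distrib, ← sum_mul, sum_const, card_univ, Fintype.card_fin, nsmul_eq_mul]
      linear_combination hbal + t * hc
end

section
/- The polynomials h_{m,r}^{(k)} := Σ_{i+j=k, i ≥ 0, 0 ≤ j ≤ r} (−1)^j h_i(ξ) e_j(η), for k = 1, …, m+r, are algebraically independent over ℂ in the polynomial ring ℂ[ξ_1,…,ξ_m, η_1,…,η_r]. -/
open Finset

/-- The `i`-th complete homogeneous symmetric polynomial `h_i(ξ)` in the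
variables `ξ_1, …, ξ_m`, inside `ℂ[ξ_1,…,ξ_m, η_1,…,η_r]`. -/
noncomputable def hcomplete (m r : ℕ) (i : ℕ) : MvPolynomial (Fin m ⊕ Fin r) ℂ :=
  ∑ μ ∈ (Fintype.piFinset fun _ : Fin m => Finset.range (i + 1)).filter
      (fun μ => (∑ t, μ t) = i),
    ∏ t : Fin m, (MvPolynomial.X (Sum.inl t)) ^ μ t

/-- The `j`-th elementary symmetric polynomial `e_j(η)` in the variables
`η_1, …, η_r`, inside `ℂ[ξ_1,…,ξ_m, η_1,…,η_r]`. -/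
noncomputable def esymEta (m r : ℕ) (j : ℕ) : MvPolynomial (Fin m ⊕ Fin r) ℂ :=
  ∑ S ∈ (Finset.univ : Finset (Finset (Fin r))).filter (fun S => S.card = j),
    ∏ t ∈ S, MvPolynomial.X (Sum.inr t)

/-- The polynomial `h_{m,r}^{(k)} = Σ_{i+j=k, i ≥ 0, 0 ≤ j ≤ r} (-1)^j h_i(ξ) e_j(η)`. -/
noncomputable def hmr (m r : ℕ) (k : ℕ) : MvPolynomial (Fin m ⊕ Fin r) ℂ :=
  ∑ j ∈ Finset.range (r + 1),
    if j ≤ k then (-1 : MvPolynomial (Fin m ⊕ Fin r) ℂ) ^ j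
      * hcomplete m r (k - j) * esymEta m r j
    else 0

/-- In characteristic zero, an essentially finitely generated field extension is algebraic over
the subalgebra generated by `s` as soon as no nonzero derivation kills `s`. -/
theorem isAlgebraic_adjoin_of_derivation_eq_zero {F K : Type} [Field F] [CharZero F] [Field K]
    [Algebra F K] [Algebra.EssFiniteType F K] (s : Set K)
    (h : ∀ D : Derivation F K K, (∀ x ∈ s, D x = 0) → D = 0) :
    Algebra.IsAlgebraic (Algebra.adjoin F s) K := by
  let L := IntermediateField.adjoin F s
  have hess : Algebra.EssFiniteType L K := Algebra.EssFiniteType.of_comp F L K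
  have hD (D : Derivation L K K) : D = 0 := by
    have h0 := h (D.restrictScalars F) fun x hx =>
      D.map_algebraMap (⟨x, IntermediateField.subset_adjoin F s hx⟩ : L)
    ext x
    exact DFunLike.congr_fun h0 x
  have hunr : Algebra.FormallyUnramified L K := by
    refine ⟨subsingleton_of_forall_eq 0 fun w => ?_⟩
    refine (Module.forall_dual_apply_eq_zero_iff K w).mp fun φ => ?_
    have hφ : φ = 0 := by
      apply (KaehlerDifferential.linearMapEquivDerivation L K).injective
      rw [hD (KaehlerDifferential.linearMapEquivDerivation L K φ), map_zero]
    simp [hφ]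
  have hsep : Algebra.IsSeparable L K := Algebra.FormallyUnramified.isSeparable L K
  open scoped IntermediateField.algebraAdjoinAdjoin in
  exact (IsFractionRing.comap_isAlgebraic_iff (A := Algebra.adjoin F s) (K := L) (C := K)).mpr
    inferInstance

/-- Jacobian-type criterion: as many polynomials as variables are algebraically independent if
every derivation that kills them kills all the variables. -/
theorem algebraicIndependent_of_derivation_eq_zero {F σ ι : Type} [Field F] [CharZero F]
    [Fintype σ] [Fintype ι] (hcard : Fintype.card ι = Fintype.card σ) (f : ι → MvPolynomial σ F)
    (h : ∀ D : Derivation F (MvPolynomial σ F) (FractionRing (MvPolynomial σ F)),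
      (∀ i, D (f i) = 0) → ∀ s, D (MvPolynomial.X s) = 0) :
    AlgebraicIndependent F f := by
  let S := MvPolynomial σ F
  let K := FractionRing S
  have hess : Algebra.EssFiniteType F K :=
    have : Algebra.EssFiniteType S K := .of_isLocalization K (nonZeroDivisors S)
    Algebra.EssFiniteType.comp F S K
  have halg : Algebra.IsAlgebraic (Algebra.adjoin F (Set.range fun i => algebraMap S K (f i))) K := by
    refine isAlgebraic_adjoin_of_derivation_eq_zero _ fun D hD => ?_
    have hX := h (D.compAlgebraMap S) fun i => hD _ ⟨i, rfl⟩
    have h0 : D.compAlgebraMap S = 0 := MvPolynomial.derivation_ext hX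
    ext x
    obtain ⟨a, b, hb, rfl⟩ := IsFractionRing.div_surjective (A := S) x
    have hz (a : S) : D (algebraMap S K a) = 0 := DFunLike.congr_fun h0 a
    simp [D.leibniz_div, hz]
  have hindep : AlgebraicIndependent F fun i => algebraMap S K (f i) := by
    refine (Algebra.IsAlgebraic.isTranscendenceBasis_of_le_trdeg_of_finite F _ ?_).1
    have hX : AlgebraicIndependent F fun s : σ => algebraMap S K (MvPolynomial.X s) :=
      (MvPolynomial.algebraicIndependent_X σ F).map' (f := IsScalarTower.toAlgHom F S K)
        (IsFractionRing.injective S K)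
    refine le_trans (le_of_eq ?_) hX.cardinalMk_le_trdeg
    simp [hcard]
  exact ((IsScalarTower.toAlgHom F S K).algebraicIndependent_iff
    (IsFractionRing.injective S K)).mp hindep

/-- Logarithmic derivatives turn products into sums. -/
theorem Derivation.apply_prod_of_apply_eq_mul {R A ι : Type*} [CommRing R] [CommRing A]
    [Algebra R A] (D : Derivation R A A) (s : Finset ι) (f g : ι → A)
    (h : ∀ i ∈ s, D (f i) = g i * f i) :
    D (∏ i ∈ s, f i) = (∑ i ∈ s, g i) * ∏ i ∈ s, f i := by
  classical
  induction s using Finset.induction_on with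
  | empty => simp
  | insert a s ha ih =>
    rw [Finset.prod_insert ha, Finset.sum_insert ha, D.leibniz,
      ih fun i hi => h i (Finset.mem_insert_of_mem hi), h a (Finset.mem_insert_self a s)]
    simp only [smul_eq_mul]
    ring

section PowerSeries

open PowerSeries

variable {A : Type*} [CommRing A]

/-- The geometric series `∑ aⁿ Tⁿ` is the inverse of `1 - a T`. -/
theorem mk_pow_mul_one_sub_C_mul_X (a : A) :
    (mk fun n => a ^ n) * (1 - C a * X) = (1 : A⟦X⟧) := by
  ext n
  rw [mul_sub, mul_one, mul_left_comm, map_sub, coeff_C_mul]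
  cases n with
  | zero => simp
  | succ n => simp [coeff_succ_mul_X, coeff_one, pow_succ']

theorem derivative_one_sub_C_mul_X (a : A) :
    derivative A (1 - C a * X) = -(C a * mk fun n => a ^ n) * (1 - C a * X) := by
  rw [neg_mul, mul_assoc, mk_pow_mul_one_sub_C_mul_X]
  simp [Derivation.leibniz]

theorem derivative_mk_pow (a : A) :
    derivative A (mk fun n => a ^ n) = (C a * mk fun n => a ^ n) * mk fun n => a ^ n := by
  have h1 := mk_pow_mul_one_sub_C_mul_X a
  have h := congrArg (derivative A) h1
  rw [Derivation.leibniz, derivative_one_sub_C_mul_X, Derivation.map_one_eq_zero] at h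
  simp only [smul_eq_mul] at h
  generalize (mk fun n => a ^ n : A⟦X⟧) = g at *
  linear_combination g * h + (C a * g * g - derivative A g) * h1

theorem derivative_prod_one_sub_C_mul_X {ι : Type*} [Fintype ι] (a : ι → A) :
    derivative A (∏ i, (1 - C (a i) * X)) =
      (∑ i, -(C (a i) * mk fun n => a i ^ n)) * ∏ i, (1 - C (a i) * X) :=
  (derivative A).apply_prod_of_apply_eq_mul _ _ _ fun i _ => derivative_one_sub_C_mul_X (a i)

theorem derivative_prod_mk_pow {ι : Type*} [Fintype ι] (a : ι → A) :
    derivative A (∏ i, mk fun n => a i ^ n) =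
      (∑ i, C (a i) * mk fun n => a i ^ n) * ∏ i, mk fun n => a i ^ n :=
  (derivative A).apply_prod_of_apply_eq_mul _ _ _ fun i _ => derivative_mk_pow (a i)

end PowerSeries

/-- The generating series `∏ (1 - ξ_i T)⁻¹ ∏ (1 - η_j T)` of the polynomials `hmr m r k`. -/
noncomputable def hmrSeries (m r : ℕ) : PowerSeries (MvPolynomial (Fin m ⊕ Fin r) ℂ) :=
  (∏ t : Fin m, PowerSeries.mk fun n => MvPolynomial.X (Sum.inl t) ^ n) *
    ∏ t : Fin r, (1 - PowerSeries.C (MvPolynomial.X (Sum.inr t)) * PowerSeries.X)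

theorem coeff_prod_mk_pow (m r i : ℕ) :
    PowerSeries.coeff i (∏ t : Fin m, PowerSeries.mk fun n =>
      (MvPolynomial.X (Sum.inl t) : MvPolynomial (Fin m ⊕ Fin r) ℂ) ^ n) = hcomplete m r i := by
  rw [PowerSeries.coeff_prod, hcomplete]
  refine Finset.sum_bij' (fun l _ => ⇑l) (fun μ _ => Finsupp.equivFunOnFinite.symm μ)
    ?_ ?_ ?_ ?_ ?_
  · intro l hl
    have hl := (Finset.mem_finsuppAntidiag.mp hl).1
    simp only [Finset.mem_filter, Fintype.mem_piFinset, Finset.mem_range]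
    exact ⟨fun t => Nat.lt_succ_of_le (hl ▸ Finset.single_le_sum (f := l) (fun _ _ => Nat.zero_le _)
      (Finset.mem_univ t)), hl⟩
  · intro μ hμ
    simpa [Finset.mem_finsuppAntidiag] using (Finset.mem_filter.mp hμ).2
  · intro l _
    ext; simp
  · intro μ _
    ext; simp
  · intro l _
    simp

theorem coeff_prod_one_sub (m r j : ℕ) :
    PowerSeries.coeff j (∏ t : Fin r, (1 - PowerSeries.C
      (MvPolynomial.X (Sum.inr t) : MvPolynomial (Fin m ⊕ Fin r) ℂ) * PowerSeries.X)) =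
      (-1) ^ j * esymEta m r j := by
  simp_rw [sub_eq_add_neg, Finset.prod_one_add, esymEta, map_sum, Finset.powerset_univ,
    Finset.sum_filter, Finset.mul_sum]
  refine Finset.sum_congr rfl fun S _ => ?_
  rw [Finset.prod_neg, Finset.prod_mul_distrib, Finset.prod_const, ← map_prod, ← mul_assoc,
    PowerSeries.coeff_mul_X_pow']
  have hneg : ((-1) ^ S.card : PowerSeries (MvPolynomial (Fin m ⊕ Fin r) ℂ)) =
      PowerSeries.C ((-1) ^ S.card) := by simp
  rw [hneg, ← map_mul, PowerSeries.coeff_C]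
  split_ifs <;> first | omega | simp_all

theorem esymEta_eq_zero {m r j : ℕ} (hj : r < j) : esymEta m r j = 0 := by
  refine Finset.sum_eq_zero fun S hS => ?_
  have := (Finset.mem_filter.mp hS).2
  have := Finset.card_le_univ S
  simp at this
  omega

theorem coeff_hmrSeries (m r k : ℕ) : PowerSeries.coeff k (hmrSeries m r) = hmr m r k := by
  rw [hmrSeries, mul_comm, PowerSeries.coeff_mul, Finset.Nat.sum_antidiagonal_eq_sum_range_succ_mk]
  simp only [coeff_prod_mk_pow, coeff_prod_one_sub, hmr]
  rw [← Finset.sum_filter]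
  symm
  refine Finset.sum_subset_zero_on_sdiff (fun j hj => ?_) (fun j hj => ?_) fun j _ => by ring
  · simp only [Finset.mem_filter, Finset.mem_range] at hj ⊢
    omega
  · simp only [Finset.mem_sdiff, Finset.mem_filter, Finset.mem_range] at hj
    rw [esymEta_eq_zero (by omega)]
    simp

/-- The supersymmetric power sum `∑ ξ_i ^ k - ∑ η_j ^ k`. -/
noncomputable def superPsum (m r k : ℕ) : MvPolynomial (Fin m ⊕ Fin r) ℂ :=
  ∑ t : Fin m, MvPolynomial.X (Sum.inl t) ^ k - ∑ t : Fin r, MvPolynomial.X (Sum.inr t) ^ k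

theorem derivative_hmrSeries (m r : ℕ) :
    PowerSeries.derivative _ (hmrSeries m r) =
      (PowerSeries.mk fun n => superPsum m r (n + 1)) * hmrSeries m r := by
  rw [hmrSeries, Derivation.leibniz,
    derivative_prod_mk_pow fun t : Fin m => MvPolynomial.X (Sum.inl t),
    derivative_prod_one_sub_C_mul_X fun t : Fin r => MvPolynomial.X (Sum.inr t)]
  have hp : (PowerSeries.mk fun n => superPsum m r (n + 1)) =
      (∑ t : Fin m, PowerSeries.C (MvPolynomial.X (Sum.inl t)) *
        PowerSeries.mk fun n => MvPolynomial.X (Sum.inl t) ^ n) +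
      ∑ t : Fin r, -(PowerSeries.C (MvPolynomial.X (Sum.inr t)) *
        PowerSeries.mk fun n => MvPolynomial.X (Sum.inr t) ^ n) := by
    ext1 n
    simp only [PowerSeries.coeff_mk, map_add, map_sum, map_neg, PowerSeries.coeff_C_mul,
      Finset.sum_neg_distrib, superPsum, pow_succ', sub_eq_add_neg]
  rw [hp]
  simp only [smul_eq_mul]
  ring

/-- Newton's identity for the polynomials `hmr m r k`. -/
theorem succ_mul_hmr (m r n : ℕ) :
    hmr m r (n + 1) * (n + 1) =
      ∑ p ∈ Finset.HasAntidiagonal.antidiagonal n, superPsum m r (p.1 + 1) * hmr m r p.2 := by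
  have h := congrArg (PowerSeries.coeff n) (derivative_hmrSeries m r)
  simpa [PowerSeries.coeff_derivative, PowerSeries.coeff_mul, coeff_hmrSeries] using h

theorem hmr_zero (m r : ℕ) : hmr m r 0 = 1 := by
  rw [← coeff_hmrSeries, PowerSeries.coeff_zero_eq_constantCoeff_apply, hmrSeries]
  simp [map_prod]

theorem derivation_superPsum_eq_zero {m r N : ℕ} {M : Type*} [AddCommGroup M]
    [Module (MvPolynomial (Fin m ⊕ Fin r) ℂ) M] [Module ℂ M]
    (D : Derivation ℂ (MvPolynomial (Fin m ⊕ Fin r) ℂ) M)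
    (hD : ∀ k < N, D (hmr m r (k + 1)) = 0) : ∀ k < N, D (superPsum m r (k + 1)) = 0 := by
  have hD' (k : ℕ) (hk : k ≤ N) : D (hmr m r k) = 0 := by
    cases k with
    | zero => rw [hmr_zero, D.map_one_eq_zero]
    | succ k => exact hD k hk
  intro n
  induction n using Nat.strong_induction_on with
  | _ n ih =>
    intro hn
    have h := congrArg D (succ_mul_hmr m r n)
    rw [D.leibniz, hD n hn, map_sum] at h
    rw [Finset.sum_eq_single_of_mem (n, 0) (by simp)] at h
    · simpa [hmr_zero, D.map_natCast] using h.symm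
    · rintro ⟨a, b⟩ hab hne
      have hab : a + b = n := Finset.HasAntidiagonal.mem_antidiagonal.mp hab
      have hb : b ≠ 0 := fun hb => hne (by simp_all)
      rw [D.leibniz, hD' b (by omega), ih a (by omega) (by omega), smul_zero, smul_zero, add_zero]

/-- The polynomials `h_{m,r}^{(k)}`, `k = 1, …, m + r`, are
algebraically independent over `ℂ`. -/
theorem hmr_algebraicIndependent (m r : ℕ) :
    AlgebraicIndependent ℂ (fun k : Fin (m + r) => hmr m r (k.1 + 1)) := by
  refine algebraicIndependent_of_derivation_eq_zero (by simp) _ fun D hD => ?_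
  have hp := derivation_superPsum_eq_zero D (N := m + r) fun k hk => hD ⟨k, hk⟩
  let K := FractionRing (MvPolynomial (Fin m ⊕ Fin r) ℂ)
  let x (i : Fin m ⊕ Fin r) : K :=
    algebraMap (MvPolynomial (Fin m ⊕ Fin r) ℂ) K (MvPolynomial.X i)
  let v (i : Fin m ⊕ Fin r) : K := Sum.elim (fun _ => 1) (fun _ => -1) i * D (MvPolynomial.X i)
  have hx : Function.Injective x :=
    (IsFractionRing.injective _ K).comp (MvPolynomial.X_injective)
  have hv : v ∘ finSumFinEquiv.symm = 0 := by
    refine Matrix.eq_zero_of_forall_pow_sum_mul_pow_eq_zero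
      (hx.comp finSumFinEquiv.symm.injective) fun k => ?_
    refine (Equiv.sum_comp finSumFinEquiv.symm fun i => v i * x i ^ (k : ℕ)).trans ?_
    have h := hp k k.2
    simp only [superPsum, map_sub, map_sum, D.leibniz_pow, Nat.add_sub_cancel,
      ← Finset.smul_sum, ← smul_sub] at h
    have h := (smul_eq_zero.mp h).resolve_left (Nat.succ_ne_zero _)
    rw [Fintype.sum_sum_type, ← h, sub_eq_add_neg, ← Finset.sum_neg_distrib]
    congr 1 <;> refine Finset.sum_congr rfl fun t _ => ?_
    · rw [Algebra.smul_def, map_pow, mul_comm, show v (Sum.inl t) = _ from one_mul _]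
    · rw [Algebra.smul_def, map_pow, mul_comm, ← mul_neg,
        show v (Sum.inr t) = _ from neg_one_mul _]
  intro i
  have hi := congrFun hv (finSumFinEquiv i)
  cases i <;> simpa [v] using hi
end

section
/- Elementary product identity: for every odd function [·] : ℂ → ℂ (so [−x] = −[x]), every δ ∈ ℂ, every m ∈ ℤ_{≥0}, every μ ∈ ℤ_{≥0}^m, and every x ∈ ℂ^m such that [x_i−x_j] ≠ 0 for all i < j, [x_i−x_j+δ]_{μ_i} ≠ 0 for all i, j, and [x_i−x_j−δμ_j]_{μ_i} ≠ 0 for all i, j, one has ∏_{1≤i<j≤m} [x_i−x_j+(μ_i−μ_j)δ]/[x_i−x_j] · ∏_{i,j=1}^m 1/[x_i−x_j+δ]_{μ_i} = (−1)^{|μ|} ∏_{i,j=1}^m 1/[x_i−x_j−δμ_j]_{μ_i}. -/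
open Finset

/-- A double product splits into its diagonal part and a product over unordered pairs. -/
lemma prod_prod_eq_diag_mul_prod_lt {ι M : Type*} [Fintype ι] [LinearOrder ι] [CommMonoid M]
    (f : ι → ι → M) :
    ∏ i, ∏ j, f i j = (∏ i, f i i) * ∏ i, ∏ j, if i < j then f i j * f j i else 1 := by
  have hsplit : ∀ i j, f i j =
      (if i = j then f i j else 1) * ((if i < j then f i j else 1) *
        (if j < i then f i j else 1)) := by
    intro i j
    rcases lt_trichotomy i j with h | h | h
    · simp [h, h.ne, h.not_gt]
    · simp [h]
    · simp [h, h.ne', h.not_gt]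
  have hpair : ∀ i j, (if i < j then f i j * f j i else 1) =
      (if i < j then f i j else 1) * (if i < j then f j i else 1) := by
    intro i j
    split_ifs <;> simp
  rw [prod_congr rfl fun i _ => prod_congr rfl fun j _ => hsplit i j]
  simp only [hpair, prod_mul_distrib, prod_ite_eq, mem_univ, if_true]
  rw [prod_comm (f := fun i j => if j < i then f i j else 1)]

lemma sfac_natCast (br : ℂ → ℂ) (a x : ℂ) (k : ℕ) :
    sfac br a x (k : ℤ) = ∏ i ∈ range k, br (x + (i : ℂ) * a) := by
  simp [sfac]

lemma sfac_natCast_add (br : ℂ → ℂ) (a x : ℂ) (k l : ℕ) :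
    sfac br a x ((k + l : ℕ) : ℤ) = sfac br a x (k : ℤ) * sfac br a (x + k * a) (l : ℤ) := by
  simp only [sfac_natCast, prod_range_add]
  congr 1
  refine prod_congr rfl fun i _ => ?_
  push_cast
  ring_nf

lemma sfac_one (br : ℂ → ℂ) (a x : ℂ) : sfac br a x ((1 : ℕ) : ℤ) = br x := by
  rw [sfac_natCast]
  simp

/-- Reversal of a shifted factorial of an odd function. -/
lemma sfac_neg (br : ℂ → ℂ) (hodd : ∀ z : ℂ, br (-z) = -br z) (a x : ℂ) (k : ℕ) :
    sfac br a (-x) (k : ℤ) = (-1) ^ k * sfac br a (x - k * a + a) (k : ℤ) := by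
  rw [sfac_natCast, sfac_natCast, ← prod_range_reflect, ← card_range k, ← prod_const,
    card_range, ← prod_mul_distrib]
  refine prod_congr rfl fun i hi => ?_
  have hk : i + 1 ≤ k := mem_range.mp hi
  rw [neg_one_mul, ← hodd, Nat.sub_sub, Nat.cast_sub (by omega)]
  push_cast
  ring_nf

lemma br_mul_sfac_mul_sfac (br : ℂ → ℂ) (hodd : ∀ z : ℂ, br (-z) = -br z) (δ z : ℂ) (k l : ℕ) :
    br (z + ((k : ℂ) - l) * δ) * (sfac br δ (z - δ * l) (k : ℤ) * sfac br δ (-z - δ * k) (l : ℤ))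
      = br z * (sfac br δ (z + δ) (k : ℤ) * sfac br δ (-z + δ) (l : ℤ)) := by
  have hleft := sfac_natCast_add br δ (z - δ * l) k (1 + l)
  have hright := sfac_natCast_add br δ (z - δ * l) l (1 + k)
  rw [sfac_natCast_add br δ _ 1 l, sfac_one] at hleft
  rw [sfac_natCast_add br δ _ 1 k, sfac_one] at hright
  rw [show l + (1 + k) = k + (1 + l) by omega, hleft] at hright
  rw [show -z - δ * k = -(z + δ * k) by ring, show -z + δ = -(z - δ) by ring,
    sfac_neg br hodd, sfac_neg br hodd]
  rw [show z + ((k : ℂ) - l) * δ = z - δ * l + k * δ by ring,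
    show z + δ * k - l * δ + δ = z - δ * l + k * δ + (1 : ℕ) * δ by push_cast; ring,
    show z - δ - l * δ + δ = z - δ * l by ring]
  rw [show z - δ * l + l * δ = z by ring,
    show z + (1 : ℕ) * δ = z + δ by push_cast; ring] at hright
  linear_combination (-1) ^ l * hright

/-- Elementary product identity: for every odd function `[·]`,
`∏_{i<j} [x_i-x_j+(μ_i-μ_j)δ]/[x_i-x_j] · ∏_{i,j} 1/[x_i-x_j+δ]_{μ_i}
  = (-1)^{|μ|} ∏_{i,j} 1/[x_i-x_j-δμ_j]_{μ_i}`. -/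
theorem elementary_product_identity
    (br : ℂ → ℂ) (hodd : ∀ z : ℂ, br (-z) = -br z)
    (δ : ℂ) (m : ℕ) (μ : Fin m → ℕ) (x : Fin m → ℂ)
    (h1 : ∀ i j : Fin m, i < j → br (x i - x j) ≠ 0)
    (h2 : ∀ i j : Fin m, sfac br δ (x i - x j + δ) (μ i : ℤ) ≠ 0)
    (h3 : ∀ i j : Fin m, sfac br δ (x i - x j - δ * (μ j : ℂ)) (μ i : ℤ) ≠ 0) :
    (∏ i : Fin m, ∏ j : Fin m,
        if i < j then br (x i - x j + ((μ i : ℂ) - (μ j : ℂ)) * δ) / br (x i - x j) else 1)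
        * ∏ i : Fin m, ∏ j : Fin m, (sfac br δ (x i - x j + δ) (μ i : ℤ))⁻¹
      = (-1 : ℂ) ^ (∑ i, μ i)
          * ∏ i : Fin m, ∏ j : Fin m, (sfac br δ (x i - x j - δ * (μ j : ℂ)) (μ i : ℤ))⁻¹ := by
  have hdiag : ∀ i, (sfac br δ (x i - x i + δ) (μ i : ℤ))⁻¹
      = (-1) ^ μ i * (sfac br δ (x i - x i - δ * (μ i : ℂ)) (μ i : ℤ))⁻¹ := by
    intro i
    rw [show x i - x i - δ * (μ i : ℂ) = -(δ * μ i) by ring, sfac_neg br hodd,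
      show δ * (μ i : ℂ) - μ i * δ + δ = x i - x i + δ by ring, mul_inv, ← mul_assoc,
      ← inv_pow, ← mul_pow]
    norm_num
  rw [prod_prod_eq_diag_mul_prod_lt fun i j => (sfac br δ (x i - x j + δ) (μ i : ℤ))⁻¹,
    prod_prod_eq_diag_mul_prod_lt fun i j =>
      (sfac br δ (x i - x j - δ * (μ j : ℂ)) (μ i : ℤ))⁻¹,
    prod_congr rfl fun i _ => hdiag i, prod_mul_distrib, prod_pow_eq_pow_sum,
    mul_left_comm, mul_assoc]
  congr 2
  simp only [← prod_mul_distrib]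
  refine prod_congr rfl fun i _ => prod_congr rfl fun j _ => ?_
  split_ifs with hij
  · have hpair := br_mul_sfac_mul_sfac br hodd δ (x i - x j) (μ i) (μ j)
    rw [neg_sub] at hpair
    have hbr := h1 i j hij
    have hij₂ := h2 i j
    have hji₂ := h2 j i
    have hij₃ := h3 i j
    have hji₃ := h3 j i
    rw [← mul_inv, ← mul_inv, ← div_eq_mul_inv, div_div, ← one_div,
      div_eq_div_iff (by simp [*]) (by simp [*]), one_mul]
    exact hpair
  · simp
end

section
/- Scalar Wronski identity: fix μ ∈ ℤ_{≥0}^r and ν ∈ ℤ_{≥0}^m with |μ|+|ν| > 0, and set M := {j ∈ {1,…,m} : ν_j > 0}, N := {j ∈ {1,…,r} : μ_j > 0}. Define D_{μ,ν}(x; y) := Σ_{I ⊆ M, J ⊆ N} (−1)^{|I|+|J|+|N|} · [(|μ|+|I|−|J|)κ + (|ν|+|J|−|I|)δ] / [(|μ|−|N|)κ + (|ν|+|N|)δ] · ∏_{i∈I} ( ∏_{j∈M∖I} [x_i−x_j+δ−κ]/[x_i−x_j] · ∏_{j∈J} [x_i−y_j+δ+(μ_j−2)κ]/[x_i−y_j+(μ_j−1)κ]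 · ∏_{j∈M} [x_i−x_j−ν_jδ]/[x_i−x_j−(ν_j−1)δ−κ] · ∏_{j∈N} [x_i−y_j−δ]/[x_i−y_j−κ] ) · ∏_{i∈N∖J} ( ∏_{j∈M∖I} [y_i−x_j+δ−μ_iκ]/[y_i−x_j−(μ_i−1)κ] · ∏_{j∈J} [y_i−y_j+(μ_j−μ_i−1)κ+δ]/[y_i−y_j+(μ_j−μ_i)κ] · ∏_{j∈M} [y_i−x_j−ν_jδ−(μ_i−1)κ]/[y_i−x_j−(ν_j−1)δ−μ_iκ] · ∏_{j∈N} [y_i−y_j−(μ_i−1)κ−δ]/[y_i−y_j−μ_iκ] ). Then for every (x, y) ∈ ℂ^m × ℂ^r at which [(|μ|−|N|)κ + (|ν|+|N|)δ] ≠ 0 and all bracket values occurring in denominators of the terms are nonzero, D_{μ,ν}(x; y) = 0. -/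
open Finset
open Filter Topology

theorem Matrix.det_eq_mul_det_pivot {n : ℕ} (A : Matrix (Fin (n + 1)) (Fin (n + 1)) ℂ)
    (h : A 0 0 ≠ 0) :
    A.det = A 0 0 * (Matrix.of fun i j : Fin n =>
      A i.succ j.succ - A i.succ 0 * A 0 j.succ / A 0 0).det := by
  let B : Matrix (Fin (n + 1)) (Fin (n + 1)) ℂ := Matrix.of fun i j =>
    Fin.cases (A 0 j) (fun i' => A i'.succ j - A i'.succ 0 / A 0 0 * A 0 j) i
  have hAB : A.det = B.det := by
    refine Matrix.det_eq_of_forall_row_eq_smul_add_const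
      (fun i => Fin.cases 0 (fun i' => A i'.succ 0 / A 0 0) i) 0 rfl fun i j => ?_
    cases i using Fin.cases <;> simp [B]
  have hcol : ∀ i : Fin n, B i.succ 0 = 0 := fun i => by simp [B, h]
  rw [hAB, Matrix.det_succ_column_zero, Fin.sum_univ_succ]
  simp only [hcol, mul_zero, zero_mul, sum_const_zero, add_zero, Fin.val_zero, pow_zero, one_mul]
  congr 2
  ext i j
  simp [B]
  ring

section Bracket

variable {br : ℂ → ℂ}

theorem eventually_bracket_affine_ne_zero (hent : Differentiable ℂ br) (hnz : br ≠ 0)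
    (a : ℂ) {k : ℂ} (hk : k ≠ 0) : ∀ᶠ e in 𝓝[≠] (0 : ℂ), br (a + k * e) ≠ 0 := by
  have hg : Differentiable ℂ fun e : ℂ => br (a + k * e) := by fun_prop
  have han : AnalyticOnNhd ℂ (fun e : ℂ => br (a + k * e)) Set.univ := fun z _ =>
    hg.analyticAt z
  refine (han 0 trivial).eventually_eq_zero_or_eventually_ne_zero.resolve_left fun h0 => hnz ?_
  have hz := han.eq_of_eventuallyEq (g := 0) (fun _ _ => analyticAt_const) h0
  funext x
  have := congrFun hz ((x - a) / k)
  simpa [mul_div_cancel₀ _ hk] using this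

theorem eq_zero_of_eventually_eq_zero {F : ℂ → ℂ} (hF : ContinuousAt F 0)
    (h : ∀ᶠ e in 𝓝[≠] (0 : ℂ), F e = 0) : F 0 = 0 :=
  tendsto_nhds_unique (hF.tendsto.mono_left nhdsWithin_le_nhds)
    (tendsto_const_nhds.congr' (h.mono fun _ he => he.symm))

/-- Frobenius' determinant: the elliptic analogue of Cauchy's determinant. -/
theorem bracket_frobenius_det (hent : Differentiable ℂ br) (hnz : br ≠ 0)
    (hW : ∀ a b c d : ℂ,
      br (a + b) * br (a - b) * br (c + d) * br (c - d)
        + br (a + d) * br (a - d) * br (b + c) * br (b - c)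
        = br (a + c) * br (a - c) * br (b + d) * br (b - d))
    {n : ℕ} (z w : Fin n → ℂ) (t : ℂ) (h : ∀ i j, br (z i - w j) ≠ 0) :
    br t * (Matrix.of fun i j => br (z i - w j + t) / br (z i - w j)).det
      = br t ^ n * br (t + ∑ i, (z i - w i))
        * ((∏ i, ∏ j ∈ Ioi i, br (z j - z i) * br (w i - w j)) / ∏ i, ∏ j, br (z i - w j)) := by
  induction n generalizing t with
  | zero => simp
  | succ n ih =>
    suffices key : ∀ s : ℂ, br (s + (z 0 - w 0)) ≠ 0 →
        br s * (Matrix.of fun i j => br (z i - w j + s) / br (z i - w j)).det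
          - br s ^ (n + 1) * br (s + ∑ i, (z i - w i))
          * ((∏ i, ∏ j ∈ Ioi i, br (z j - z i) * br (w i - w j))
            / ∏ i, ∏ j, br (z i - w j)) = 0 by
      have hc : Continuous br := hent.continuous
      have := eq_zero_of_eventually_eq_zero (F := fun e =>
        br (t + e) * (Matrix.of fun i j => br (z i - w j + (t + e)) / br (z i - w j)).det
          - br (t + e) ^ (n + 1) * br (t + e + ∑ i, (z i - w i))
          * ((∏ i, ∏ j ∈ Ioi i, br (z j - z i) * br (w i - w j))
            / ∏ i, ∏ j, br (z i - w j))) ?_ ?_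
      · simpa [sub_eq_zero] using this
      · refine Continuous.continuousAt ?_
        have hdet : Continuous fun e : ℂ =>
            (Matrix.of fun i j => br (z i - w j + (t + e)) / br (z i - w j)).det := by
          refine Continuous.matrix_det (continuous_matrix fun i j => ?_)
          simp only [Matrix.of_apply]
          fun_prop
        fun_prop
      · filter_upwards [eventually_bracket_affine_ne_zero hent hnz (t + (z 0 - w 0)) one_ne_zero]
          with e he
        refine key _ ?_
        rwa [show t + e + (z 0 - w 0) = t + (z 0 - w 0) + 1 * e by ring]
    intro s hs
    have hz0 := h 0 0
    have hs' : br (z 0 - w 0 + s) ≠ 0 := by rwa [add_comm]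
    have IH := ih (fun i => z i.succ) (fun i => w i.succ) (s + (z 0 - w 0))
      fun i j => h _ _
    rw [Matrix.det_eq_mul_det_pivot _ (by simpa using ⟨hs', hz0⟩)]
    have hentry : (Matrix.of fun i j : Fin n =>
        (Matrix.of fun i j => br (z i - w j + s) / br (z i - w j)) i.succ j.succ
        - (Matrix.of fun i j => br (z i - w j + s) / br (z i - w j)) i.succ 0
          * (Matrix.of fun i j => br (z i - w j + s) / br (z i - w j)) 0 j.succ
          / (Matrix.of fun i j => br (z i - w j + s) / br (z i - w j)) 0 0)
        = Matrix.of fun i j : Fin n =>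
          (br s / br (s + (z 0 - w 0)) * (br (z i.succ - z 0) / br (z i.succ - w 0)))
            * (Matrix.of fun i j : Fin n => (br (w 0 - w j.succ) / br (z 0 - w j.succ))
              * (Matrix.of fun i j : Fin n =>
                br (z i.succ - w j.succ + (s + (z 0 - w 0))) / br (z i.succ - w j.succ)) i j)
                i j := by
      ext i j
      simp only [Matrix.of_apply]
      have h1 := h i.succ j.succ
      have h2 := h i.succ 0
      have h3 := h 0 j.succ
      have hw := hW ((z i.succ - w j.succ + z 0 - w 0) / 2 + s)
        ((z i.succ - w 0 + z 0 - w j.succ) / 2)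
        ((z i.succ - w j.succ - z 0 + w 0) / 2) ((z i.succ - w 0 - z 0 + w j.succ) / 2)
      ring_nf at hw hs hs' h1 h2 h3 hz0 ⊢
      field_simp
      linear_combination -hw
    rw [hentry, Matrix.det_mul_column, Matrix.det_mul_row]
    simp only [Matrix.of_apply]
    have hDa : ∏ j : Fin n, br (z 0 - w j.succ) ≠ 0 := prod_ne_zero_iff.2 fun j _ => h _ _
    have hDb : ∏ j : Fin n, br (z j.succ - w 0) ≠ 0 := prod_ne_zero_iff.2 fun j _ => h _ _
    have hDc : ∏ i : Fin n, ∏ j : Fin n, br (z i.succ - w j.succ) ≠ 0 :=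
      prod_ne_zero_iff.2 fun i _ => prod_ne_zero_iff.2 fun j _ => h _ _
    have hsum : s + (z 0 - w 0) + ∑ i : Fin n, (z i.succ - w i.succ)
        = s + ∑ i, (z i - w i) := by rw [Fin.sum_univ_succ]; ring
    rw [hsum] at IH
    simp only [Fin.prod_univ_succ (n := n), Fin.prod_Ioi_zero, Fin.prod_Ioi_succ,
      prod_mul_distrib, prod_div_distrib, prod_const, card_univ, Fintype.card_fin] at IH ⊢
    rw [add_comm (z 0 - w 0) s, eq_div_of_mul_eq hs ((mul_comm _ _).trans IH)]
    field_simp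
    ring

theorem exists_det_eq_bracket_sum (hent : Differentiable ℂ br) (hnz : br ≠ 0)
    (hW : ∀ a b c d : ℂ,
      br (a + b) * br (a - b) * br (c + d) * br (c - d)
        + br (a + d) * br (a - d) * br (b + c) * br (b - c)
        = br (a + c) * br (a - c) * br (b + d) * br (b - d))
    {k : ℕ} (w : Fin (k + 1) → ℂ) (hw : ∀ i j, i ≠ j → br (w i - w j) ≠ 0) :
    ∃ f : Fin (k + 1) → ℂ → ℂ, (∀ u, f 0 u = 1) ∧ ∃ C : ℂ, C ≠ 0 ∧
      ∀ z : Fin (k + 1) → ℂ, (∀ i j, br (z i - w j) ≠ 0) →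
        (Matrix.of fun i j => f j (z i)).det
          = C * (br (∑ i, (z i - w i)) * (∏ i, ∏ j ∈ Ioi i, br (z j - z i))
            / ∏ i, ∏ j, br (z i - w j)) := by
  obtain ⟨s, hs, hsw⟩ : ∃ s, br s ≠ 0 ∧ ∀ j : Fin k, br (w 0 - w j.succ + s) ≠ 0 := by
    have h1 := eventually_bracket_affine_ne_zero hent hnz 0 one_ne_zero
    have h2 := eventually_all.2 fun j : Fin k =>
      eventually_bracket_affine_ne_zero hent hnz (w 0 - w j.succ) one_ne_zero
    obtain ⟨s, hs1, hs2⟩ := (h1.and h2).exists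
    exact ⟨s, by simpa using hs1, by simpa using hs2⟩
  refine ⟨fun j u => Fin.cases 1 (fun j' => br (u - w j'.succ + s) * br (u - w 0 - s)
    / (br (u - w j'.succ) * br (u - w 0))) j, fun u => rfl,
    (∏ j : Fin k, br s * br (w 0 - w j.succ + s))
      * ∏ i : Fin k, ∏ j ∈ Ioi i, br (w i.succ - w j.succ), ?_, fun z hz => ?_⟩
  · refine mul_ne_zero (prod_ne_zero_iff.2 fun j _ => mul_ne_zero hs (hsw j))
      (prod_ne_zero_iff.2 fun i _ => prod_ne_zero_iff.2 fun j hj => hw _ _ ?_)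
    exact fun h => (mem_Ioi.1 hj).ne (Fin.succ_injective _ h)
  rw [Matrix.det_eq_mul_det_pivot _ (by simp)]
  have hz0 := hz 0 0
  have hentry : ∀ f : Fin (k + 1) → ℂ → ℂ, (f = fun j u => Fin.cases 1 (fun j' =>
      br (u - w j'.succ + s) * br (u - w 0 - s) / (br (u - w j'.succ) * br (u - w 0))) j) →
      (Matrix.of fun i j : Fin k =>
        (Matrix.of fun i j => f j (z i)) i.succ j.succ
        - (Matrix.of fun i j => f j (z i)) i.succ 0
          * (Matrix.of fun i j => f j (z i)) 0 j.succ
          / (Matrix.of fun i j => f j (z i)) 0 0)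
      = Matrix.of fun i j : Fin k => (br (z i.succ - z 0) / br (z i.succ - w 0))
          * (Matrix.of fun i j : Fin k =>
            (br s * br (w 0 - w j.succ + s) / (br (z 0 - w j.succ) * br (z 0 - w 0)))
            * (Matrix.of fun i j : Fin k =>
              br (z i.succ - w j.succ + (z 0 - w 0)) / br (z i.succ - w j.succ)) i j) i j := by
    rintro f rfl
    ext i j
    simp only [Matrix.of_apply, Fin.cases_zero, Fin.cases_succ]
    have h1 := hz i.succ j.succ
    have h2 := hz i.succ 0
    have h3 := hz 0 j.succ
    have hw := hW (z i.succ - (w j.succ + w 0) / 2) (z 0 - (w j.succ + w 0) / 2)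
      ((w 0 - w j.succ) / 2 + s) ((w 0 - w j.succ) / 2)
    ring_nf at hw hz0 h1 h2 h3 ⊢
    field_simp
    linear_combination -hw
  rw [hentry _ rfl, Matrix.det_mul_column, Matrix.det_mul_row]
  have hF := bracket_frobenius_det hent hnz hW (fun i : Fin k => z i.succ) (fun i => w i.succ)
    (z 0 - w 0) fun i j => hz _ _
  have hDa : ∏ j : Fin k, br (z 0 - w j.succ) ≠ 0 := prod_ne_zero_iff.2 fun j _ => hz _ _
  have hDb : ∏ j : Fin k, br (z j.succ - w 0) ≠ 0 := prod_ne_zero_iff.2 fun j _ => hz _ _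
  have hDc : ∏ i : Fin k, ∏ j : Fin k, br (z i.succ - w j.succ) ≠ 0 :=
    prod_ne_zero_iff.2 fun i _ => prod_ne_zero_iff.2 fun j _ => hz _ _
  rw [← Fin.sum_univ_succ (fun i => z i - w i)] at hF
  simp only [Matrix.of_apply, Fin.cases_zero, Fin.prod_univ_succ (n := k), Fin.prod_Ioi_zero,
    Fin.prod_Ioi_succ, prod_mul_distrib, prod_div_distrib, prod_const, card_univ,
    Fintype.card_fin] at hF ⊢
  rw [eq_div_of_mul_eq hz0 ((mul_comm _ _).trans hF)]
  field_simp

theorem prod_Ioi_bracket_shift (hodd : ∀ z : ℂ, br (-z) = -br z) {n : ℕ} (z : Fin n → ℂ)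
    (hz : ∀ i j, i ≠ j → br (z i - z j) ≠ 0) (c : ℂ) (K : Finset (Fin n)) :
    ∏ i, ∏ j ∈ Ioi i, br ((z j - if j ∈ K then 0 else c) - (z i - if i ∈ K then 0 else c))
      = (∏ i, ∏ j ∈ Ioi i, br (z j - z i))
        * ∏ i ∈ K, ∏ j ∈ Kᶜ, br (z i - z j + c) / br (z i - z j) := by
  let g : Fin n → Fin n → ℂ := fun i j =>
    if i ∈ K ∧ j ∉ K then br (z i - z j + c) / br (z i - z j) else 1
  have hg : ∏ i ∈ K, ∏ j ∈ Kᶜ, br (z i - z j + c) / br (z i - z j)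
      = ∏ i, ∏ j ∈ Ioi i, g j i * g i j := by
    have hoff : ∏ i, ∏ j ∈ Ioi i, g j i * g i j = ∏ i, ∏ j ∈ {i}ᶜ, g i j := by
      rw [prod_prod_Ioi_mul_eq_prod_prod_off_diag]
      exact prod_comm' (by simp [eq_comm])
    rw [hoff, ← prod_subset (subset_univ K) fun i _ hi => prod_eq_one fun j _ => by simp [g, hi]]
    refine prod_congr rfl fun i hi => ?_
    rw [← prod_subset (s₁ := Kᶜ) (s₂ := {i}ᶜ)
      (fun j hj => by simp only [mem_compl, mem_singleton] at hj ⊢; rintro rfl; exact hj hi)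
      fun j _ hj => by simp at hj; simp [g, hj]]
    exact prod_congr rfl fun j hj => by simp at hj; simp [g, hi, hj]
  rw [hg, ← prod_mul_distrib]
  refine prod_congr rfl fun i _ => ?_
  rw [← prod_mul_distrib]
  refine prod_congr rfl fun j hj => ?_
  have hne : i ≠ j := (mem_Ioi.1 hj).ne
  have h1 := hz i j hne
  have h2 := hz j i hne.symm
  by_cases hi : i ∈ K <;> by_cases hj : j ∈ K <;> simp only [g, hi, hj] <;> simp
  · have e1 : br (z j - c - z i) = -br (z i - z j + c) := by rw [← hodd]; ring_nf
    have e2 : br (z j - z i) = -br (z i - z j) := by rw [← hodd]; ring_nf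
    rw [e1, e2]
    field_simp
  · rw [mul_div_cancel₀ _ h2]; ring_nf

/-- The subset identity, away from the zeros of auxiliary brackets. -/
theorem bracket_sum_subsets_eq_zero_of_generic
    (hodd : ∀ z : ℂ, br (-z) = -br z) (hent : Differentiable ℂ br) (hnz : br ≠ 0)
    (hW : ∀ a b c d : ℂ,
      br (a + b) * br (a - b) * br (c + d) * br (c - d)
        + br (a + d) * br (a - d) * br (b + c) * br (b - c)
        = br (a + c) * br (a - c) * br (b + d) * br (b - d))
    {k : ℕ} (z w : Fin (k + 1) → ℂ) (c : ℂ)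
    (hz : ∀ i j, i ≠ j → br (z i - z j) ≠ 0) (hw : ∀ i j, i ≠ j → br (w i - w j) ≠ 0)
    (hzw : ∀ i j, br (z i - w j) ≠ 0) (hzwc : ∀ i j, br (z i - w j - c) ≠ 0) :
    ∑ K : Finset (Fin (k + 1)), (-1 : ℂ) ^ #K
        * br ((∑ i, (w i - z i)) + (((k + 1 : ℕ) : ℂ) - (#K : ℂ)) * c)
        * (∏ i ∈ K, ∏ j ∈ Kᶜ, br (z i - z j + c) / br (z i - z j))
        * ∏ i ∈ K, ∏ j, br (z i - w j - c) / br (z i - w j) = 0 := by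
  obtain ⟨f, hf0, C, hC, hdet⟩ := exists_det_eq_bracket_sum hent hnz hW w hw
  let R : Fin (k + 1) → Fin (k + 1) → ℂ := fun i j => f j (z i)
  let R' : Fin (k + 1) → Fin (k + 1) → ℂ := fun i j => f j (z i - c)
  let Z : Finset (Fin (k + 1)) → Fin (k + 1) → ℂ := fun K i => z i - if i ∈ K then 0 else c
  have hexp : ∑ K : Finset (Fin (k + 1)), (-1 : ℂ) ^ #K
      * (Matrix.of fun i j => f j (Z K i)).det = 0 := by
    have h0 : (Matrix.of (-R + R')).det = 0 :=
      Matrix.det_eq_zero_of_column_eq_zero 0 fun i => by simp [R, R', hf0]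
    rw [← h0]
    refine Eq.trans (sum_congr rfl fun K _ => ?_)
      (MultilinearMap.map_add_univ
        (Matrix.detRowAlternating (n := Fin (k + 1)) (R := ℂ)).toMultilinearMap (-R) R').symm
    have := MultilinearMap.map_piecewise_smul
      (Matrix.detRowAlternating (n := Fin (k + 1)) (R := ℂ)).toMultilinearMap
      (fun _ => (-1 : ℂ)) (fun i j => f j (Z K i)) K
    rw [prod_const, smul_eq_mul] at this
    refine this.symm.trans (congrArg _ ?_)
    funext i
    by_cases hi : i ∈ K
    · rw [piecewise_eq_of_mem _ _ _ hi, piecewise_eq_of_mem _ _ _ hi]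
      funext j
      simp [hi, R, Z]
    · rw [piecewise_eq_of_notMem _ _ _ hi, piecewise_eq_of_notMem _ _ _ hi]
      funext j
      simp [hi, R', Z]
  have hP : ∏ i, ∏ j, br (z i - w j - c) ≠ 0 :=
    prod_ne_zero_iff.2 fun i _ => prod_ne_zero_iff.2 fun j _ => hzwc i j
  have hD : ∏ i, ∏ j ∈ Ioi i, br (z j - z i) ≠ 0 :=
    prod_ne_zero_iff.2 fun i _ => prod_ne_zero_iff.2 fun j hj => hz _ _ (mem_Ioi.1 hj).ne'
  rw [← mul_zero (-(∏ i, ∏ j, br (z i - w j - c))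
    / (C * ∏ i, ∏ j ∈ Ioi i, br (z j - z i))), ← hexp, mul_sum]
  refine sum_congr rfl fun K _ => ?_
  have hZ : ∀ i j, br (Z K i - w j) ≠ 0 := fun i j => by
    by_cases hi : i ∈ K
    · simpa [Z, hi] using hzw i j
    · simpa [Z, hi, sub_right_comm] using hzwc i j
  have hQ : ∏ i, ∏ j, br (Z K i - w j) ≠ 0 :=
    prod_ne_zero_iff.2 fun i _ => prod_ne_zero_iff.2 fun j _ => hZ i j
  have hratio : ∏ i ∈ K, ∏ j, br (z i - w j - c) / br (z i - w j)
      = (∏ i, ∏ j, br (z i - w j - c)) / ∏ i, ∏ j, br (Z K i - w j) := by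
    simp only [← prod_div_distrib]
    rw [← prod_subset (subset_univ K) fun i _ hi => prod_eq_one fun j _ => ?_]
    · exact prod_congr rfl fun i hi => by simp [Z, hi]
    · have := hzwc i j
      simp only [Z, hi, if_false, sub_right_comm _ c]
      exact div_self this
  have hsum : br (∑ i, (Z K i - w i))
      = -br ((∑ i, (w i - z i)) + (((k + 1 : ℕ) : ℂ) - (#K : ℂ)) * c) := by
    rw [← hodd]
    congr 1
    have : ∑ i, (if i ∈ K then (0 : ℂ) else c) = (((k + 1 : ℕ) : ℂ) - (#K : ℂ)) * c := by
      have h1 : ∀ i, (if i ∈ K then (0 : ℂ) else c) = c - if i ∈ K then c else 0 := fun i => by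
        split_ifs <;> simp
      simp only [h1, sum_sub_distrib, sum_ite_mem, univ_inter, sum_const, card_univ,
        Fintype.card_fin, nsmul_eq_mul]
      ring
    simp only [Z, sum_sub_distrib, this]
    ring
  rw [hdet _ hZ, prod_Ioi_bracket_shift hodd z hz c K, hsum, hratio]
  field_simp

theorem bracket_sum_subsets_eq_zero
    (hodd : ∀ z : ℂ, br (-z) = -br z) (hent : Differentiable ℂ br) (hnz : br ≠ 0)
    (hW : ∀ a b c d : ℂ,
      br (a + b) * br (a - b) * br (c + d) * br (c - d)
        + br (a + d) * br (a - d) * br (b + c) * br (b - c)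
        = br (a + c) * br (a - c) * br (b + d) * br (b - d))
    {k : ℕ} (z w : Fin (k + 1) → ℂ) (c : ℂ)
    (hz : ∀ i j, i ≠ j → br (z i - z j) ≠ 0) (hzw : ∀ i j, br (z i - w j) ≠ 0) :
    ∑ K : Finset (Fin (k + 1)), (-1 : ℂ) ^ #K
        * br ((∑ i, (w i - z i)) + (((k + 1 : ℕ) : ℂ) - (#K : ℂ)) * c)
        * (∏ i ∈ K, ∏ j ∈ Kᶜ, br (z i - z j + c) / br (z i - z j))
        * ∏ i ∈ K, ∏ j, br (z i - w j - c) / br (z i - w j) = 0 := by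
  have hc : Continuous br := hent.continuous
  let W : ℂ → Fin (k + 1) → ℂ := fun e i => w i + ((i : ℕ) + 1 : ℂ) * e
  have hW0 : W 0 = w := by funext i; simp [W]
  have hWc : ∀ i, Continuous fun e => W e i := fun i => by simp only [W]; fun_prop
  have hco : ∀ i : Fin (k + 1), -(((i : ℕ) : ℂ) + 1) ≠ 0 := fun i =>
    neg_ne_zero.2 (Nat.cast_add_one_ne_zero _)
  have := eq_zero_of_eventually_eq_zero (F := fun e =>
    ∑ K : Finset (Fin (k + 1)), (-1 : ℂ) ^ #K
        * br ((∑ i, (W e i - z i)) + (((k + 1 : ℕ) : ℂ) - (#K : ℂ)) * c)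
        * (∏ i ∈ K, ∏ j ∈ Kᶜ, br (z i - z j + c) / br (z i - z j))
        * ∏ i ∈ K, ∏ j, br (z i - W e j - c) / br (z i - W e j)) ?_ ?_
  · simpa only [hW0] using this
  · refine tendsto_finsetSum _ fun K _ => ContinuousAt.mul ?_ ?_
    · exact Continuous.continuousAt (by fun_prop)
    · refine tendsto_finsetProd _ fun i _ => tendsto_finsetProd _ fun j _ => ?_
      exact ContinuousAt.div (Continuous.continuousAt (by fun_prop))
        (Continuous.continuousAt (by fun_prop)) (by rw [hW0]; exact hzw i j)
  · have h1 := eventually_all.2 fun i : Fin (k + 1) => eventually_all.2 fun j : Fin (k + 1) =>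
      eventually_bracket_affine_ne_zero hent hnz (z i - w j) (hco j)
    have h2 := eventually_all.2 fun i : Fin (k + 1) => eventually_all.2 fun j : Fin (k + 1) =>
      eventually_bracket_affine_ne_zero hent hnz (z i - w j - c) (hco j)
    have h3 : ∀ᶠ e in 𝓝[≠] (0 : ℂ), ∀ i j : Fin (k + 1), i ≠ j → br (W e i - W e j) ≠ 0 := by
      refine eventually_all.2 fun i => eventually_all.2 fun j => ?_
      by_cases hij : i = j
      · simp [hij]
      have hne : ((i : ℕ) : ℂ) - ((j : ℕ) : ℂ) ≠ 0 :=
        sub_ne_zero.2 fun h => hij (Fin.ext (Nat.cast_injective h))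
      filter_upwards [eventually_bracket_affine_ne_zero hent hnz (w i - w j) hne] with e he _
      convert he using 2
      simp only [W]; ring
    filter_upwards [h1, h2, h3] with e h1 h2 h3
    refine bracket_sum_subsets_eq_zero_of_generic hodd hent hnz hW z (W e) c hz h3 ?_ ?_
    · intro i j
      convert h1 i j using 2
      simp only [W]; ring
    · intro i j
      convert h2 i j using 2
      simp only [W]; ring

theorem bracket_sum_powerset_eq_zero
    (hodd : ∀ z : ℂ, br (-z) = -br z) (hent : Differentiable ℂ br) (hnz : br ≠ 0)
    (hW : ∀ a b c d : ℂ,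
      br (a + b) * br (a - b) * br (c + d) * br (c - d)
        + br (a + d) * br (a - d) * br (b + c) * br (b - c)
        = br (a + c) * br (a - c) * br (b + d) * br (b - d))
    {ι : Type*} [DecidableEq ι] (T : Finset ι) (hT : T.Nonempty) (z w : ι → ℂ) (c : ℂ)
    (hz : ∀ i ∈ T, ∀ j ∈ T, i ≠ j → br (z i - z j) ≠ 0)
    (hzw : ∀ i ∈ T, ∀ j ∈ T, br (z i - w j) ≠ 0) :
    ∑ K ∈ T.powerset, (-1 : ℂ) ^ #K
        * br ((∑ i ∈ T, (w i - z i)) + ((#T : ℂ) - (#K : ℂ)) * c)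
        * (∏ i ∈ K, ∏ j ∈ T \ K, br (z i - z j + c) / br (z i - z j))
        * ∏ i ∈ K, ∏ j ∈ T, br (z i - w j - c) / br (z i - w j) = 0 := by
  obtain ⟨k, hk⟩ : ∃ k, #T = k + 1 := Nat.exists_eq_add_one.2 hT.card_pos
  let e : Fin (k + 1) ↪ ι :=
    (T.equivFinOfCardEq hk).symm.toEmbedding.trans (Function.Embedding.subtype _)
  have he : univ.map e = T := by
    ext i
    simp only [Finset.mem_map, mem_univ, true_and, e]
    refine ⟨?_, fun hi => ⟨T.equivFinOfCardEq hk ⟨i, hi⟩, by simp⟩⟩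
    rintro ⟨a, rfl⟩
    exact ((T.equivFinOfCardEq hk).symm a).2
  have heT : ∀ i, e i ∈ T := fun i => he ▸ mem_map_of_mem e (mem_univ i)
  rw [← bracket_sum_subsets_eq_zero hodd hent hnz hW (fun i => z (e i)) (fun i => w (e i)) c
    (fun i j hij => hz _ (heT i) _ (heT j) (e.injective.ne hij))
    (fun i j => hzw _ (heT i) _ (heT j))]
  symm
  refine sum_bij (fun K _ => K.map e) (fun K _ => ?_) (fun K _ K' _ h => map_injective e h)
    (fun K hK => ?_) fun K _ => ?_
  · rw [mem_powerset, ← he]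
    exact map_subset_map.2 (subset_univ K)
  · obtain ⟨L, -, hL⟩ := subset_map_iff.1 (he.symm ▸ mem_powerset.1 hK : K ⊆ univ.map e)
    exact ⟨L, mem_univ L, hL.symm⟩
  · have hc : T \ K.map e = Kᶜ.map e := by rw [compl_eq_univ_sdiff, Finset.map_sdiff, he]
    have hTs : ∀ F : ι → ℂ, ∑ i ∈ T, F i = ∑ i, F (e i) := fun F => by rw [← he, sum_map]
    have hTp : ∀ F : ι → ℂ, ∏ i ∈ T, F i = ∏ i, F (e i) := fun F => by rw [← he, prod_map]
    rw [hc]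
    simp only [hTs, hTp, hk, card_map, prod_map]

end Bracket
/-- Scalar Wronski identity: the sum `D_{μ,ν}(x; y)` vanishes
for `|μ| + |ν| > 0`, at every admissible point. -/
theorem scalar_wronski_identity
    (br : ℂ → ℂ) (hodd : ∀ z : ℂ, br (-z) = -br z)
    (hent : Differentiable ℂ br) (hnz : br ≠ 0)
    (hW : ∀ a b c d : ℂ,
      br (a + b) * br (a - b) * br (c + d) * br (c - d)
        + br (a + d) * br (a - d) * br (b + c) * br (b - c)
        = br (a + c) * br (a - c) * br (b + d) * br (b - d))
    (δ κ : ℂ)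
    (hδ : ∀ n : ℕ, 1 ≤ n → br ((n : ℂ) * δ) ≠ 0)
    (hκ : ∀ n : ℕ, 1 ≤ n → br ((n : ℂ) * κ) ≠ 0)
    (m r : ℕ) (μ : Fin r → ℕ) (ν : Fin m → ℕ)
    (hpos : 0 < (∑ j, μ j) + (∑ j, ν j))
    (M : Finset (Fin m)) (hM : M = Finset.univ.filter fun j => 0 < ν j)
    (N : Finset (Fin r)) (hN : N = Finset.univ.filter fun j => 0 < μ j)
    (x : Fin m → ℂ) (y : Fin r → ℂ)
    (h0 : br ((((∑ j, μ j : ℕ) : ℂ) - (N.card : ℂ)) * κ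
        + (((∑ j, ν j : ℕ) : ℂ) + (N.card : ℂ)) * δ) ≠ 0)
    (hden : ∀ I ∈ M.powerset, ∀ J ∈ N.powerset,
      (∀ i ∈ I,
          (∀ j ∈ M \ I, br (x i - x j) ≠ 0)
            ∧ (∀ j ∈ J, br (x i - y j + ((μ j : ℂ) - 1) * κ) ≠ 0)
            ∧ (∀ j ∈ M, br (x i - x j - ((ν j : ℂ) - 1) * δ - κ) ≠ 0)
            ∧ (∀ j ∈ N, br (x i - y j - κ) ≠ 0))
        ∧ ∀ i ∈ N \ J,
            (∀ j ∈ M \ I, br (y i - x j - ((μ i : ℂ) - 1) * κ) ≠ 0)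
              ∧ (∀ j ∈ J, br (y i - y j + ((μ j : ℂ) - (μ i : ℂ)) * κ) ≠ 0)
              ∧ (∀ j ∈ M, br (y i - x j - ((ν j : ℂ) - 1) * δ - (μ i : ℂ) * κ) ≠ 0)
              ∧ (∀ j ∈ N, br (y i - y j - (μ i : ℂ) * κ) ≠ 0)) :
    ∑ I ∈ M.powerset, ∑ J ∈ N.powerset,
        (-1 : ℂ) ^ (I.card + J.card + N.card)
          * (br ((((∑ j, μ j : ℕ) : ℂ) + (I.card : ℂ) - (J.card : ℂ)) * κ
                + (((∑ j, ν j : ℕ) : ℂ) + (J.card : ℂ) - (I.card : ℂ)) * δ)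
              / br ((((∑ j, μ j : ℕ) : ℂ) - (N.card : ℂ)) * κ
                + (((∑ j, ν j : ℕ) : ℂ) + (N.card : ℂ)) * δ))
          * (∏ i ∈ I,
              (∏ j ∈ M \ I, br (x i - x j + δ - κ) / br (x i - x j))
                * (∏ j ∈ J,
                    br (x i - y j + δ + ((μ j : ℂ) - 2) * κ)
                      / br (x i - y j + ((μ j : ℂ) - 1) * κ))
                * (∏ j ∈ M,
                    br (x i - x j - (ν j : ℂ) * δ)
                      / br (x i - x j - ((ν j : ℂ) - 1) * δ - κ))
                * ∏ j ∈ N, br (x i - y j - δ) / br (x i - y j - κ))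
          * ∏ i ∈ N \ J,
              (∏ j ∈ M \ I,
                  br (y i - x j + δ - (μ i : ℂ) * κ)
                    / br (y i - x j - ((μ i : ℂ) - 1) * κ))
                * (∏ j ∈ J,
                    br (y i - y j + ((μ j : ℂ) - (μ i : ℂ) - 1) * κ + δ)
                      / br (y i - y j + ((μ j : ℂ) - (μ i : ℂ)) * κ))
                * (∏ j ∈ M,
                    br (y i - x j - (ν j : ℂ) * δ - ((μ i : ℂ) - 1) * κ)
                      / br (y i - x j - ((ν j : ℂ) - 1) * δ - (μ i : ℂ) * κ))
                * ∏ j ∈ N,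
                    br (y i - y j - ((μ i : ℂ) - 1) * κ - δ)
                      / br (y i - y j - (μ i : ℂ) * κ)
      = 0 := by
  let T : Finset (Fin m ⊕ Fin r) := M.disjSum N
  let z : Fin m ⊕ Fin r → ℂ := Sum.elim x fun j => y j - ((μ j : ℂ) - 1) * κ
  let w : Fin m ⊕ Fin r → ℂ :=
    Sum.elim (fun j => x j + ((ν j : ℂ) - 1) * δ + κ) fun j => y j + κ
  have hT : T.Nonempty := by
    rw [nonempty_iff_ne_empty]
    intro hemp
    obtain ⟨hM0, hN0⟩ := disjSum_eq_empty.1 hemp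
    have hν : ∑ j, ν j = 0 := sum_eq_zero fun j _ => by
      by_contra hj
      have : j ∈ M := by rw [hM]; simpa using Nat.pos_of_ne_zero hj
      simp [hM0] at this
    have hμ : ∑ j, μ j = 0 := sum_eq_zero fun j _ => by
      by_contra hj
      have : j ∈ N := by rw [hN]; simpa using Nat.pos_of_ne_zero hj
      simp [hN0] at this
    omega
  have hz : ∀ i ∈ T, ∀ j ∈ T, i ≠ j → br (z i - z j) ≠ 0 := by
    rintro (i | i) hi (j | j) hj hij
    · have hi' : i ∈ M := by simpa [T] using hi
      have hj' : j ∈ M := by simpa [T] using hj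
      exact ((hden {i} (by simpa) ∅ (by simp)).1 i (by simp)).1 j
        (by simpa [hj'] using fun h : j = i => hij (by rw [h]))
    · have hi' : i ∈ M := by simpa [T] using hi
      have hj' : j ∈ N := by simpa [T] using hj
      convert ((hden {i} (by simpa) {j} (by simpa)).1 i (by simp)).2.1 j (by simp) using 2
      simp only [z, Sum.elim_inl, Sum.elim_inr]; ring
    · have hi' : i ∈ N := by simpa [T] using hi
      have hj' : j ∈ M := by simpa [T] using hj
      convert ((hden ∅ (by simp) ∅ (by simp)).2 i (by simpa)).1 j (by simpa) using 2
      simp only [z, Sum.elim_inl, Sum.elim_inr]; ring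
    · have hi' : i ∈ N := by simpa [T] using hi
      have hj' : j ∈ N := by simpa [T] using hj
      convert ((hden ∅ (by simp) {j} (by simpa)).2 i
        (by simpa [hi'] using fun h : i = j => hij (by rw [h]))).2.1 j (by simp) using 2
      simp only [z, Sum.elim_inr]; ring
  have hzw : ∀ i ∈ T, ∀ j ∈ T, br (z i - w j) ≠ 0 := by
    rintro (i | i) hi (j | j) hj
    · have hi' : i ∈ M := by simpa [T] using hi
      have hj' : j ∈ M := by simpa [T] using hj
      convert ((hden {i} (by simpa) ∅ (by simp)).1 i (by simp)).2.2.1 j hj' using 2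
      simp only [z, w, Sum.elim_inl]; ring
    · have hi' : i ∈ M := by simpa [T] using hi
      have hj' : j ∈ N := by simpa [T] using hj
      convert ((hden {i} (by simpa) ∅ (by simp)).1 i (by simp)).2.2.2 j hj' using 2
      simp only [z, w, Sum.elim_inl, Sum.elim_inr]; ring
    · have hi' : i ∈ N := by simpa [T] using hi
      have hj' : j ∈ M := by simpa [T] using hj
      convert ((hden ∅ (by simp) ∅ (by simp)).2 i (by simpa)).2.2.1 j hj' using 2
      simp only [z, w, Sum.elim_inl, Sum.elim_inr]; ring
    · have hi' : i ∈ N := by simpa [T] using hi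
      have hj' : j ∈ N := by simpa [T] using hj
      convert ((hden ∅ (by simp) ∅ (by simp)).2 i (by simpa)).2.2.2 j hj' using 2
      simp only [z, w, Sum.elim_inr]; ring
  have hsum : ∑ i ∈ T, (w i - z i) = ((∑ j, ν j : ℕ) : ℂ) * δ - (#M : ℂ) * δ + (#M : ℂ) * κ
      + ((∑ j, μ j : ℕ) : ℂ) * κ := by
    have hν : ((∑ j, ν j : ℕ) : ℂ) = ∑ j ∈ M, (ν j : ℂ) := by
      rw [Nat.cast_sum]
      refine (sum_subset (subset_univ M) fun j _ hj => ?_).symm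
      rw [hM] at hj
      simpa using hj
    have hμ : ((∑ j, μ j : ℕ) : ℂ) = ∑ j ∈ N, (μ j : ℂ) := by
      rw [Nat.cast_sum]
      refine (sum_subset (subset_univ N) fun j _ hj => ?_).symm
      rw [hN] at hj
      simpa using hj
    have h1 : ∀ j, w (Sum.inl j) - z (Sum.inl j) = (ν j : ℂ) * δ - δ + κ := fun j => by
      simp only [z, w, Sum.elim_inl]; ring
    have h2 : ∀ j, w (Sum.inr j) - z (Sum.inr j) = (μ j : ℂ) * κ := fun j => by
      simp only [z, w, Sum.elim_inr]; ring
    rw [sum_disjSum]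
    simp only [h1, h2, sum_add_distrib, sum_sub_distrib, sum_const,
      nsmul_eq_mul, ← sum_mul, hν, hμ]
  have key := bracket_sum_powerset_eq_zero hodd hent hnz hW T hT z w (δ - κ) hz hzw
  rw [← mul_zero (br ((((∑ j, μ j : ℕ) : ℂ) - (N.card : ℂ)) * κ
        + (((∑ j, ν j : ℕ) : ℂ) + (N.card : ℂ)) * δ))⁻¹, ← key, mul_sum, ← sum_product']
  refine sum_bij' (fun p _ => p.1.disjSum (N \ p.2)) (fun K _ => (K.toLeft, N \ K.toRight))
    ?_ ?_ ?_ ?_ ?_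
  · rintro ⟨I, J⟩ hp
    simp only [mem_product, mem_powerset] at hp
    exact mem_powerset.2 (disjSum_mono hp.1 sdiff_subset)
  · intro K hK
    rw [mem_powerset, subset_disjSum] at hK
    simp only [mem_product, mem_powerset]
    exact ⟨hK.1, sdiff_subset⟩
  · rintro ⟨I, J⟩ hp
    simp only [mem_product, mem_powerset] at hp
    simp [inter_eq_right.2 hp.2]
  · intro K hK
    rw [mem_powerset, subset_disjSum] at hK
    simp only [sdiff_sdiff_right_self, inf_eq_inter, inter_eq_right.2 hK.2,
      toLeft_disjSum_toRight]
  · rintro ⟨I, J⟩ hp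
    simp only [mem_product, mem_powerset] at hp
    have hJ := hp.2
    have hTK : T \ I.disjSum (N \ J) = (M \ I).disjSum J := by
      ext (i | i)
      · simp [T]
      · simp only [T, Finset.mem_sdiff, inr_mem_disjSum]
        exact ⟨fun h => by_contra fun h' => h.2 ⟨h.1, h'⟩, fun h => ⟨hJ h, fun h' => h'.2 h⟩⟩
    have hcard : #(N \ J) + #J = #N := card_sdiff_add_card_eq_card hJ
    have hcardC : (#(N \ J) : ℂ) = #N - #J := by rw [← hcard]; push_cast; ring
    have hsign : (-1 : ℂ) ^ (#I + #J + #N) = (-1) ^ (#I + #(N \ J)) := by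
      rw [← hcard, show #I + #J + (#(N \ J) + #J) = #I + #(N \ J) + (#J + #J) by ring,
        pow_add _ _ (#J + #J), Even.neg_one_pow ⟨_, rfl⟩, mul_one]
    rw [hTK, hsum, hsign]
    simp only [T, card_disjSum, prod_disjSum, Nat.cast_add, hcardC, z, w, Sum.elim_inl,
      Sum.elim_inr]
    have hbr : br ((((∑ j, μ j : ℕ) : ℂ) + (#I : ℂ) - (#J : ℂ)) * κ
          + (((∑ j, ν j : ℕ) : ℂ) + (#J : ℂ) - (#I : ℂ)) * δ)
        = br (((∑ j, ν j : ℕ) : ℂ) * δ - (#M : ℂ) * δ + (#M : ℂ) * κ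
          + ((∑ j, μ j : ℕ) : ℂ) * κ
          + ((#M : ℂ) + (#N : ℂ) - ((#I : ℂ) + ((#N : ℂ) - (#J : ℂ)))) * (δ - κ)) := by
      congr 1; ring
    rw [hbr, div_eq_inv_mul]
    have hcomb : ∀ s d b P P' A A' B B' : ℂ, P = A * B → P' = A' * B' →
        s * (d * b) * P * P' = d * (s * b * (A * A') * (B * B')) := by
      rintro s d b _ _ A A' B B' rfl rfl
      ring
    refine hcomb _ _ _ _ _ _ _ _ _ ?_ ?_ <;> rw [← prod_mul_distrib] <;>
      refine prod_congr rfl fun i _ => ?_ <;> rw [← mul_assoc] <;>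
      refine congrArg₂ _ (congrArg₂ _ (congrArg₂ _ ?_ ?_) ?_) ?_ <;>
      refine prod_congr rfl fun j _ => congrArg₂ _ (congrArg br ?_) (congrArg br ?_) <;> ring
end
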